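/- arXiv:1305.7376 — 3 statements merged into one kernel-verified Lean document; each statement's English description precedes it below -/
import Mathlib

section
/- For all positive integers k and r, if a graph G does not contain k pairwise disjoint models of the complete bipartite graph K_{2,r} (i.e. the disjoint union of k copies of K_{2,r} is not a minor of G), then tw(G) < 20k^2r^2 − 8k^2r + 2r − 1. -/
open SimpleGraph

/-- A minor model of `H` in `G`: pairwise disjoint branch sets `B v ⊆ V(G)`, each
inducing a connected (hence nonempty) subgraph of `G`, such that for every edge
`{u,v}` of `H` there is an edge of `G` between `B u` and `B v`. -/
def IsMinorModel {β α : Type*} (H : SimpleGraph β) (G : SimpleGraph α)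
    (B : β → Set α) : Prop :=
  (∀ u, (G.induce (B u)).Connected) ∧
  (Pairwise fun u v => Disjoint (B u) (B v)) ∧
  (∀ u v, H.Adj u v → ∃ a ∈ B u, ∃ b ∈ B v, G.Adj a b)

/-- `H` is a minor of `G`. -/
def IsMinor {β α : Type*} (H : SimpleGraph β) (G : SimpleGraph α) : Prop :=
  ∃ B : β → Set α, IsMinorModel H G B

/-- `G` contains `k` models of `H` whose vertex sets are pairwise disjoint
(equivalently, the disjoint union of `k` copies of `H` is a minor of `G`). -/
def HasDisjointModels {β α : Type*} (H : SimpleGraph β) (G : SimpleGraph α) (k : ℕ) : Prop :=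
  ∃ M : Fin k → β → Set α, (∀ i, IsMinorModel H G (M i)) ∧
    Pairwise fun i j => Disjoint (⋃ u, M i u) (⋃ u, M j u)

/-- `pack_H(G)`: the maximum number of pairwise disjoint models of `H` in `G`. -/
noncomputable def packNumber {β α : Type*} (H : SimpleGraph β) (G : SimpleGraph α) : ℕ :=
  sSup {k | HasDisjointModels H G k}

/-- `S` meets every model of `H` in `G`. -/
def IsHittingSet {β α : Type*} (H : SimpleGraph β) (G : SimpleGraph α) (S : Set α) : Prop :=
  ∀ B : β → Set α, IsMinorModel H G B → ∃ a ∈ S, ∃ u, a ∈ B u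

/-- `cover_H(G)`: the minimum size of a set of vertices meeting every model of `H` in `G`. -/
noncomputable def coverNumber {β α : Type*} (H : SimpleGraph β) (G : SimpleGraph α) : ℕ :=
  sInf {n | ∃ S : Set α, IsHittingSet H G S ∧ S.ncard = n}

/-- A tree/path decomposition of `G` with underlying graph `T` and bags `X`. -/
def IsTreeDecomp {α ι : Type*} (G : SimpleGraph α) (T : SimpleGraph ι) (X : ι → Set α) : Prop :=
  (∀ v, ∃ t, v ∈ X t) ∧
  (∀ u v, G.Adj u v → ∃ t, u ∈ X t ∧ v ∈ X t) ∧
  (∀ v, (T.induce {t | v ∈ X t}).Connected)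

/-- The treewidth of `G`: the minimum width of a tree decomposition of `G`. -/
noncomputable def treewidth {α : Type*} (G : SimpleGraph α) : ℕ :=
  sInf {w | ∃ (ι : Type) (T : SimpleGraph ι) (X : ι → Set α),
    T.IsTree ∧ IsTreeDecomp G T X ∧ ∀ t, (X t).ncard ≤ w + 1}

/-- The pathwidth of `G`: the minimum width of a tree decomposition whose
underlying tree is a path. -/
noncomputable def pathwidth {α : Type*} (G : SimpleGraph α) : ℕ :=
  sInf {w | ∃ (n : ℕ) (X : Fin (n+1) → Set α),
    IsTreeDecomp G (pathGraph (n+1)) X ∧ ∀ t, (X t).ncard ≤ w + 1}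

/-- The degeneracy of `G`: the maximum over all (nonempty) subgraphs of `G`
of the minimum degree. -/
noncomputable def degeneracy {α : Type*} (G : SimpleGraph α) : ℕ :=
  sSup {d | ∃ G' : G.Subgraph, G'.verts.Nonempty ∧ ∀ v ∈ G'.verts, d ≤ (G'.neighborSet v).ncard}

/-- The contraction degeneracy of `G`: the maximum over all (nonempty) minors of `G`
of the minimum degree. -/
noncomputable def contractionDegeneracy {α : Type*} (G : SimpleGraph α) : ℕ :=
  sSup {d | ∃ (n : ℕ) (H : SimpleGraph (Fin n)), 0 < n ∧ IsMinor H G ∧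
    ∀ v, d ≤ (H.neighborSet v).ncard}


/-- `X` and `Y` are externally `q`-connected within the vertex set `W` of `G`:
for all disjoint `X' ⊆ X`, `Y' ⊆ Y` with `|X'| = |Y'| ≤ q` there are `|X'|`
pairwise disjoint `X'`–`Y'` paths (inside `W`) having no internal vertices and
no edges in `G[X ∪ Y]`. -/
def ExternallyConnectedIn {α : Type*} (G : SimpleGraph α) (W X Y : Set α) (q : ℕ) : Prop :=
  ∀ X' Y' : Finset α, ↑X' ⊆ X → ↑Y' ⊆ Y → Disjoint (X' : Set α) (Y' : Set α) →
    X'.card = Y'.card → X'.card ≤ q →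
    ∃ p : (x : X') → Σ y : Y', G.Walk x.1 y.1,
      (∀ x, (p x).2.IsPath) ∧
      (∀ x, ∀ v ∈ (p x).2.support, v ∈ W) ∧
      (Pairwise fun x₁ x₂ => ∀ v, v ∈ (p x₁).2.support → v ∉ (p x₂).2.support) ∧
      (∀ x, ∀ v ∈ (p x).2.support.tail.dropLast, v ∉ X ∪ Y) ∧
      (∀ x, ∀ u v : α, s(u, v) ∈ (p x).2.edges → ¬(u ∈ X ∪ Y ∧ v ∈ X ∪ Y))

/-- `(A, B)` is a `q`-mesh of order `s` in `G`. -/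
def IsMesh {α : Type*} (G : SimpleGraph α) (A B : Set α) (q s : ℕ) : Prop :=
  A ∪ B = Set.univ ∧
  ∃ T : G.Subgraph, T.verts ⊆ A ∧ T.coe.IsTree ∧
    (∀ v ∈ T.verts, (T.neighborSet v).ncard ≤ 3) ∧
    A ∩ B ⊆ T.verts ∧
    (∀ v ∈ A ∩ B, (T.neighborSet v).ncard ≤ 2) ∧
    (∃ v ∈ A ∩ B, (T.neighborSet v).ncard = 1) ∧
    (A ∩ B).ncard = s ∧
    ExternallyConnectedIn G B (A ∩ B) (A ∩ B) q

/-- The graph `Ξ_r`, with vertices `x_i = (0,i)`, `y_i = (1,i)`, `z_i = (2,i)`. -/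
def Xi (r : ℕ) : SimpleGraph (Fin 3 × Fin r) :=
  SimpleGraph.fromRel (fun a b =>
    (a.1 = 0 ∧ b.1 = 0 ∧ (b.2 : ℕ) = (a.2 : ℕ) + 1) ∨
    (a.1 = 2 ∧ b.1 = 2 ∧ (b.2 : ℕ) = (a.2 : ℕ) + 1) ∨
    (a.1 = 1 ∧ a.2 = b.2 ∧ (b.1 = 0 ∨ b.1 = 2)))

/-- The underlying simple bipartite graph of the bipartite multigraph with
parts `α`, `β` and multiplicity function `m`. -/
def bipMulti {α β : Type*} (m : α → β → ℕ) : SimpleGraph (α ⊕ β) :=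
  SimpleGraph.fromRel (fun x y => match x, y with
    | Sum.inl v, Sum.inr u => 1 ≤ m v u
    | _, _ => False)

/-! ### Connected vertex sets -/

section Connected

variable {α : Type*} {G G' : SimpleGraph α} {S K M : Set α} {u v w x y : α}

/-- The vertex set `S` induces a connected subgraph of `G`. -/
def ConnectedOn (G : SimpleGraph α) (S : Set α) : Prop := (G.induce S).Connected

/-- The outer neighbourhood of a vertex set. -/
def outerNeighbors (G : SimpleGraph α) (S : Set α) : Set α := {u | u ∉ S ∧ ∃ v ∈ S, G.Adj v u}

/-- The connected component of `v` in the subgraph induced by `S`. -/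
def componentOn (G : SimpleGraph α) (S : Set α) (v : α) : Set α :=
  ⋃₀ {K | K ⊆ S ∧ ConnectedOn G K ∧ v ∈ K}

theorem ConnectedOn.nonempty (h : ConnectedOn G S) : S.Nonempty := by
  obtain ⟨⟨v, hv⟩⟩ := Connected.nonempty h
  exact ⟨v, hv⟩

theorem connectedOn_singleton (v : α) : ConnectedOn G {v} := by
  have : Subsingleton ({v} : Set α) := by infer_instance
  exact Connected.of_subsingleton

theorem ConnectedOn.union (hS : ConnectedOn G S) (hK : ConnectedOn G K) (h : (S ∩ K).Nonempty) :
    ConnectedOn G (S ∪ K) :=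
  induce_union_connected (Connected.preconnected hS) (Connected.preconnected hK) h

theorem ConnectedOn.union_of_adj (hS : ConnectedOn G S) (hK : ConnectedOn G K)
    (hu : u ∈ S) (hv : v ∈ K) (h : G.Adj u v) : ConnectedOn G (S ∪ K) :=
  connected_induce_union (Connected.preconnected hS) (Connected.preconnected hK) hu hv h

theorem ConnectedOn.insert (hS : ConnectedOn G S) (hu : u ∈ S) (h : G.Adj u v) :
    ConnectedOn G (insert v S) := by
  rw [← Set.union_singleton]
  exact hS.union_of_adj (connectedOn_singleton v) hu rfl h

theorem ConnectedOn.of_adj_imp (hS : ConnectedOn G S)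
    (h : ∀ u ∈ S, ∀ v ∈ S, G.Adj u v → G'.Adj u v) : ConnectedOn G' S :=
  Connected.mono (fun u v huv => h u u.2 v v.2 huv) hS

theorem ConnectedOn.mono (hG : G ≤ G') (hS : ConnectedOn G S) : ConnectedOn G' S :=
  hS.of_adj_imp fun _ _ _ _ h => hG h

theorem ConnectedOn.exists_adj (hM : ConnectedOn G M) (hKM : K ⊆ M) (hK : K.Nonempty)
    (hne : K ≠ M) : ∃ u ∈ K, ∃ w ∈ M \ K, G.Adj u w := by
  obtain ⟨u, hu⟩ := hK
  obtain ⟨w, hw, hwK⟩ := Set.exists_of_ssubset (hKM.ssubset_of_ne hne)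
  obtain ⟨p⟩ := Connected.preconnected hM ⟨u, hKM hu⟩ ⟨w, hw⟩
  obtain ⟨d, -, hd₁, hd₂⟩ := p.exists_boundary_dart (Subtype.val ⁻¹' K) hu hwK
  exact ⟨d.fst, hd₁, d.snd, ⟨d.snd.2, hd₂⟩, d.adj⟩

theorem ConnectedOn.exists_walk (hM : ConnectedOn G M) (hu : u ∈ M) (hv : v ∈ M) :
    ∃ p : G.Walk u v, p.IsPath ∧ ∀ x ∈ p.support, x ∈ M := by
  classical
  obtain ⟨p⟩ := Connected.preconnected hM ⟨u, hu⟩ ⟨v, hv⟩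
  let q : G.Walk u v := p.map (Embedding.induce M).toHom
  refine ⟨q.bypass, q.bypass_isPath, fun x hx => ?_⟩
  have hx' : x ∈ (p.map (Embedding.induce M).toHom).support :=
    q.support_bypass_subset_support hx
  rw [Walk.support_map, List.mem_map] at hx'
  obtain ⟨a, -, rfl⟩ := hx'
  exact a.2

theorem componentOn_subset : componentOn G S v ⊆ S :=
  Set.sUnion_subset fun _ h => h.1

theorem mem_componentOn_self (hv : v ∈ S) : v ∈ componentOn G S v :=
  ⟨{v}, ⟨by simpa using hv, connectedOn_singleton v, rfl⟩, rfl⟩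

theorem connectedOn_componentOn (hv : v ∈ S) : ConnectedOn G (componentOn G S v) := by
  refine induce_sUnion_connected_of_pairwise_not_disjoint ?_ ?_ ?_
  · exact ⟨{v}, by simpa using hv, connectedOn_singleton v, rfl⟩
  · exact fun hs ht => ⟨v, hs.2.2, ht.2.2⟩
  · exact fun hs => hs.2.1

theorem ConnectedOn.subset_componentOn (hK : ConnectedOn G K) (hKS : K ⊆ S) (hv : v ∈ K) :
    K ⊆ componentOn G S v :=
  Set.subset_sUnion_of_mem ⟨hKS, hK, hv⟩

theorem mem_componentOn_of_adj (hv : v ∈ S) (hu : u ∈ componentOn G S v) (hw : w ∈ S)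
    (h : G.Adj u w) : w ∈ componentOn G S v := by
  refine ConnectedOn.subset_componentOn ((connectedOn_componentOn hv).insert hu h) ?_
    (Set.mem_insert_of_mem _ (mem_componentOn_self hv)) (Set.mem_insert _ _)
  exact Set.insert_subset hw componentOn_subset

/-- Deleting a vertex `x` of a connected set leaves every component adjacent to `x`. -/
theorem ConnectedOn.exists_adj_componentOn (hM : ConnectedOn G M) (hv : v ∈ M) (hx : x ∈ M)
    (hne : v ≠ x) : ∃ u ∈ componentOn G (M \ {x}) v, G.Adj u x := by
  have hv' : v ∈ M \ {x} := ⟨hv, hne⟩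
  have hsub : componentOn G (M \ {x}) v ⊆ M \ {x} := componentOn_subset
  obtain ⟨u, hu, w, hw, huw⟩ := hM.exists_adj (hsub.trans Set.sdiff_subset)
    ⟨v, mem_componentOn_self hv'⟩ (fun h => (hsub (h.symm.subset hx)).2 rfl)
  by_cases hwx : w = x
  · exact ⟨u, hu, hwx ▸ huw⟩
  · exact absurd (mem_componentOn_of_adj hv' hu ⟨hw.1, hwx⟩ huw) hw.2

/-- A connected set meeting `P` contains, from each of its vertices `v`, a connected part that
meets `P` exactly once. -/
theorem ConnectedOn.exists_first_meeting {P : Set α} (hM : ConnectedOn G M) (hv : v ∈ M)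
    (hP : (M ∩ P).Nonempty) :
    ∃ N ⊆ M, ∃ p ∈ P, ConnectedOn G N ∧ v ∈ N ∧ p ∈ N ∧
      (N = {p} ∨ ConnectedOn G (N \ {p}) ∧ v ∈ N \ {p}) ∧ N ∩ P = {p} := by
  by_cases hvP : v ∈ P
  · exact ⟨{v}, by simpa using hv, v, hvP, connectedOn_singleton v, rfl, rfl, Or.inl rfl,
      by simpa using hvP⟩
  have hv' : v ∈ M \ P := ⟨hv, hvP⟩
  have hsub : componentOn G (M \ P) v ⊆ M \ P := componentOn_subset
  obtain ⟨q, hqM, hqP⟩ := hP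
  obtain ⟨u, hu, p, hp, hup⟩ := hM.exists_adj (hsub.trans Set.sdiff_subset)
    ⟨v, mem_componentOn_self hv'⟩ (fun h => (hsub (h.symm.subset hqM)).2 hqP)
  have hpP : p ∈ P := by
    by_contra hpP
    exact hp.2 (mem_componentOn_of_adj hv' hu ⟨hp.1, hpP⟩ hup)
  have hdiff : Insert.insert p (componentOn G (M \ P) v) \ {p} = componentOn G (M \ P) v := by
    rw [Set.insert_sdiff_of_mem _ (Set.mem_singleton p), Set.sdiff_singleton_eq_self hp.2]
  refine ⟨Insert.insert p (componentOn G (M \ P) v), ?_, p, hpP,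
    (connectedOn_componentOn hv').insert hu hup, Or.inr (mem_componentOn_self hv'),
    Or.inl rfl, Or.inr ?_, ?_⟩
  · exact Set.insert_subset hp.1 (hsub.trans Set.sdiff_subset)
  · rw [hdiff]
    exact ⟨connectedOn_componentOn hv', mem_componentOn_self hv'⟩
  · ext z
    constructor
    · rintro ⟨rfl | hz, hzP⟩
      · rfl
      · exact absurd hzP (hsub hz).2
    · rintro rfl
      exact ⟨Or.inl rfl, hpP⟩

end Connected
/-! ### Rooted tree decompositions of induced subgraphs -/

section TreeDecomposition

variable {α : Type*} {G : SimpleGraph α} {b : ℕ} {V V' X X' : Set α}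

/-- The subgraph induced by `V` has a tree decomposition with bags of size at most `b`, one of
which contains `X`. -/
def HasRootedDecomp (G : SimpleGraph α) (b : ℕ) (V X : Set α) : Prop :=
  ∃ (ι : Type) (T : SimpleGraph ι) (D : ι → Set α) (r : ι), T.IsTree ∧ X ⊆ D r ∧
    (∀ v, v ∈ V ↔ ∃ t, v ∈ D t) ∧
    (∀ u ∈ V, ∀ v ∈ V, G.Adj u v → ∃ t, u ∈ D t ∧ v ∈ D t) ∧
    (∀ v ∈ V, ConnectedOn T {t | v ∈ D t}) ∧ ∀ t, (D t).ncard ≤ b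

theorem hasRootedDecomp_self (hX : X.ncard ≤ b) : HasRootedDecomp G b X X := by
  refine ⟨Unit, ⊥, fun _ => X, (), IsTree.of_subsingleton, subset_rfl, fun v => by simp,
    fun u hu v hv _ => ⟨(), hu, hv⟩, fun v hv => ?_, fun _ => hX⟩
  convert connectedOn_singleton ()
  ext
  simp [hv]

theorem ConnectedOn.image_of_hom {ι κ : Type*} {T : SimpleGraph ι} {T' : SimpleGraph κ}
    {S : Set ι} (hS : ConnectedOn T S) (f : T →g T') : ConnectedOn T' (f '' S) := by
  let g : T.induce S →g T'.induce (f '' S) :=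
    { toFun := fun x => ⟨f x, Set.mem_image_of_mem f x.2⟩
      map_rel' := fun h => f.map_rel h }
  refine Connected.map g ?_ hS
  rintro ⟨_, x, hx, rfl⟩
  exact ⟨⟨x, hx⟩, rfl⟩

theorem isAcyclic_sum {ι κ : Type*} {T : SimpleGraph ι} {T' : SimpleGraph κ}
    (hT : T.IsAcyclic) (hT' : T'.IsAcyclic) : (T ⊕g T').IsAcyclic := by
  rw [isAcyclic_iff_forall_adj_isBridge] at *
  rintro (u | u) (v | v) huv
  · rw [isBridge_iff]
    intro hr
    have key : ∀ x, Relation.ReflTransGen ((T ⊕g T').deleteEdges {s(.inl u, .inl v)}).Adj (.inl u) x →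
        ∃ c, x = .inl c ∧ (T.deleteEdges {s(u, v)}).Reachable u c := by
      intro x hx
      induction hx with
      | refl => exact ⟨u, rfl, Reachable.refl _⟩
      | @tail y z _ hyz ih =>
        obtain ⟨c, rfl, hc⟩ := ih
        rcases z with z | z
        · refine ⟨z, rfl, hc.trans (Adj.reachable ?_)⟩
          simpa [deleteEdges_adj] using hyz
        · simp [deleteEdges_adj] at hyz
    obtain ⟨c, hc, hr'⟩ := key _ ((reachable_iff_reflTransGen _ _).1 hr)
    obtain rfl := Sum.inl_injective hc
    exact isBridge_iff.1 (hT (by simpa using huv)) hr'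
  · simp at huv
  · simp at huv
  · rw [isBridge_iff]
    intro hr
    have key : ∀ x, Relation.ReflTransGen ((T ⊕g T').deleteEdges {s(.inr u, .inr v)}).Adj (.inr u) x →
        ∃ c, x = .inr c ∧ (T'.deleteEdges {s(u, v)}).Reachable u c := by
      intro x hx
      induction hx with
      | refl => exact ⟨u, rfl, Reachable.refl _⟩
      | @tail y z _ hyz ih =>
        obtain ⟨c, rfl, hc⟩ := ih
        rcases z with z | z
        · simp [deleteEdges_adj] at hyz
        · refine ⟨z, rfl, hc.trans (Adj.reachable ?_)⟩
          simpa [deleteEdges_adj] using hyz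
    obtain ⟨c, hc, hr'⟩ := key _ ((reachable_iff_reflTransGen _ _).1 hr)
    obtain rfl := Sum.inr_injective hc
    exact isBridge_iff.1 (hT' (by simpa using huv)) hr'

theorem HasRootedDecomp.glue (h : HasRootedDecomp G b V X) (h' : HasRootedDecomp G b V' X')
    (hX : V ∩ V' ⊆ X) (hX' : V ∩ V' ⊆ X')
    (hadj : ∀ u ∈ V, ∀ v ∈ V', G.Adj u v → u ∈ V' ∨ v ∈ V) :
    HasRootedDecomp G b (V ∪ V') X := by
  obtain ⟨ι, T, D, r, hT, hr, hV, hE, hC, hb⟩ := h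
  obtain ⟨ι', T', D', r', hT', hr', hV', hE', hC', hb'⟩ := h'
  let f : T →g (T ⊕g T') ⊔ edge (.inl r) (.inr r') :=
    (Hom.ofLE le_sup_left).comp Embedding.sumInl.toHom
  let f' : T' →g (T ⊕g T') ⊔ edge (.inl r) (.inr r') :=
    (Hom.ofLE le_sup_left).comp Embedding.sumInr.toHom
  have hsplit : ∀ v, {t | v ∈ Sum.elim D D' t} = f '' {t | v ∈ D t} ∪ f' '' {t | v ∈ D' t} := by
    intro v
    ext (t | t) <;> simp [f, f', Embedding.sumInl, Embedding.sumInr]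
  refine ⟨ι ⊕ ι', (T ⊕g T') ⊔ edge (.inl r) (.inr r'), Sum.elim D D', .inl r,
    ⟨hT.connected.sum_sup_edge hT'.connected, ?_⟩, hr, ?_, ?_, ?_, ?_⟩
  · exact IsAcyclic.sup_edge_of_not_reachable (not_reachable_sum_inl_inr r r')
      (isAcyclic_sum hT.isAcyclic hT'.isAcyclic)
  · intro v
    simp [hV, hV']
  · have key : ∀ u ∈ V ∪ V', ∀ v ∈ V ∪ V', G.Adj u v → (u ∈ V ∧ v ∈ V) ∨ (u ∈ V' ∧ v ∈ V') := by
      rintro u (hu | hu) v (hv | hv) huv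
      · exact Or.inl ⟨hu, hv⟩
      · rcases hadj u hu v hv huv with h | h
        · exact Or.inr ⟨h, hv⟩
        · exact Or.inl ⟨hu, h⟩
      · rcases hadj v hv u hu huv.symm with h | h
        · exact Or.inr ⟨hu, h⟩
        · exact Or.inl ⟨h, hv⟩
      · exact Or.inr ⟨hu, hv⟩
    intro u hu v hv huv
    rcases key u hu v hv huv with ⟨h₁, h₂⟩ | ⟨h₁, h₂⟩
    · obtain ⟨t, ht⟩ := hE u h₁ v h₂ huv
      exact ⟨.inl t, ht⟩
    · obtain ⟨t, ht⟩ := hE' u h₁ v h₂ huv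
      exact ⟨.inr t, ht⟩
  · intro v hv
    rw [hsplit]
    by_cases h₁ : v ∈ V <;> by_cases h₂ : v ∈ V'
    · refine ((hC v h₁).image_of_hom f).union_of_adj ((hC' v h₂).image_of_hom f')
        (u := .inl r) (v := .inr r') ⟨r, hr (hX ⟨h₁, h₂⟩), rfl⟩ ⟨r', hr' (hX' ⟨h₁, h₂⟩), rfl⟩ ?_
      simp [edge_adj]
    · have : {t | v ∈ D' t} = ∅ := by
        ext t
        simpa using fun ht => h₂ ((hV' v).2 ⟨t, ht⟩)
      rw [this, Set.image_empty, Set.union_empty]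
      exact (hC v h₁).image_of_hom f
    · have : {t | v ∈ D t} = ∅ := by
        ext t
        simpa using fun ht => h₁ ((hV v).2 ⟨t, ht⟩)
      rw [this, Set.image_empty, Set.empty_union]
      exact (hC' v h₂).image_of_hom f'
    · exact absurd hv (by simp [h₁, h₂])
  · rintro (t | t)
    exacts [hb t, hb' t]

/-- A bag `W` separating the vertex set `D` from the rest can be completed to a tree
decomposition once every component of `D` has a decomposition rooted at its neighbourhood. -/
theorem hasRootedDecomp_union_of_components [Finite α] {W : Set α} (hW : W.ncard ≤ b) :
    ∀ (D : Set α), Disjoint D W → outerNeighbors G D ⊆ W →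
    (∀ C ⊆ D, ConnectedOn G C → outerNeighbors G C ⊆ W →
      HasRootedDecomp G b (C ∪ outerNeighbors G C) (outerNeighbors G C)) →
    HasRootedDecomp G b (D ∪ W) W := by
  intro D
  induction hn : D.ncard using Nat.strong_induction_on generalizing D with
  | _ n ih =>
    subst hn
    intro hDW hND hC
    obtain rfl | ⟨v, hv⟩ := D.eq_empty_or_nonempty
    · rw [Set.empty_union]
      exact hasRootedDecomp_self hW
    set C := componentOn G D v with hCdef
    have hCD : C ⊆ D := componentOn_subset
    have hCc : ConnectedOn G C := connectedOn_componentOn hv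
    have hvC : v ∈ C := mem_componentOn_self hv
    have hNC : outerNeighbors G C ⊆ W := by
      rintro u ⟨hu, c, hc, hcu⟩
      by_cases huD : u ∈ D
      · exact absurd (mem_componentOn_of_adj hv hc huD hcu) hu
      · exact hND ⟨huD, c, hCD hc, hcu⟩
    have hrest : HasRootedDecomp G b (D \ C ∪ W) W := by
      refine ih _ (Set.ncard_lt_ncard ?_ D.toFinite) (D \ C) rfl
        (hDW.mono_left Set.sdiff_subset) ?_ ?_
      · exact ⟨Set.sdiff_subset, fun h => (h hv).2 hvC⟩
      · rintro u ⟨hu, c, hc, hcu⟩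
        by_cases huD : u ∈ D
        · have huC : u ∈ C := by
            by_contra huC
            exact hu ⟨huD, huC⟩
          exact absurd (mem_componentOn_of_adj hv huC hc.1 hcu.symm) hc.2
        · exact hND ⟨huD, c, hc.1, hcu⟩
      · exact fun K hK => hC K (hK.trans Set.sdiff_subset)
    have hsub : (D \ C ∪ W) ∩ (C ∪ outerNeighbors G C) ⊆ outerNeighbors G C := by
      rintro z ⟨hz | hz, hz' | hz'⟩
      · exact absurd hz' hz.2
      · exact hz'
      · exact absurd hz (Set.disjoint_left.1 hDW (hCD hz'))
      · exact hz'
    have := hrest.glue (hC C hCD hCc hNC) (hsub.trans hNC) hsub ?_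
    · convert this using 1
      ext z
      constructor
      · rintro (hz | hz)
        · by_cases hzC : z ∈ C
          · exact Or.inr (Or.inl hzC)
          · exact Or.inl (Or.inl ⟨hz, hzC⟩)
        · exact Or.inl (Or.inr hz)
      · rintro ((hz | hz) | (hz | hz))
        exacts [Or.inl hz.1, Or.inr hz, Or.inl (hCD hz), Or.inr (hNC hz)]
    · rintro u - z (hz | hz) huz
      · by_cases huC : u ∈ C
        · exact Or.inl (Or.inl huC)
        · exact Or.inl (Or.inr ⟨huC, z, hz, huz.symm⟩)
      · exact Or.inr (Or.inr (hNC hz))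

end TreeDecomposition

theorem treewidth_le_of_hasRootedDecomp {α : Type} {G : SimpleGraph α} {w : ℕ} {X : Set α}
    (h : HasRootedDecomp G (w + 1) Set.univ X) : treewidth G ≤ w := by
  obtain ⟨ι, T, D, r, hT, -, hV, hE, hC, hb⟩ := h
  exact Nat.sInf_le ⟨ι, T, D, hT, ⟨fun v => (hV v).1 trivial,
    fun u v huv => hE u trivial v trivial huv, fun v => hC v trivial⟩, hb⟩
/-! ### Menger's theorem for connected vertex sets -/

section Menger

variable {α : Type*} {G G' : SimpleGraph α} {A B : Set α} {I P S T : Finset α} {M : α → Set α}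
  {u w : α}

/-- `S` meets every connected vertex set of `G` that meets both `A` and `B`. -/
def Separates (G : SimpleGraph α) (A B : Set α) (S : Finset α) : Prop :=
  ∀ K, ConnectedOn G K → (K ∩ A).Nonempty → (K ∩ B).Nonempty → (K ∩ S).Nonempty

theorem Separates.symm (h : Separates G A B S) : Separates G B A S :=
  fun K hK hB hA => h K hK hA hB

/-- The sets `M i`, for `i ∈ I`, are disjoint and connected, and each of them meets `A` and `B`. -/
structure IsLinkage (G : SimpleGraph α) (A B : Set α) (I : Finset α) (M : α → Set α) : Prop where
  connected : ∀ i ∈ I, ConnectedOn G (M i)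
  left : ∀ i ∈ I, (M i ∩ A).Nonempty
  right : ∀ i ∈ I, (M i ∩ B).Nonempty
  eq_of_mem : ∀ i ∈ I, ∀ j ∈ I, ∀ z, z ∈ M i → z ∈ M j → i = j

theorem IsLinkage.symm (h : IsLinkage G A B I M) : IsLinkage G B A I M :=
  ⟨h.connected, h.right, h.left, h.eq_of_mem⟩

/-- A linkage all of whose members meet a set `P` that is not larger than the linkage can be
indexed by `P`. -/
theorem IsLinkage.reindex (h : IsLinkage G A B I M) (hP : ∀ i ∈ I, (M i ∩ P).Nonempty)
    (hcard : P.card ≤ I.card) :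
    P.card = I.card ∧ ∃ M', IsLinkage G A B P M' ∧ ∀ p ∈ P, p ∈ M' p := by
  classical
  choose! g hg using hP
  have hinj : Set.InjOn g I := fun i hi j hj hij =>
    h.eq_of_mem i hi j hj (g i) (hg i hi).1 (hij ▸ (hg j hj).1)
  have himg : I.image g = P := by
    refine Finset.eq_of_subset_of_card_le ?_ (by rwa [Finset.card_image_of_injOn hinj])
    intro p hp
    obtain ⟨i, hi, rfl⟩ := Finset.mem_image.1 hp
    exact (hg i hi).2
  refine ⟨by rw [← himg, Finset.card_image_of_injOn hinj], ?_⟩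
  have hinv : ∀ p ∈ P, ∃ i ∈ I, g i = p := fun p hp => Finset.mem_image.1 (himg ▸ hp)
  choose! f hf hgf using hinv
  refine ⟨M ∘ f, ⟨fun p hp => h.connected _ (hf p hp), fun p hp => h.left _ (hf p hp),
    fun p hp => h.right _ (hf p hp), fun p hp q hq z hz hz' => ?_⟩, fun p hp => ?_⟩
  · have := h.eq_of_mem _ (hf p hp) _ (hf q hq) z hz hz'
    rw [← hgf p hp, this, hgf q hq]
  · have := (hg _ (hf p hp)).1
    rwa [hgf p hp] at this

/-- A linkage from `A` to a set `P` of the same size can be cut off where it first meets `P`. -/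
theorem IsLinkage.exists_trimmed (h : IsLinkage G A P I M) (hcard : P.card ≤ I.card) :
    P.card = I.card ∧ ∃ N : α → Set α, IsLinkage G A P P N ∧
      ∀ p ∈ P, N p ∩ P = {p} ∧
        ∀ z ∈ N p, z ≠ p → ∃ K, ConnectedOn G K ∧ (K ∩ A).Nonempty ∧ K ∩ P = ∅ ∧ z ∈ K := by
  obtain ⟨heq, M', hM', hp⟩ := h.reindex h.right hcard
  refine ⟨heq, ?_⟩
  have key : ∀ p ∈ P, ∃ N ⊆ M' p, ConnectedOn G N ∧ (N ∩ A).Nonempty ∧ N ∩ P = {p} ∧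
      ∀ z ∈ N, z ≠ p → ∃ K, ConnectedOn G K ∧ (K ∩ A).Nonempty ∧ K ∩ P = ∅ ∧ z ∈ K := by
    intro p hpP
    obtain ⟨a, haM, haA⟩ := hM'.left p hpP
    obtain ⟨N, hN, q, hq, hNc, haN, hqN, hcase, hNP⟩ :=
      (hM'.connected p hpP).exists_first_meeting haM (hM'.right p hpP)
    obtain rfl : p = q := hM'.eq_of_mem p hpP q hq q (hN hqN) (hp q hq)
    refine ⟨N, hN, hNc, ⟨a, haN, haA⟩, hNP, fun z hz hzp => ?_⟩
    rcases hcase with rfl | ⟨hc, ha⟩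
    · exact absurd hz hzp
    · refine ⟨N \ {p}, hc, ⟨a, ha, haA⟩, ?_, hz, hzp⟩
      ext y
      constructor
      · rintro ⟨⟨hyN, hyp⟩, hyP⟩
        exact hyp (hNP.subset ⟨hyN, hyP⟩)
      · exact False.elim
  choose! N hN hNc hNA hNP hNK using key
  refine ⟨N, ⟨hNc, hNA, fun p hpP => ?_, fun p hpP q hq z hz hz' =>
    hM'.eq_of_mem p hpP q hq z (hN p hpP hz) (hN q hq hz')⟩, fun p hpP => ⟨hNP p hpP, hNK p hpP⟩⟩
  rw [hNP p hpP]
  exact Set.singleton_nonempty p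

/-- If `S` separates `A` from `B` after deletion of the edge `uw`, and `w` is not on the side
of `A`, then separating `A` from `S ∪ {u}` without `uw` separates `A` from `B`. -/
theorem Separates.of_insert [DecidableEq α] (hS : Separates G' A B S)
    (hdel : ∀ p q, G.Adj p q → ¬ G'.Adj p q → (p = u ∧ q = w) ∨ (p = w ∧ q = u))
    (hw : ∀ K, ConnectedOn G' K → (K ∩ A).Nonempty → K ∩ S = ∅ → w ∉ K)
    (hT : Separates G' A (insert u S : Finset α) T) : Separates G A B T := by
  intro M hM hMA hMB
  by_contra hMT
  rw [Set.not_nonempty_iff_eq_empty] at hMT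
  have hP : (M ∩ (insert u S : Finset α)).Nonempty := by
    by_contra hP
    rw [Set.not_nonempty_iff_eq_empty] at hP
    have huM : u ∉ M := fun h => (hP.subset ⟨h, by simp⟩ : u ∈ (∅ : Set α))
    have hM' : ConnectedOn G' M := by
      refine hM.of_adj_imp fun p hp q hq hpq => ?_
      by_contra hpq'
      rcases hdel p q hpq hpq' with ⟨rfl, -⟩ | ⟨-, rfl⟩
      exacts [huM hp, huM hq]
    obtain ⟨z, hz, hzS⟩ := hS M hM' hMA hMB
    exact (hP.subset ⟨hz, by simpa using Or.inr hzS⟩ : z ∈ (∅ : Set α))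
  obtain ⟨a, haM, haA⟩ := hMA
  have hK : ConnectedOn G' (componentOn G' M a) := connectedOn_componentOn haM
  have haK : a ∈ componentOn G' M a := mem_componentOn_self haM
  have hKM : componentOn G' M a ⊆ M := componentOn_subset
  have hKP : componentOn G' M a ∩ (insert u S : Finset α) = ∅ := by
    by_contra hne
    obtain ⟨z, hz, hzT⟩ := hT _ hK ⟨a, haK, haA⟩ (Set.nonempty_iff_ne_empty.2 hne)
    exact (hMT.subset ⟨hKM hz, hzT⟩ : z ∈ (∅ : Set α))
  obtain ⟨z, hzM, hzP⟩ := hP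
  obtain ⟨p, hp, q, hq, hpq⟩ := hM.exists_adj hKM ⟨a, haK⟩
    (fun h => (hKP.subset ⟨h.symm.subset hzM, hzP⟩ : z ∈ (∅ : Set α)))
  have hpq' : ¬ G'.Adj p q := fun h => hq.2 (mem_componentOn_of_adj haM hp hq.1 h)
  rcases hdel p q hpq hpq' with ⟨rfl, -⟩ | ⟨rfl, -⟩
  · exact (hKP.subset ⟨hp, by simp⟩ : p ∈ (∅ : Set α))
  · refine hw _ hK ⟨a, haK, haA⟩ ?_ hp
    refine Set.eq_empty_of_subset_empty fun z hz => hKP.subset ⟨hz.1, ?_⟩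
    simpa using Or.inr hz.2

theorem exists_linkage_of_forall_separates [Finite α] : ∀ (G : SimpleGraph α) (A B : Set α) (k : ℕ),
    (∀ S, Separates G A B S → k ≤ S.card) → ∃ I M, I.card = k ∧ IsLinkage G A B I M := by
  classical
  intro G
  induction hn : G.edgeSet.ncard using Nat.strong_induction_on generalizing G with
  | _ n ih =>
  subst hn
  intro A B k hk
  by_cases hedge : ∃ x y, G.Adj x y
  swap
  · have hsep : Separates G A B (A ∩ B).toFinite.toFinset := by
      rintro K hK ⟨a, haK, haA⟩ ⟨b, hbK, hbB⟩
      have hKa : {a} = K := by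
        by_contra hne
        obtain ⟨x, -, y, -, hxy⟩ := hK.exists_adj (K := {a}) (by simpa using haK)
          ⟨a, Set.mem_singleton a⟩ hne
        exact hedge ⟨x, y, hxy⟩
      obtain rfl : b = a := by simpa [← hKa] using hbK
      exact ⟨b, hbK, by simp [haA, hbB]⟩
    obtain ⟨I, hI, hIk⟩ := Finset.exists_subset_card_eq (hk _ hsep)
    have hI' : ∀ i ∈ I, i ∈ A ∧ i ∈ B := fun i hi => by simpa using hI hi
    refine ⟨I, fun i => {i}, hIk, fun i _ => connectedOn_singleton i,
      fun i hi => ⟨i, rfl, (hI' i hi).1⟩, fun i hi => ⟨i, rfl, (hI' i hi).2⟩, ?_⟩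
    rintro i - j - z rfl rfl
    rfl
  obtain ⟨x, y, hxy⟩ := hedge
  set G' := G.deleteEdges {s(x, y)} with hG'
  have hle : G' ≤ G := deleteEdges_le _
  have hlt : G'.edgeSet.ncard < G.edgeSet.ncard := by
    refine Set.ncard_lt_ncard ?_ (Set.toFinite _)
    rw [edgeSet_ssubset_edgeSet]
    refine lt_of_le_of_ne hle fun h => ?_
    have : G'.Adj x y := h ▸ hxy
    simp [hG', deleteEdges_adj] at this
  by_cases hk' : ∀ S, Separates G' A B S → k ≤ S.card
  · obtain ⟨I, M, hI, hM⟩ := ih _ hlt G' rfl A B k hk'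
    exact ⟨I, M, hI, fun i hi => (hM.connected i hi).mono hle, hM.left, hM.right, hM.eq_of_mem⟩
  push Not at hk'
  obtain ⟨S, hS, hSk⟩ := hk'
  have hnot : ¬ Separates G A B S := fun h => absurd (hk S h) (by omega)
  unfold Separates at hnot
  push Not at hnot
  obtain ⟨M₀, hM₀, ⟨a, haM, haA⟩, ⟨b, hbM, hbB⟩, hM₀S⟩ := hnot
  let R : Set α → Set α := fun D =>
    {v | ∃ K, ConnectedOn G' K ∧ (K ∩ D).Nonempty ∧ K ∩ S = ∅ ∧ v ∈ K}
  have hRdisj : ∀ v, v ∈ R A → v ∉ R B := by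
    rintro v ⟨K, hK, ⟨c, hcK, hcA⟩, hKS, hv⟩ ⟨K', hK', ⟨d, hdK, hdB⟩, hKS', hv'⟩
    obtain ⟨z, hz | hz, hzS⟩ := hS _ (hK.union hK' ⟨v, hv, hv'⟩) ⟨c, Or.inl hcK, hcA⟩
      ⟨d, Or.inr hdK, hdB⟩
    · exact (hKS.subset ⟨hz, hzS⟩ : z ∈ (∅ : Set α))
    · exact (hKS'.subset ⟨hz, hzS⟩ : z ∈ (∅ : Set α))
  have hRS : ∀ D v, v ∈ R D → v ∉ S := by
    rintro D v ⟨K, -, -, hKS, hv⟩ hvS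
    exact (hKS.subset ⟨hv, hvS⟩ : v ∈ (∅ : Set α))
  have hMS : ∀ v ∈ M₀, v ∉ S := fun v hv hvS => (hM₀S.subset ⟨hv, hvS⟩ : v ∈ (∅ : Set α))
  have hcross : ∀ D c d, c ∈ M₀ → c ∈ D → d ∈ M₀ → d ∉ R D →
      ∃ u w, G.Adj u w ∧ u ∈ R D ∧ w ∉ R D ∧ s(u, w) = s(x, y) := by
    intro D c d hcM hcD hdM hdR
    have hc : c ∈ R D := ⟨{c}, connectedOn_singleton c, ⟨c, rfl, hcD⟩, by
      simpa using hMS c hcM, rfl⟩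
    obtain ⟨u, hu, w, hw, huw⟩ := hM₀.exists_adj (K := R D ∩ M₀) Set.inter_subset_right
      ⟨c, hc, hcM⟩ (fun h => hdR (h.symm.subset hdM).1)
    have hwR : w ∉ R D := fun h => hw.2 ⟨h, hw.1⟩
    refine ⟨u, w, huw, hu.1, hwR, ?_⟩
    by_contra hne
    have huw' : G'.Adj u w := by
      rw [hG', deleteEdges_adj]
      exact ⟨huw, hne⟩
    obtain ⟨K, hK, ⟨e, heK, heD⟩, hKS, huK⟩ := hu.1
    refine hwR ⟨insert w K, hK.insert huK huw', ⟨e, Or.inr heK, heD⟩, ?_, Or.inl rfl⟩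
    rw [Set.insert_inter_of_notMem (by simpa using hMS w hw.1), hKS]
  have hbR : b ∈ R B := ⟨{b}, connectedOn_singleton b, ⟨b, rfl, hbB⟩, by
    simpa using hMS b hbM, rfl⟩
  have haR : a ∈ R A := ⟨{a}, connectedOn_singleton a, ⟨a, rfl, haA⟩, by
    simpa using hMS a haM, rfl⟩
  obtain ⟨u, w, huw, huA, -, huwe⟩ := hcross A a b haM haA hbM fun h => hRdisj b h hbR
  obtain ⟨u', w', -, huB, -, huwe'⟩ := hcross B b a hbM hbB haM fun h => hRdisj a haR h
  have hwB : w ∈ R B := by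
    rw [← huwe, Sym2.eq_iff] at huwe'
    rcases huwe' with ⟨rfl, -⟩ | ⟨rfl, -⟩
    · exact absurd huB (hRdisj _ huA)
    · exact huB
  have hdel : ∀ p q, G.Adj p q → ¬ G'.Adj p q → (p = u ∧ q = w) ∨ (p = w ∧ q = u) := by
    intro p q hpq hpq'
    rw [hG', deleteEdges_adj, ← huwe] at hpq'
    simp only [hpq, true_and, Set.mem_singleton_iff, not_not, Sym2.eq_iff] at hpq'
    tauto
  have huS := hRS _ _ huA
  have hwS := hRS _ _ hwB
  have hcardP : (insert u S).card ≤ k := by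
    rw [Finset.card_insert_of_notMem huS]
    omega
  have hcardQ : (insert w S).card ≤ k := by
    rw [Finset.card_insert_of_notMem hwS]
    omega
  obtain ⟨I₁, M₁, hI₁, hM₁⟩ := ih _ hlt G' rfl A (insert u S : Finset α) k fun T hT =>
    hk T (hS.of_insert hdel (fun K hK hKA hKS hwK => hRdisj w ⟨K, hK, hKA, hKS, hwK⟩ hwB) hT)
  obtain ⟨I₂, M₂, hI₂, hM₂⟩ := ih _ hlt G' rfl B (insert w S : Finset α) k fun T hT =>
    hk T (hS.symm.of_insert (fun p q hpq hpq' => (hdel p q hpq hpq').symm)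
      (fun K hK hKB hKS huK => hRdisj u huA ⟨K, hK, hKB, hKS, huK⟩) hT).symm
  obtain ⟨hPk, N₁, hN₁, hN₁P⟩ := hM₁.exists_trimmed (hI₁ ▸ hcardP)
  obtain ⟨-, N₂, hN₂, hN₂Q⟩ := hM₂.exists_trimmed (hI₂ ▸ hcardQ)
  have hself₁ : ∀ p ∈ insert u S, p ∈ N₁ p := fun p hp =>
    ((hN₁P p hp).1.symm.subset rfl).1
  have hself₂ : ∀ p ∈ insert w S, p ∈ N₂ p := fun p hp =>
    ((hN₂Q p hp).1.symm.subset rfl).1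
  have hin₁ : ∀ p ∈ insert u S, ∀ z ∈ N₁ p, z = p ∨ z ∈ R A := by
    intro p hp z hz
    by_cases hzp : z = p
    · exact Or.inl hzp
    · obtain ⟨K, hK, hKA, hKP, hzK⟩ := (hN₁P p hp).2 z hz hzp
      refine Or.inr ⟨K, hK, hKA, Set.eq_empty_of_subset_empty fun t ht => hKP.subset ⟨ht.1, ?_⟩, hzK⟩
      simpa using Or.inr ht.2
  have hin₂ : ∀ p ∈ insert w S, ∀ z ∈ N₂ p, z = p ∨ z ∈ R B := by
    intro p hp z hz
    by_cases hzp : z = p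
    · exact Or.inl hzp
    · obtain ⟨K, hK, hKB, hKP, hzK⟩ := (hN₂Q p hp).2 z hz hzp
      refine Or.inr ⟨K, hK, hKB, Set.eq_empty_of_subset_empty fun t ht => hKP.subset ⟨ht.1, ?_⟩, hzK⟩
      simpa using Or.inr ht.2
  let τ : α → α := fun p => if p = u then w else p
  have hτu : τ u = w := if_pos rfl
  have hτS : ∀ p ∈ S, τ p = p := fun p hp => if_neg (fun h : p = u => huS (h ▸ hp))
  have hτQ : ∀ p ∈ insert u S, τ p ∈ insert w S := by
    intro p hp
    rcases Finset.mem_insert.1 hp with rfl | hp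
    · rw [hτu]; exact Finset.mem_insert_self _ _
    · rw [hτS p hp]; exact Finset.mem_insert_of_mem hp
  have hτinj : ∀ p ∈ insert u S, ∀ q ∈ insert u S, τ p = τ q → p = q := by
    intro p hp q hq hpq
    rcases Finset.mem_insert.1 hp with hpu | hpS <;> rcases Finset.mem_insert.1 hq with hqu | hqS
    · rw [hpu, hqu]
    · rw [hpu, hτu, hτS q hqS] at hpq
      exact absurd (hpq ▸ hqS) hwS
    · rw [hqu, hτu, hτS p hpS] at hpq
      exact absurd (hpq ▸ hpS) hwS
    · rwa [hτS p hpS, hτS q hqS] at hpq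
  have huw_ne : u ≠ w := huw.ne
  have hmixed : ∀ p ∈ insert u S, ∀ q ∈ insert u S, ∀ z, z ∈ N₁ p → z ∈ N₂ (τ q) → p = q := by
    intro p hp q hq z hz₁ hz₂
    rcases hin₁ p hp z hz₁ with rfl | hzA <;> rcases hin₂ _ (hτQ q hq) z hz₂ with hzq | hzB
    · rcases Finset.mem_insert.1 hq with rfl | hq
      · rw [hτu] at hzq
        subst hzq
        rcases Finset.mem_insert.1 hp with h | h
        exacts [h, absurd h hwS]
      · rw [hzq, hτS q hq]
    · rcases Finset.mem_insert.1 hp with rfl | hp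
      · exact absurd hzB (hRdisj _ huA)
      · exact absurd hp (hRS _ _ hzB)
    · subst hzq
      rcases Finset.mem_insert.1 hq with rfl | hq
      · rw [hτu] at hzA
        exact absurd hwB (hRdisj _ hzA)
      · rw [hτS q hq] at hzA
        exact absurd hq (hRS _ _ hzA)
    · exact absurd hzB (hRdisj _ hzA)
  refine ⟨insert u S, fun p => N₁ p ∪ N₂ (τ p), by rw [hPk, hI₁], ?_, ?_, ?_, ?_⟩
  · intro p hp
    have h₁ := (hN₁.connected p hp).mono hle
    have h₂ := (hN₂.connected _ (hτQ p hp)).mono hle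
    rcases Finset.mem_insert.1 hp with rfl | hpS
    · exact h₁.union_of_adj h₂ (hself₁ p hp) (hself₂ _ (hτQ p hp)) (hτu ▸ huw)
    · refine h₁.union h₂ ⟨p, hself₁ p hp, ?_⟩
      rw [hτS p hpS]
      exact hself₂ p (Finset.mem_insert_of_mem hpS)
  · exact fun p hp => (hN₁.left p hp).mono (Set.inter_subset_inter_left _ Set.subset_union_left)
  · exact fun p hp => (hN₂.left _ (hτQ p hp)).mono
      (Set.inter_subset_inter_left _ Set.subset_union_right)
  · rintro p hp q hq z (hz | hz) (hz' | hz')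
    · exact hN₁.eq_of_mem p hp q hq z hz hz'
    · exact hmixed p hp q hq z hz hz'
    · exact (hmixed q hq p hp z hz' hz).symm
    · exact hτinj p hp q hq (hN₂.eq_of_mem _ (hτQ p hp) _ (hτQ q hq) z hz hz')

/-- Menger's theorem: some separator `S` of `A` and `B` indexes a linkage from `A` to `B`, each
member of which contains its index. -/
theorem exists_separates_and_linkage [Finite α] (G : SimpleGraph α) (A B : Set α) :
    ∃ S M, Separates G A B S ∧ IsLinkage G A B S M ∧ ∀ s ∈ S, s ∈ M s := by
  classical
  have := Fintype.ofFinite α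
  have hex : ∃ n, ∃ S, Separates G A B S ∧ S.card = n :=
    ⟨_, Finset.univ, fun K _ ⟨a, ha, _⟩ _ => ⟨a, ha, by simp⟩, rfl⟩
  obtain ⟨S, hS, hSn⟩ := Nat.find_spec hex
  obtain ⟨I, M, hI, hM⟩ := exists_linkage_of_forall_separates G A B (Nat.find hex)
    fun T hT => Nat.find_min' hex ⟨T, hT, rfl⟩
  obtain ⟨-, M', hM', hmem⟩ := hM.reindex (P := S)
    (fun i hi => hS _ (hM.connected i hi) (hM.left i hi) (hM.right i hi)) (by omega)
  exact ⟨S, M', hS, hM', hmem⟩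

end Menger

/-! ### Connected subgraphs of bounded degree -/

section Core

variable {α : Type*} {G H : SimpleGraph α} {Z N X : Set α} {s u v w : α}

/-- `H` is a connected subgraph of `G` with vertex set `Z`. -/
structure IsCore (G H : SimpleGraph α) (Z : Set α) : Prop where
  le : H ≤ G
  mem_of_adj : ∀ u v, H.Adj u v → u ∈ Z
  connected : ConnectedOn H Z

theorem IsCore.neighborSet_eq_empty (hH : IsCore G H Z) (hv : v ∉ Z) : H.neighborSet v = ∅ :=
  Set.eq_empty_of_forall_notMem fun w hw => hv (hH.mem_of_adj v w hw)

theorem IsCore.sup_edge (hH : IsCore G H Z) (hu : u ∈ Z) (huv : G.Adj u v) :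
    IsCore G (H ⊔ edge u v) (insert v Z) := by
  refine ⟨sup_le hH.le ((edge_le_iff G).2 (Or.inr huv)), fun p q hpq => ?_, ?_⟩
  · rw [sup_adj, edge_adj] at hpq
    rcases hpq with hpq | ⟨⟨rfl, rfl⟩ | ⟨rfl, rfl⟩, -⟩
    exacts [Or.inr (hH.mem_of_adj p q hpq), Or.inr hu, Or.inl rfl]
  · refine (hH.connected.mono le_sup_left).insert hu ?_
    rw [sup_adj, edge_adj]
    exact Or.inr ⟨Or.inl ⟨rfl, rfl⟩, huv.ne⟩

theorem ncard_neighborSet_sup_edge_of_ne (hu : w ≠ u) (hv : w ≠ v) :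
    ((H ⊔ edge u v).neighborSet w).ncard = (H.neighborSet w).ncard := by
  congr 1
  ext x
  simp [edge_adj, hu, hv]

theorem ncard_neighborSet_sup_edge_left_le [Finite α] :
    ((H ⊔ edge u v).neighborSet u).ncard ≤ (H.neighborSet u).ncard + 1 := by
  refine (Set.ncard_le_ncard (t := insert v (H.neighborSet u)) ?_ (Set.toFinite _)).trans
    (Set.ncard_insert_le _ _)
  intro x hx
  rw [mem_neighborSet, sup_adj, edge_adj] at hx
  rcases hx with hx | ⟨⟨-, rfl⟩ | ⟨h, rfl⟩, hne⟩
  exacts [Or.inr hx, Or.inl rfl, absurd rfl hne]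

theorem IsCore.ncard_neighborSet_sup_edge_right_le (hH : IsCore G H Z) (hv : v ∉ Z) :
    ((H ⊔ edge u v).neighborSet v).ncard ≤ 1 := by
  refine (Set.ncard_le_ncard (t := {u}) ?_ (Set.toFinite _)).trans (Set.ncard_singleton u).le
  intro x hx
  rw [mem_neighborSet, sup_adj, edge_adj] at hx
  rcases hx with hx | ⟨⟨rfl, rfl⟩ | ⟨-, rfl⟩, hne⟩
  exacts [absurd (hH.mem_of_adj _ _ hx) hv, absurd rfl hne, rfl]

theorem IsCore.exists_attach_walk [Finite α] (hH : IsCore G H Z) {z : α} (hz : z ∈ Z) :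
    ∀ {s : α} (p : G.Walk s z), p.IsPath → s ∉ Z →
    ∃ H' Z', IsCore G H' Z' ∧ Z ⊆ Z' ∧ s ∈ Z' ∧ (∀ x ∈ Z', x ∈ Z ∨ x ∈ p.support) ∧
      (∃ y ∈ Z, y ∈ p.support ∧ (H'.neighborSet y).ncard ≤ (H.neighborSet y).ncard + 1 ∧
        ∀ v ∈ Z, v ≠ y → (H'.neighborSet v).ncard ≤ (H.neighborSet v).ncard) ∧
      (∀ v, v ∉ Z → (H'.neighborSet v).ncard ≤ 2) ∧ (H'.neighborSet s).ncard ≤ 1 := by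
  intro s p
  induction p with
  | nil => exact fun _ h => absurd hz h
  | @cons s t _ hst p ih =>
    intro hp hs
    rw [Walk.cons_isPath_iff] at hp
    by_cases ht : t ∈ Z
    · refine ⟨H ⊔ edge t s, insert s Z, hH.sup_edge ht hst.symm, Set.subset_insert _ _, Or.inl rfl,
        ?_, ⟨t, ht, by simp, ncard_neighborSet_sup_edge_left_le, fun v hv hvt => ?_⟩,
        fun v hv => ?_, hH.ncard_neighborSet_sup_edge_right_le hs⟩
      · rintro x (rfl | hx)
        exacts [Or.inr (by simp), Or.inl hx]
      · exact (ncard_neighborSet_sup_edge_of_ne hvt (ne_of_mem_of_not_mem hv hs)).le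
      · by_cases hvs : v = s
        · subst hvs
          exact (hH.ncard_neighborSet_sup_edge_right_le hs).trans (by norm_num)
        · rw [ncard_neighborSet_sup_edge_of_ne (ne_of_mem_of_not_mem ht hv).symm hvs,
            hH.neighborSet_eq_empty hv]
          simp
    · obtain ⟨H', Z', hH', hZZ, htZ, hZ', ⟨y, hy, hyp, hydeg, hdeg⟩, hdeg₂, hdeg₁⟩ := ih hz hp.1 ht
      have hsZ : s ∉ Z' := fun h => (hZ' s h).elim hs hp.2
      have hold : ∀ v ∈ Z, ((H' ⊔ edge t s).neighborSet v).ncard = (H'.neighborSet v).ncard :=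
        fun v hv => ncard_neighborSet_sup_edge_of_ne (ne_of_mem_of_not_mem hv ht)
          (ne_of_mem_of_not_mem hv hs)
      refine ⟨H' ⊔ edge t s, insert s Z', hH'.sup_edge htZ hst.symm,
        hZZ.trans (Set.subset_insert _ _), Or.inl rfl, ?_,
        ⟨y, hy, by simp [hyp], (hold y hy).trans_le hydeg,
          fun v hv hvy => (hold v hv).trans_le (hdeg v hv hvy)⟩,
        fun v hv => ?_, hH'.ncard_neighborSet_sup_edge_right_le hsZ⟩
      · rintro x (rfl | hx)
        · exact Or.inr (by simp)
        · exact (hZ' x hx).imp_right fun h => by simp [h]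
      · by_cases hvs : v = s
        · subst hvs
          exact (hH'.ncard_neighborSet_sup_edge_right_le hsZ).trans (by norm_num)
        · by_cases hvt : v = t
          · subst hvt
            exact ncard_neighborSet_sup_edge_left_le.trans (by omega)
          · rw [ncard_neighborSet_sup_edge_of_ne hvt hvs]
            exact hdeg₂ v hv

/-- A core extends to a new vertex `s` inside any connected set joining `s` to it, raising the
degree of only one old vertex. -/
theorem IsCore.exists_attach [Finite α] (hH : IsCore G H Z) (hN : ConnectedOn G N) (hs : s ∈ N)
    (hsZ : s ∉ Z) (hNZ : (N ∩ Z).Nonempty) :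
    ∃ H' Z', IsCore G H' Z' ∧ Z ⊆ Z' ∧ s ∈ Z' ∧ Z' ⊆ Z ∪ N ∧
      (∃ y ∈ N ∩ Z, (H'.neighborSet y).ncard ≤ (H.neighborSet y).ncard + 1 ∧
        ∀ v ∈ Z, v ≠ y → (H'.neighborSet v).ncard ≤ (H.neighborSet v).ncard) ∧
      (∀ v, v ∉ Z → (H'.neighborSet v).ncard ≤ 2) ∧ (H'.neighborSet s).ncard ≤ 1 := by
  obtain ⟨z, hzN, hz⟩ := hNZ
  obtain ⟨p, hp, hpN⟩ := hN.exists_walk hs hzN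
  obtain ⟨H', Z', hH', hZZ, hsZ', hZ', ⟨y, hy, hyp, hdeg⟩, hdeg'⟩ := hH.exists_attach_walk hz p hp hsZ
  exact ⟨H', Z', hH', hZZ, hsZ', fun x hx => (hZ' x hx).imp_right (hpN x),
    ⟨y, ⟨hpN y hyp, hy⟩, hdeg⟩, hdeg'⟩

theorem IsCore.exists_attach_finset [Finite α] (hH : IsCore G H Z) {N : α → Set α}
    (hdeg : ∀ v, (H.neighborSet v).ncard ≤ 3) (J : Finset α)
    (hN : ∀ s ∈ J, ConnectedOn G (N s)) (hs : ∀ s ∈ J, s ∈ N s) (hsZ : ∀ s ∈ J, s ∉ Z)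
    (hNZ : ∀ s ∈ J, (N s ∩ Z).Nonempty)
    (hdisj : ∀ s ∈ J, ∀ t ∈ J, ∀ z, z ∈ N s → z ∈ N t → s = t)
    (hdeg₂ : ∀ s ∈ J, ∀ v ∈ N s ∩ Z, (H.neighborSet v).ncard ≤ 2) :
    ∃ H' Z', IsCore G H' Z' ∧ Z ⊆ Z' ∧ ↑J ⊆ Z' ∧ (∀ z ∈ Z', z ∈ Z ∨ ∃ s ∈ J, z ∈ N s) ∧
      (∀ v, (H'.neighborSet v).ncard ≤ 3) ∧ (∀ s ∈ J, (H'.neighborSet s).ncard ≤ 1) ∧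
      (∀ v ∈ Z, (∀ s ∈ J, v ∉ N s) → (H'.neighborSet v).ncard ≤ (H.neighborSet v).ncard) := by
  classical
  induction J using Finset.induction_on with
  | empty =>
    exact ⟨H, Z, hH, subset_rfl, by simp, fun z hz => Or.inl hz, hdeg, by simp, fun _ _ _ => le_rfl⟩
  | insert s J hsJ ih =>
    have hJ : ∀ t ∈ J, t ∈ insert s J := fun t => Finset.mem_insert_of_mem
    have hsI : s ∈ insert s J := Finset.mem_insert_self _ _
    obtain ⟨H₁, Z₁, hH₁, hZZ₁, hJZ₁, hZ₁, hd₃, hd₁, hdo⟩ := ih (fun t ht => hN t (hJ t ht))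
      (fun t ht => hs t (hJ t ht)) (fun t ht => hsZ t (hJ t ht)) (fun t ht => hNZ t (hJ t ht))
      (fun t ht t' ht' => hdisj t (hJ t ht) t' (hJ t' ht')) (fun t ht => hdeg₂ t (hJ t ht))
    have hNJ : ∀ z ∈ N s, ∀ t ∈ J, z ∉ N t := fun z hz t ht hzt =>
      hsJ (hdisj s hsI t (hJ t ht) z hz hzt ▸ ht)
    have hsZ₁ : s ∉ Z₁ := fun h => (hZ₁ s h).elim (hsZ s hsI)
      fun ⟨t, ht, hst⟩ => hNJ s (hs s hsI) t ht hst
    obtain ⟨H', Z', hH', hZZ, hsZ', hZ', ⟨y, hy, hyd, hyo⟩, hd₂, hds⟩ :=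
      hH₁.exists_attach (hN s hsI) (hs s hsI) hsZ₁ ((hNZ s hsI).mono
        (Set.inter_subset_inter_right _ hZZ₁))
    have hyZ : y ∈ Z := (hZ₁ y hy.2).resolve_right fun ⟨t, ht, hyt⟩ => hNJ y hy.1 t ht hyt
    refine ⟨H', Z', hH', hZZ₁.trans hZZ, ?_, fun z hz => ?_, fun v => ?_, fun t ht => ?_,
      fun v hv hvN => ?_⟩
    · rw [Finset.coe_insert]
      exact Set.insert_subset hsZ' (hJZ₁.trans hZZ)
    · rcases hZ' hz with hz | hz
      · exact (hZ₁ z hz).imp_right fun ⟨t, ht, hzt⟩ => ⟨t, hJ t ht, hzt⟩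
      · exact Or.inr ⟨s, hsI, hz⟩
    · by_cases hv : v ∈ Z₁
      · by_cases hvy : v = y
        · subst hvy
          have := hdo v hyZ (hNJ v hy.1)
          have := hdeg₂ s hsI v ⟨hy.1, hyZ⟩
          omega
        · exact (hyo v hv hvy).trans (hd₃ v)
      · exact (hd₂ v hv).trans (by norm_num)
    · rcases Finset.mem_insert.1 ht with rfl | ht
      · exact hds
      · refine (hyo t (hJZ₁ ht) ?_).trans (hd₁ t ht)
        rintro rfl
        exact hNJ t hy.1 t ht (hs t (hJ t ht))
    · refine (hyo v (hZZ₁ hv) ?_).trans (hdo v hv fun t ht => hvN t (hJ t ht))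
      rintro rfl
      exact hvN s hsI hy.1

/-- A connected set of maximum degree three splits off a connected part with between `d` and
`2 * d - 1` vertices of `X`, leaving the rest connected. -/
theorem ConnectedOn.exists_split [Finite α] {d : ℕ} (hd : 0 < d)
    (hdeg : ∀ v, (H.neighborSet v).ncard ≤ 3) : ∀ (Z : Set α) (u : α), ConnectedOn H Z → u ∈ Z →
    (H.neighborSet u ∩ Z).ncard ≤ 2 → d ≤ (Z ∩ X).ncard →
    ∃ D ⊆ Z, ConnectedOn H D ∧ d ≤ (D ∩ X).ncard ∧ (D ∩ X).ncard ≤ 2 * d - 1 ∧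
      (D = Z ∨ ConnectedOn H (Z \ D) ∧ u ∈ Z \ D) := by
  classical
  intro Z
  induction hn : Z.ncard using Nat.strong_induction_on generalizing Z with
  | _ n ih =>
  subst hn
  intro u hZ hu hudeg hdZ
  by_cases hle : (Z ∩ X).ncard ≤ 2 * d - 1
  · exact ⟨Z, subset_rfl, hZ, hdZ, hle, Or.inl rfl⟩
  have hcover : ∀ z ∈ Z, z ≠ u → ∃ w ∈ H.neighborSet u ∩ Z, z ∈ componentOn H (Z \ {u}) w := by
    intro z hz hzu
    have hz' : z ∈ Z \ {u} := ⟨hz, hzu⟩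
    obtain ⟨w, hw, hwu⟩ := hZ.exists_adj_componentOn hz hu hzu
    exact ⟨w, ⟨hwu.symm, (componentOn_subset hw).1⟩, (connectedOn_componentOn hz').subset_componentOn
      componentOn_subset hw (mem_componentOn_self hz')⟩
  obtain ⟨w, hw, hwd⟩ : ∃ w ∈ H.neighborSet u ∩ Z, d ≤ (componentOn H (Z \ {u}) w ∩ X).ncard := by
    by_contra! hsmall
    have hsub : (Z ∩ X).toFinite.toFinset ⊆ Insert.insert u ((H.neighborSet u ∩ Z).toFinite.toFinset.biUnion
        fun w => (componentOn H (Z \ {u}) w ∩ X).toFinite.toFinset) := by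
      intro z hz
      rw [Set.Finite.mem_toFinset] at hz
      by_cases hzu : z = u
      · simp [hzu]
      · obtain ⟨w, hw, hzw⟩ := hcover z hz.1 hzu
        refine Finset.mem_insert_of_mem (Finset.mem_biUnion.2 ⟨w, by simpa using hw, ?_⟩)
        simpa using ⟨hzw, hz.2⟩
    have h₁ := (Finset.card_le_card hsub).trans (Finset.card_insert_le _ _)
    have h₂ := Finset.card_biUnion_le_card_mul (H.neighborSet u ∩ Z).toFinite.toFinset
      (fun w => (componentOn H (Z \ {u}) w ∩ X).toFinite.toFinset) (d - 1) (fun w hw => by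
        have := hsmall w (by simpa using hw)
        rw [← Set.ncard_eq_toFinset_card]
        omega)
    rw [← Set.ncard_eq_toFinset_card] at h₁ h₂
    have h₃ := Nat.mul_le_mul_right (d - 1) hudeg
    omega
  have hwu : w ∈ Z \ {u} := ⟨hw.2, hw.1.ne'⟩
  set K := componentOn H (Z \ {u}) w with hK
  have hKsub : K ⊆ Z \ {u} := componentOn_subset
  have huK : u ∉ K := fun h => (hKsub h).2 rfl
  have hKZ : K ⊆ Z := hKsub.trans Set.sdiff_subset
  have hwK : w ∈ K := mem_componentOn_self hwu
  have hrest : ConnectedOn H (Z \ K) := by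
    have huZ : u ∈ Z \ K := ⟨hu, huK⟩
    have heq : componentOn H (Z \ K) u = Z \ K := by
      refine Set.Subset.antisymm componentOn_subset fun z hz => ?_
      by_cases hzu : z = u
      · rw [hzu]
        exact mem_componentOn_self huZ
      · have hz' : z ∈ Z \ {u} := ⟨hz.1, hzu⟩
        obtain ⟨x, hx, hxu⟩ := hZ.exists_adj_componentOn hz.1 hu hzu
        refine (((connectedOn_componentOn hz').insert hx hxu).subset_componentOn ?_ (Or.inl rfl))
          (Or.inr (mem_componentOn_self hz'))
        refine Set.insert_subset huZ fun y hy => ⟨(componentOn_subset hy).1, fun hyK => hz.2 ?_⟩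
        have := (connectedOn_componentOn hz').union (connectedOn_componentOn hwu) ⟨y, hy, hyK⟩
        exact this.subset_componentOn (Set.union_subset componentOn_subset hKsub) (Or.inr hwK)
          (Or.inl (mem_componentOn_self hz'))
    rw [← heq]
    exact connectedOn_componentOn huZ
  have hwdeg : (H.neighborSet w ∩ K).ncard ≤ 2 := by
    have hlt : (H.neighborSet w ∩ K).ncard < (H.neighborSet w).ncard :=
      Set.ncard_lt_ncard ((Set.ssubset_iff_of_subset Set.inter_subset_left).2
        ⟨u, hw.1.symm, fun h => huK h.2⟩) (Set.toFinite _)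
    have := hdeg w
    omega
  obtain ⟨D, hDK, hDc, hd₁, hd₂, hD⟩ := ih K.ncard (Set.ncard_lt_ncard
    ((Set.ssubset_iff_of_subset hKZ).2 ⟨u, hu, huK⟩) (Set.toFinite _)) K rfl w
    (connectedOn_componentOn hwu) hwK hwdeg hwd
  refine ⟨D, hDK.trans hKZ, hDc, hd₁, hd₂, Or.inr ⟨?_, hu, fun h => huK (hDK h)⟩⟩
  rcases hD with rfl | ⟨hc, hwD⟩
  · exact hrest
  · have : Z \ D = Z \ K ∪ K \ D := by
      ext z
      constructor
      · rintro ⟨hz, hzD⟩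
        by_cases hzK : z ∈ K
        exacts [Or.inr ⟨hzK, hzD⟩, Or.inl ⟨hz, hzK⟩]
      · rintro (⟨hz, hzK⟩ | ⟨hz, hzD⟩)
        exacts [⟨hz, fun h => hzK (hDK h)⟩, ⟨hKZ hz, hzD⟩]
    rw [this]
    exact hrest.union_of_adj hc ⟨hu, huK⟩ hwD hw.1

theorem ConnectedOn.exists_pieces [Finite α] {d : ℕ} (hd : 0 < d)
    (hdeg : ∀ v, (H.neighborSet v).ncard ≤ 3) (m : ℕ) : ∀ (Z : Set α), ConnectedOn H Z → u ∈ Z →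
    (H.neighborSet u).ncard ≤ 2 → m * (2 * d - 1) + d ≤ (Z ∩ X).ncard →
    ∃ P : Fin (m + 1) → Set α, (∀ i, P i ⊆ Z) ∧ (∀ i, ConnectedOn H (P i)) ∧
      (∀ i, d ≤ (P i ∩ X).ncard) ∧ Pairwise fun i j => Disjoint (P i) (P j) := by
  induction m with
  | zero =>
    intro Z hZ hu hudeg hX
    exact ⟨fun _ => Z, fun _ => subset_rfl, fun _ => hZ, fun _ => by simpa using hX,
      fun i j hij => absurd (Subsingleton.elim (α := Fin 1) i j) hij⟩
  | succ m ih =>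
    intro Z hZ hu hudeg hX
    have hmul : (m + 1) * (2 * d - 1) = m * (2 * d - 1) + (2 * d - 1) := by ring
    obtain ⟨D, hDZ, hDc, hd₁, hd₂, hD⟩ := hZ.exists_split (X := X) hd hdeg Z u hu
      ((Set.ncard_le_ncard Set.inter_subset_left (Set.toFinite _)).trans hudeg) (by omega)
    rcases hD with rfl | ⟨hc, huD⟩
    · omega
    have hcard : (Z ∩ X).ncard ≤ (D ∩ X).ncard + ((Z \ D) ∩ X).ncard := by
      refine (Set.ncard_le_ncard ?_ (Set.toFinite _)).trans (Set.ncard_union_le _ _)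
      intro z hz
      by_cases hzD : z ∈ D
      exacts [Or.inl ⟨hzD, hz.2⟩, Or.inr ⟨⟨hz.1, hzD⟩, hz.2⟩]
    obtain ⟨P, hP, hPc, hPd, hPdisj⟩ := ih (Z \ D) hc huD hudeg (by omega)
    have hPD : ∀ i, Disjoint D (P i) := fun i =>
      Set.disjoint_left.2 fun z hzD hz => (hP i hz).2 hzD
    refine ⟨Fin.cons D P, fun i => ?_, fun i => ?_, fun i => ?_, fun i j hij => ?_⟩
    · refine Fin.cases hDZ (fun i => ?_) i
      exact (hP i).trans Set.sdiff_subset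
    · exact Fin.cases hDc hPc i
    · exact Fin.cases hd₁ hPd i
    · induction i using Fin.cases with
      | zero =>
        induction j using Fin.cases with
        | zero => exact absurd rfl hij
        | succ j => exact hPD j
      | succ i =>
        induction j using Fin.cases with
        | zero => exact (hPD i).symm
        | succ j => exact hPdisj fun h => hij (congrArg Fin.succ h)

end Core

/-! ### Choosing heavy entries of a matrix -/

theorem exists_heavy_entries {k c : ℕ} (m : Fin (3 * k) → Fin (3 * k) → ℕ)
    (hrow : ∀ a, 4 * k * c + 1 ≤ ∑ b, m a b) (hcol : ∀ b, ∑ a, m a b ≤ 4 * k * c + 1) :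
    ∃ f g : Fin k → Fin (3 * k), f.Injective ∧ g.Injective ∧ ∀ j, c < m (f j) (g j) := by
  suffices h : ∀ t ≤ k, ∃ f g : Fin t → Fin (3 * k),
      f.Injective ∧ g.Injective ∧ ∀ j, c < m (f j) (g j) from h k le_rfl
  intro t
  induction t with
  | zero =>
    exact fun _ => ⟨Fin.elim0, Fin.elim0, fun i => i.elim0, fun i => i.elim0, fun i => i.elim0⟩
  | succ t ih =>
    intro ht
    obtain ⟨f, g, hf, hg, hfg⟩ := ih (by omega)
    set A := (Finset.univ.image f)ᶜ with hA
    set B := Finset.univ.image g with hB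
    have hAcard : A.card = 3 * k - t := by
      rw [hA, Finset.card_compl, Finset.card_image_of_injective _ hf]
      simp
    have hBcard : B.card = t := by
      rw [hB, Finset.card_image_of_injective _ hg]
      simp
    have hBcard' : Bᶜ.card = 3 * k - t := by
      rw [Finset.card_compl, hBcard]
      simp
    obtain ⟨a, ha, b, hb, hab⟩ : ∃ a ∈ A, ∃ b ∈ Bᶜ, c < m a b := by
      by_contra! hle
      have h₁ : A.card * (4 * k * c + 1) ≤ ∑ a ∈ A, ∑ b, m a b := by
        exact (smul_eq_mul _ _).symm.trans_le (Finset.card_nsmul_le_sum _ _ _ fun a _ => hrow a)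
      have h₂ : ∑ a ∈ A, ∑ b, m a b = ∑ a ∈ A, ∑ b ∈ B, m a b + ∑ a ∈ A, ∑ b ∈ Bᶜ, m a b := by
        rw [← Finset.sum_add_distrib]
        exact Finset.sum_congr rfl fun a _ => (Finset.sum_add_sum_compl B _).symm
      have h₃ : ∑ a ∈ A, ∑ b ∈ B, m a b ≤ B.card * (4 * k * c + 1) := by
        rw [Finset.sum_comm]
        refine (Finset.sum_le_card_nsmul _ _ _ fun b _ => le_trans ?_ (hcol b)).trans_eq
          (smul_eq_mul _ _)
        exact Finset.sum_le_sum_of_subset (Finset.subset_univ A)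
      have h₄ : ∑ a ∈ A, ∑ b ∈ Bᶜ, m a b ≤ A.card * (Bᶜ.card * c) := by
        refine (Finset.sum_le_card_nsmul _ _ _ fun a ha => ?_).trans_eq (smul_eq_mul _ _)
        exact (Finset.sum_le_card_nsmul _ _ _ fun b hb => hle a ha b hb).trans_eq (smul_eq_mul _ _)
      rw [hAcard] at h₁ h₄
      rw [hBcard'] at h₄
      rw [hBcard] at h₃
      obtain ⟨e, rfl⟩ : ∃ e, k = t + 1 + e := ⟨k - (t + 1), by omega⟩
      rw [show 3 * (t + 1 + e) - t = 2 * t + 3 * e + 3 by omega] at h₁ h₄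
      have h₅ := h₁.trans (h₂.le.trans (Nat.add_le_add h₃ h₄))
      ring_nf at h₅
      nlinarith [Nat.zero_le (c * t * e), Nat.zero_le (c * t), Nat.zero_le (c * e ^ 2),
        Nat.zero_le (c * e)]
    have ha' : ∀ i, f i ≠ a := by simpa [hA] using ha
    have hb' : ∀ i, g i ≠ b := by simpa [hB] using hb
    refine ⟨Fin.cons a f, Fin.cons b g, ?_, ?_, fun j => ?_⟩
    · exact Fin.cons_injective_iff.2 ⟨fun ⟨i, hi⟩ => ha' i hi, hf⟩
    · exact Fin.cons_injective_iff.2 ⟨fun ⟨i, hi⟩ => hb' i hi, hg⟩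
    · exact Fin.cases hab hfg j

/-! ### From linkages to disjoint models of `K_{2,r}` -/

section Link

variable {α : Type*} {G : SimpleGraph α} {C T M Z : Set α} {x y z : α}

/-- The subgraph of `G` formed by the edges inside `C` and those between `C` and `T`. -/
def linkGraph (G : SimpleGraph α) (C T : Set α) : SimpleGraph α where
  Adj a b := G.Adj a b ∧ a ∈ C ∪ T ∧ b ∈ C ∪ T ∧ (a ∈ C ∨ b ∈ C)
  symm := ⟨fun _ _ h => ⟨h.1.symm, h.2.2.1, h.2.1, h.2.2.2.symm⟩⟩
  loopless := ⟨fun _ h => h.1.ne rfl⟩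

theorem linkGraph_le : linkGraph G C T ≤ G := fun _ _ h => h.1

theorem ConnectedOn.mem_of_linkGraph (hM : ConnectedOn (linkGraph G C T) M) (hx : x ∈ M)
    (hz : z ∈ M) (hxz : x ≠ z) : z ∈ C ∪ T := by
  obtain ⟨u, hu, w, -, h⟩ := hM.exists_adj (K := {z}) (by simpa using hz)
    ⟨z, Set.mem_singleton z⟩ (fun h => hxz (h.symm.subset hx))
  obtain rfl : u = z := hu
  exact h.2.1

/-- A connected set of `linkGraph G C T` that meets `T` in exactly two vertices contains a
connected subset of `C` adjacent to both. -/
theorem ConnectedOn.exists_middle (hM : ConnectedOn (linkGraph G C T) M) (hCT : Disjoint C T)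
    (hx : x ∈ M) (hy : y ∈ M) (hxy : x ≠ y) (hxT : x ∈ T) (hyT : y ∈ T)
    (hT : ∀ z ∈ M, z ∈ T → z = x ∨ z = y) :
    ∃ L ⊆ M ∩ C, ConnectedOn G L ∧ (∃ u ∈ L, G.Adj x u) ∧ ∃ u ∈ L, G.Adj y u := by
  have hx' : x ∈ M \ {y} := ⟨hx, hxy⟩
  obtain ⟨k, hk, hky⟩ := hM.exists_adj_componentOn hx hy hxy
  have hK := connectedOn_componentOn (G := linkGraph G C T) hx'
  have hKM : componentOn (linkGraph G C T) (M \ {y}) x ⊆ M \ {y} := componentOn_subset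
  have hkx : k ≠ x := by
    rintro rfl
    exact hky.2.2.2.elim (fun h => Set.disjoint_left.1 hCT h hxT)
      (fun h => Set.disjoint_left.1 hCT h hyT)
  obtain ⟨u, hu, hux⟩ := hK.exists_adj_componentOn hk (mem_componentOn_self hx') hkx
  have hk' : k ∈ componentOn (linkGraph G C T) (M \ {y}) x \ {x} := ⟨hk, hkx⟩
  refine ⟨_, fun z hz => ?_, (connectedOn_componentOn hk').mono linkGraph_le,
    ⟨u, hu, hux.1.symm⟩, ⟨k, mem_componentOn_self hk', hky.1.symm⟩⟩
  have hz' := componentOn_subset hz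
  have hzM := hKM hz'.1
  have hzx : z ≠ x := hz'.2
  have hzy : z ≠ y := hzM.2
  refine ⟨hzM.1, (hM.mem_of_linkGraph hx hzM.1 hzx.symm).resolve_right fun h => ?_⟩
  exact (hT z hzM.1 h).elim hzx hzy

theorem hasDisjointModels_of_isLinkage {k c : ℕ} {P Q : Fin (3 * k) → Set α} {A B I : Finset α}
    {N : α → Set α} (hZC : Disjoint C Z) (hPZ : ∀ i, P i ⊆ Z) (hQZ : ∀ i, Q i ⊆ Z)
    (hPc : ∀ i, ConnectedOn G (P i)) (hQc : ∀ i, ConnectedOn G (Q i))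
    (hPP : Pairwise fun i j => Disjoint (P i) (P j))
    (hQQ : Pairwise fun i j => Disjoint (Q i) (Q j)) (hPQ : ∀ i j, Disjoint (P i) (Q j))
    (hAP : ∀ x ∈ A, ∃ i, x ∈ P i) (hBQ : ∀ x ∈ B, ∃ i, x ∈ Q i)
    (hPA : ∀ i, 4 * k * c + 1 ≤ ((A : Set α) ∩ P i).ncard)
    (hQB : ∀ i, ((B : Set α) ∩ Q i).ncard ≤ 4 * k * c + 1)
    (hN : IsLinkage (linkGraph G C (A ∪ B : Set α)) A B I N) (hAI : A.card ≤ I.card)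
    (hBI : B.card ≤ I.card) :
    HasDisjointModels (completeBipartiteGraph (Fin 2) (Fin (c + 1))) G k := by
  classical
  obtain ⟨hAI', M, hM, hself⟩ := hN.reindex (P := A) hN.left hAI
  choose! y hyM hyB using hM.right
  have hyinj : Set.InjOn y A := fun x hx x' hx' h =>
    hM.eq_of_mem x hx x' hx' (y x) (hyM x hx) (h ▸ hyM x' hx')
  have hyimg : A.image y = B := by
    refine Finset.eq_of_subset_of_card_le ?_ ?_
    · intro z hz
      obtain ⟨x, hx, rfl⟩ := Finset.mem_image.1 hz
      exact hyB x hx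
    · rw [Finset.card_image_of_injOn hyinj]
      omega
  have hT : ∀ x ∈ A, ∀ z ∈ M x, z ∈ (A ∪ B : Set α) → z = x ∨ z = y x := by
    rintro x hx z hz (hzA | hzB)
    · exact Or.inl (hM.eq_of_mem x hx z hzA z hz (hself z hzA)).symm
    · rw [Finset.mem_coe, ← hyimg] at hzB
      obtain ⟨x', hx', rfl⟩ := Finset.mem_image.1 hzB
      exact Or.inr (by rw [hM.eq_of_mem x hx x' hx' _ hz (hyM x' hx')])
  have hCT : Disjoint C (A ∪ B : Set α) := by
    refine hZC.mono_right (Set.union_subset (fun x hx => ?_) fun x hx => ?_)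
    · obtain ⟨i, hi⟩ := hAP x hx
      exact hPZ i hi
    · obtain ⟨i, hi⟩ := hBQ x hx
      exact hQZ i hi
  have hxy : ∀ x ∈ A, x ≠ y x := by
    intro x hx h
    obtain ⟨i, hi⟩ := hAP x hx
    obtain ⟨j, hj⟩ := hBQ (y x) (hyB x hx)
    exact Set.disjoint_left.1 (hPQ i j) hi (by rwa [h])
  have hmid : ∀ x ∈ A, ∃ L ⊆ M x ∩ C, ConnectedOn G L ∧ (∃ u ∈ L, G.Adj x u) ∧
      ∃ u ∈ L, G.Adj (y x) u := fun x hx =>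
    (hM.connected x hx).exists_middle hCT (hself x hx) (hyM x hx) (hxy x hx) (Or.inl hx)
      (Or.inr (hyB x hx)) (hT x hx)
  choose! L hLM hLc hLx hLy using hmid
  let F : Fin (3 * k) → Fin (3 * k) → Finset α := fun a b => A.filter fun x => x ∈ P a ∧ y x ∈ Q b
  have hF : ∀ a b x, x ∈ F a b ↔ x ∈ A ∧ x ∈ P a ∧ y x ∈ Q b := fun a b x => Finset.mem_filter
  obtain ⟨f, g, hf, hg, hfg⟩ := exists_heavy_entries (c := c) (fun a b => (F a b).card) (by
    intro a
    refine ((hPA a).trans ?_).trans (Finset.card_biUnion_le (s := Finset.univ) (t := F a))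
    rw [← Set.ncard_coe_finset]
    refine Set.ncard_le_ncard (fun x hx => ?_) (Finset.finite_toSet _)
    obtain ⟨b, hb⟩ := hBQ (y x) (hyB x hx.1)
    simp only [Finset.coe_biUnion, Set.mem_iUnion]
    exact ⟨b, Finset.mem_univ b, (hF a b x).2 ⟨hx.1, hx.2, hb⟩⟩) (by
    intro b
    refine le_trans ?_ (hQB b)
    rw [← Finset.card_biUnion, ← Set.ncard_coe_finset]
    · refine Set.ncard_le_ncard_of_injOn y (fun x hx => ?_) (hyinj.mono fun x hx => ?_)
        (B.finite_toSet.inter_of_left _)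
      · simp only [Finset.coe_biUnion, Set.mem_iUnion] at hx
        obtain ⟨a, -, hx⟩ := hx
        have := (hF a b x).1 hx
        exact ⟨hyB x this.1, this.2.2⟩
      · simp only [Finset.coe_biUnion, Set.mem_iUnion] at hx
        obtain ⟨a, -, hx⟩ := hx
        exact ((hF a b x).1 hx).1
    · intro a _ a' _ haa'
      refine Finset.disjoint_left.2 fun x hx hx' => ?_
      exact Set.disjoint_left.1 (hPP haa') ((hF a b x).1 hx).2.1 ((hF a' b x).1 hx').2.1)
  let e : Fin k → Fin (c + 1) → α := fun j i =>
    ((F (f j) (g j)).equivFin.symm (Fin.castLE (hfg j) i)).1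
  have he : ∀ j i, e j i ∈ F (f j) (g j) := fun j i => Subtype.prop _
  have heinj : ∀ j i i', e j i = e j i' → i = i' := fun j i i' h => by
    simpa using Subtype.ext h
  have heA : ∀ j i, e j i ∈ A := fun j i => ((hF _ _ _).1 (he j i)).1
  have heP : ∀ j i, e j i ∈ P (f j) := fun j i => ((hF _ _ _).1 (he j i)).2.1
  have heQ : ∀ j i, y (e j i) ∈ Q (g j) := fun j i => ((hF _ _ _).1 (he j i)).2.2
  have hPeq : ∀ {i j z}, z ∈ P i → z ∈ P j → i = j := fun {i j z} hi hj => by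
    by_contra hij
    exact Set.disjoint_left.1 (hPP hij) hi hj
  have hQeq : ∀ {i j z}, z ∈ Q i → z ∈ Q j → i = j := fun {i j z} hi hj => by
    by_contra hij
    exact Set.disjoint_left.1 (hQQ hij) hi hj
  have hLZ : ∀ {j i z}, z ∈ L (e j i) → z ∉ Z := fun {j i z} hz hzZ =>
    Set.disjoint_left.1 hZC (hLM _ (heA j i) hz).2 hzZ
  let S : Fin k → Fin 2 ⊕ Fin (c + 1) → Set α := fun j =>
    Sum.elim (fun a => if a = 0 then P (f j) else Q (g j)) fun i => L (e j i)
  have hS : ∀ j u j' u' z, z ∈ S j u → z ∈ S j' u' → j = j' ∧ u = u' := by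
    rintro j (a | i) j' (a' | i') z hz hz'
    · simp only [S, Sum.elim_inl] at hz hz'
      fin_cases a <;> fin_cases a' <;> simp at hz hz' ⊢
      · exact hf (hPeq hz hz')
      · exact Set.disjoint_left.1 (hPQ _ _) hz hz'
      · exact Set.disjoint_left.1 (hPQ _ _) hz' hz
      · exact hg (hQeq hz hz')
    · simp only [S, Sum.elim_inl, Sum.elim_inr] at hz hz'
      refine absurd ?_ (hLZ hz')
      split_ifs at hz
      exacts [hPZ _ hz, hQZ _ hz]
    · simp only [S, Sum.elim_inl, Sum.elim_inr] at hz hz'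
      refine absurd ?_ (hLZ hz)
      split_ifs at hz'
      exacts [hPZ _ hz', hQZ _ hz']
    · simp only [S, Sum.elim_inr] at hz hz'
      have h := hM.eq_of_mem _ (heA j i) _ (heA j' i') z (hLM _ (heA j i) hz).1
        (hLM _ (heA j' i') hz').1
      obtain rfl : j = j' := hf (hPeq (heP j i) (h ▸ heP j' i'))
      exact ⟨rfl, congrArg _ (heinj j i i' h)⟩
  have hadj : ∀ j (a : Fin 2) i, ∃ p ∈ S j (.inl a), ∃ q ∈ S j (.inr i), G.Adj p q := by
    intro j a i
    by_cases ha : a = 0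
    · obtain ⟨u, hu, h⟩ := hLx _ (heA j i)
      exact ⟨e j i, by simpa [S, ha] using heP j i, u, hu, h⟩
    · obtain ⟨u, hu, h⟩ := hLy _ (heA j i)
      exact ⟨y (e j i), by simpa [S, ha] using heQ j i, u, hu, h⟩
  refine ⟨S, fun j => ⟨?_, fun u v huv => ?_, ?_⟩, fun j j' hj => ?_⟩
  · rintro (a | i)
    · change ConnectedOn G (if a = 0 then P (f j) else Q (g j))
      split_ifs
      exacts [hPc _, hQc _]
    · exact hLc _ (heA j i)
  · exact Set.disjoint_left.2 fun z hz hz' => huv (hS j u j v z hz hz').2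
  · rintro (a | i) (a' | i') h
    · simp at h
    · exact hadj j a i'
    · obtain ⟨p, hp, q, hq, hpq⟩ := hadj j a' i
      exact ⟨q, hq, p, hp, hpq.symm⟩
    · simp at h
  · refine Set.disjoint_left.2 fun z hz hz' => ?_
    obtain ⟨u, hu⟩ := Set.mem_iUnion.1 hz
    obtain ⟨u', hu'⟩ := Set.mem_iUnion.1 hz'
    exact hj (hS j u j' u' z hu hu').1

end Link

/-! ### Scaffolds and the recursive decomposition -/

section Scaffold

variable {α : Type*} {G H : SimpleGraph α} {C D X Z T : Set α} {v : α}

theorem HasRootedDecomp.mono_root {b : ℕ} {V X Y : Set α} (h : HasRootedDecomp G b V Y)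
    (hXY : X ⊆ Y) : HasRootedDecomp G b V X := by
  obtain ⟨ι, T, D, r, hT, hr, h⟩ := h
  exact ⟨ι, T, D, r, hT, hXY.trans hr, h⟩

theorem ConnectedOn.exists_mem_outerNeighbors (hC : ConnectedOn G C) (hD : D.Nonempty)
    (hDC : D ⊆ C) (hne : D ≠ C) : ∃ s ∈ C, s ∈ outerNeighbors G D := by
  obtain ⟨u, hu, w, hw, huw⟩ := hC.exists_adj hDC hD hne
  exact ⟨w, hw.1, hw.2, u, hu, huw⟩

/-- `G` has a connected subgraph of maximum degree three that avoids `C` and contains the outer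
neighbours of `C`, these having degree at most two and one of them degree at most one. -/
def HasScaffold (G : SimpleGraph α) (C : Set α) : Prop :=
  ∃ H Z, IsCore G H Z ∧ Disjoint C Z ∧ outerNeighbors G C ⊆ Z ∧
    (∀ v, (H.neighborSet v).ncard ≤ 3) ∧
    (∀ v ∈ outerNeighbors G C, (H.neighborSet v).ncard ≤ 2) ∧
    ∃ x ∈ outerNeighbors G C, (H.neighborSet x).ncard ≤ 1

theorem HasScaffold.exists_vertex [Finite α] (hC : ConnectedOn G C) (h : HasScaffold G C) :
    ∃ v ∈ C, ∀ D ⊆ C \ {v}, ConnectedOn G D → outerNeighbors G D ⊆ outerNeighbors G C ∪ {v} →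
      HasScaffold G D := by
  obtain ⟨H, Z, hH, hCZ, hXZ, hd₃, hd₂, x, hx, hx₁⟩ := h
  obtain ⟨v, hv, hvx⟩ := hx.2
  have hvZ : v ∉ Z := Set.disjoint_left.1 hCZ hv
  have hdv := hH.ncard_neighborSet_sup_edge_right_le (u := x) hvZ
  have hdx : ((H ⊔ edge x v).neighborSet x).ncard ≤ 2 :=
    ncard_neighborSet_sup_edge_left_le.trans (by omega)
  refine ⟨v, hv, fun D hD hDc hDX => ⟨H ⊔ edge x v, insert v Z, hH.sup_edge (hXZ hx) hvx.symm,
    ?_, ?_, fun w => ?_, fun w hw => ?_, v, ?_, hdv⟩⟩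
  · refine Set.disjoint_left.2 fun z hz => ?_
    rintro (rfl | hzZ)
    exacts [(hD hz).2 rfl, Set.disjoint_left.1 hCZ (hD hz).1 hzZ]
  · intro z hz
    rcases hDX hz with h | h
    exacts [Or.inr (hXZ h), Or.inl h]
  · by_cases hwv : w = v
    · subst hwv
      omega
    · by_cases hwx : w = x
      · subst hwx
        omega
      · rw [ncard_neighborSet_sup_edge_of_ne hwx hwv]
        exact hd₃ w
  · by_cases hwv : w = v
    · subst hwv
      omega
    · by_cases hwx : w = x
      · subst hwx
        omega
      · rw [ncard_neighborSet_sup_edge_of_ne hwx hwv]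
        exact hd₂ w ((hDX hw).resolve_right hwv)
  · obtain ⟨s, hs, hsD⟩ := hC.exists_mem_outerNeighbors hDc.nonempty
      (hD.trans Set.sdiff_subset) (fun h => (hD (h.symm.subset hv)).2 rfl)
    rcases hDX hsD with h | rfl
    exacts [absurd hs h.1, hsD]

theorem hasScaffold_of_isLinkage [Finite α] (hC : ConnectedOn G C) (hH : IsCore G H Z)
    (hCZ : Disjoint C Z) (hXZ : outerNeighbors G C ⊆ Z)
    (hd₃ : ∀ v, (H.neighborSet v).ncard ≤ 3)
    (hd₂ : ∀ v ∈ outerNeighbors G C, (H.neighborSet v).ncard ≤ 2)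
    {A B S : Finset α} {M : α → Set α} (hBX : ↑B ⊆ outerNeighbors G C)
    (hTAB : T ⊆ A ∪ B) (hsep : Separates (linkGraph G C T) A B S)
    (hM : IsLinkage (linkGraph G C T) A B S M) (hself : ∀ s ∈ S, s ∈ M s)
    (hcard : S.card < B.card) (hDc : ConnectedOn G D) (hDC : D ⊆ C)
    (hDS : ∀ s ∈ S, s ∉ D) (hDX : outerNeighbors G D ⊆ outerNeighbors G C ∪ (S ∩ C))
    (hDB : ∀ b ∈ B, b ∈ outerNeighbors G D → b ∈ S) :
    HasScaffold G D ∧ (outerNeighbors G D).ncard < (outerNeighbors G C).ncard := by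
  classical
  have hBC : ∀ b ∈ B, b ∉ C := fun b hb => (hBX hb).1
  have hDne : D ≠ C := by
    rintro rfl
    exact absurd (Finset.card_le_card fun b hb => hDB b hb (hBX hb)) (by omega)
  have hsmall : (outerNeighbors G D).ncard < (outerNeighbors G C).ncard := by
    have h₁ : (outerNeighbors G D).ncard ≤ (outerNeighbors G C \ B ∪ S : Set α).ncard := by
      refine Set.ncard_le_ncard (fun z hz => ?_) (Set.toFinite _)
      rcases hDX hz with h | h
      · by_cases hzB : z ∈ B
        exacts [Or.inr (hDB z hzB hz), Or.inl ⟨h, hzB⟩]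
      · exact Or.inr h.1
    have h₂ := Set.ncard_union_le (outerNeighbors G C \ B) (S : Set α)
    have h₃ := Set.ncard_sdiff_add_ncard_of_subset hBX (Set.toFinite _)
    rw [Set.ncard_coe_finset] at h₂ h₃
    omega
  refine ⟨?_, hsmall⟩
  have key : ∀ s ∈ S.filter (· ∈ C), ∃ N ⊆ M s, ConnectedOn G N ∧ s ∈ N ∧ (N ∩ Z).Nonempty ∧
      (∀ z ∈ N, z ∈ Z → z ∈ B ∧ z ∉ S) ∧ Disjoint N D := by
    intro s hs
    obtain ⟨hs, hsC⟩ := Finset.mem_filter.1 hs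
    obtain ⟨y, hyM, hyB⟩ := hM.right s hs
    have hys : y ≠ s := by
      rintro rfl
      exact hBC y hyB hsC
    have hy : y ∈ M s \ {s} := ⟨hyM, hys⟩
    set K := componentOn (linkGraph G C T) (M s \ {s}) y with hKdef
    have hK : ConnectedOn (linkGraph G C T) K := connectedOn_componentOn hy
    have hKM : K ⊆ M s \ {s} := componentOn_subset
    have hyK : y ∈ K := mem_componentOn_self hy
    have hKS : ∀ z ∈ K, z ∉ S := fun z hz hzS =>
      (hKM hz).2 (hM.eq_of_mem z hzS s hs z (hself z hzS) (hKM hz).1)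
    have hKA : ∀ z ∈ K, z ∉ A := fun z hz hzA => by
      obtain ⟨t, ht, htS⟩ := hsep K hK ⟨z, hz, hzA⟩ ⟨y, hyK, hyB⟩
      exact hKS t ht htS
    have hKCB : ∀ z ∈ K, z ∈ C ∨ z ∈ B := by
      intro z hz
      rcases (hM.connected s hs).mem_of_linkGraph (hself s hs) (hKM hz).1
        (fun h => (hKM hz).2 h.symm) with h | h
      · exact Or.inl h
      · exact Or.inr ((hTAB h).resolve_left (hKA z hz))
    have hKD : ∀ z ∈ K, z ∉ D := by
      intro z hz hzD
      obtain ⟨p, hp, w, hw, hpw⟩ := hK.exists_adj (K := K ∩ D) Set.inter_subset_left ⟨z, hz, hzD⟩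
        (fun h => hBC y hyB (hDC (h.symm.subset hyK).2))
      have hwD : w ∈ outerNeighbors G D := ⟨fun h => hw.2 ⟨hw.1, h⟩, p, hp.2, hpw.1⟩
      rcases hKCB w hw.1 with h | h
      · exact (hDX hwD).elim (fun h' => h'.1 h) fun h' => hKS w hw.1 h'.1
      · exact hKS w hw.1 (hDB w h hwD)
    obtain ⟨t, ht, hts⟩ := (hM.connected s hs).exists_adj_componentOn hyM (hself s hs) hys
    refine ⟨insert s K, Set.insert_subset (hself s hs) (hKM.trans Set.sdiff_subset),
      (hK.mono linkGraph_le).insert ht hts.1, Or.inl rfl, ⟨y, Or.inr hyK, hXZ (hBX hyB)⟩, ?_, ?_⟩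
    · rintro z (rfl | hz) hzZ
      · exact absurd hzZ (Set.disjoint_left.1 hCZ hsC)
      · exact ⟨(hKCB z hz).resolve_left fun h => Set.disjoint_left.1 hCZ h hzZ, hKS z hz⟩
    · refine Set.disjoint_left.2 ?_
      rintro z (rfl | hz)
      exacts [hDS z hs, hKD z hz]
  choose! N hNM hNc hsN hNZ hNB hND using key
  obtain ⟨H', Z', hH', hZZ, hJZ, hZ', hd₃', hd₁', hd'⟩ := hH.exists_attach_finset (N := N) hd₃
    (S.filter (· ∈ C)) hNc hsN (fun s hs => Set.disjoint_left.1 hCZ (Finset.mem_filter.1 hs).2) hNZ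
    (fun s hs t ht z hz hz' => hM.eq_of_mem s (Finset.mem_filter.1 hs).1 t
      (Finset.mem_filter.1 ht).1 z (hNM s hs hz) (hNM t ht hz'))
    (fun s hs z hz => hd₂ z (hBX (hNB s hs z hz.1 hz.2).1))
  have hJ : ∀ z ∈ (S ∩ C : Set α), z ∈ S.filter (· ∈ C) := fun z hz => Finset.mem_filter.2 hz
  refine ⟨H', Z', hH', ?_, fun z hz => ?_, hd₃', fun z hz => ?_, ?_⟩
  · refine Set.disjoint_left.2 fun z hz hzZ => ?_
    rcases hZ' z hzZ with h | ⟨s, hs, hzs⟩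
    exacts [Set.disjoint_left.1 hCZ (hDC hz) h, Set.disjoint_left.1 (hND s hs) hzs hz]
  · rcases hDX hz with h | h
    exacts [hZZ (hXZ h), hJZ (hJ z h)]
  · rcases hDX hz with h | h
    · refine (hd' z (hXZ h) fun s hs hzs => ?_).trans (hd₂ z h)
      have := hNB s hs z hzs (hXZ h)
      exact this.2 (hDB z this.1 hz)
    · exact (hd₁' z (hJ z h)).trans (by norm_num)
  · obtain ⟨s, hs, hsD⟩ := hC.exists_mem_outerNeighbors hDc.nonempty hDC hDne
    exact ⟨s, hsD, hd₁' s (hJ s ((hDX hsD).resolve_left fun h => h.1 hs))⟩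

/-- A connected set separated from part of `A` or of `B` cannot see both sides. -/
theorem Separates.mem_or_mem {A B S : Finset α} (hsep : Separates (linkGraph G C T) A B S)
    (hAT : ↑A ⊆ T) (hBT : ↑B ⊆ T) (hDc : ConnectedOn G D) (hDC : D ⊆ C)
    (hDS : ∀ s ∈ S, s ∉ D) :
    (∀ b ∈ B, b ∈ outerNeighbors G D → b ∈ S) ∨ ∀ a ∈ A, a ∈ outerNeighbors G D → a ∈ S := by
  by_contra! h
  obtain ⟨⟨b, hb, ⟨-, p, hp, hpb⟩, hbS⟩, a, ha, ⟨-, q, hq, hqa⟩, haS⟩ := h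
  have hD : ConnectedOn (linkGraph G C T) D := hDc.of_adj_imp fun u hu v hv huv =>
    ⟨huv, Or.inl (hDC hu), Or.inl (hDC hv), Or.inl (hDC hu)⟩
  have hDb := hD.insert hp (v := b) ⟨hpb, Or.inl (hDC hp), Or.inr (hBT hb), Or.inl (hDC hp)⟩
  have hDab := hDb.insert (u := q) (v := a) (Or.inr hq)
    ⟨hqa, Or.inl (hDC hq), Or.inr (hAT ha), Or.inl (hDC hq)⟩
  obtain ⟨z, rfl | rfl | hz, hzS⟩ := hsep _ hDab ⟨a, Or.inl rfl, ha⟩ ⟨b, Or.inr (Or.inl rfl), hb⟩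
  exacts [haS hzS, hbS hzS, hDS z hzS hz]

theorem HasScaffold.exists_separator [Finite α] {k c : ℕ} (hk : 0 < k)
    (hG : ¬ HasDisjointModels (completeBipartiteGraph (Fin 2) (Fin (c + 1))) G k)
    (hC : ConnectedOn G C) (h : HasScaffold G C)
    (hX : (6 * k - 1) * (2 * (4 * k * c + 1) - 1) + (4 * k * c + 1) ≤ (outerNeighbors G C).ncard) :
    ∃ S ⊆ C, S.ncard < 3 * k * (4 * k * c + 1) ∧ ∀ D ⊆ C \ S, ConnectedOn G D →
      outerNeighbors G D ⊆ outerNeighbors G C ∪ S →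
      HasScaffold G D ∧ (outerNeighbors G D).ncard < (outerNeighbors G C).ncard := by
  classical
  obtain ⟨H, Z, hH, hCZ, hXZ, hd₃, hd₂, x, hx, hx₁⟩ := h
  obtain ⟨P, hPZ, hPc, hPd, hPP⟩ := hH.connected.exists_pieces (X := outerNeighbors G C)
    (Nat.succ_pos (4 * k * c)) hd₃ (6 * k - 1) Z (hXZ hx) (hx₁.trans (by norm_num))
    (by rwa [Set.inter_eq_right.2 hXZ])
  have hex : ∀ i, ∃ F : Finset α, ↑F ⊆ P i ∩ outerNeighbors G C ∧ F.card = 4 * k * c + 1 := by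
    intro i
    have := hPd i
    rw [Set.ncard_eq_toFinset_card _ (Set.toFinite _)] at this
    obtain ⟨F, hF, hFc⟩ := Finset.exists_subset_card_eq this
    exact ⟨F, fun z hz => by simpa using hF hz, hFc⟩
  choose F hF hFc using hex
  have hPeq : ∀ i j z, z ∈ P i → z ∈ P j → i = j := fun i j z hi hj => by
    by_contra hij
    exact Set.disjoint_left.1 (hPP hij) hi hj
  let l : Fin (3 * k) → Fin (6 * k - 1 + 1) := fun i => ⟨i, by omega⟩
  let m : Fin (3 * k) → Fin (6 * k - 1 + 1) := fun i => ⟨3 * k + i, by omega⟩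
  have hl : l.Injective := fun i j hij => Fin.ext (by simpa [l] using hij)
  have hm : m.Injective := fun i j hij => Fin.ext (by simpa [m] using hij)
  have hlm : ∀ i j, l i ≠ m j := fun i j hij => by
    have : (i : ℕ) = 3 * k + j := congrArg Fin.val hij
    omega
  have hcard : ∀ e : Fin (3 * k) → Fin (6 * k - 1 + 1), e.Injective →
      (Finset.univ.biUnion fun i => F (e i)).card = 3 * k * (4 * k * c + 1) := by
    intro e he
    rw [Finset.card_biUnion]
    · simp [hFc]
    · intro i _ j _ hij
      refine Finset.disjoint_left.2 fun z hz hz' => hij (he ?_)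
      exact hPeq _ _ z (hF _ hz).1 (hF _ hz').1
  set A := Finset.univ.biUnion fun i => F (l i) with hA
  set B := Finset.univ.biUnion fun i => F (m i) with hB
  have hAc := hcard l hl
  have hBc := hcard m hm
  rw [← hA] at hAc
  rw [← hB] at hBc
  have hmemA : ∀ z, z ∈ A ↔ ∃ i, z ∈ F (l i) := fun z => by simp [hA]
  have hmemB : ∀ z, z ∈ B ↔ ∃ i, z ∈ F (m i) := fun z => by simp [hB]
  have hAX : ↑A ⊆ outerNeighbors G C := fun z hz => by
    obtain ⟨i, hi⟩ := (hmemA z).1 hz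
    exact (hF _ hi).2
  have hBX : ↑B ⊆ outerNeighbors G C := fun z hz => by
    obtain ⟨i, hi⟩ := (hmemB z).1 hz
    exact (hF _ hi).2
  obtain ⟨S, M, hsep, hM, hself⟩ :=
    exists_separates_and_linkage (linkGraph G C (A ∪ B : Set α)) A B
  by_cases hS : 3 * k * (4 * k * c + 1) ≤ S.card
  · refine absurd (hasDisjointModels_of_isLinkage (P := P ∘ l) (Q := P ∘ m) hCZ (fun i => hPZ _)
      (fun i => hPZ _) (fun i => (hPc _).mono hH.le) (fun i => (hPc _).mono hH.le)
      (fun i j hij => hPP (hl.ne hij)) (fun i j hij => hPP (hm.ne hij))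
      (fun i j => hPP (hlm i j)) (fun z hz => ?_) (fun z hz => ?_) (fun i => ?_) (fun i => ?_) hM
      (by omega) (by omega)) hG
    · obtain ⟨i, hi⟩ := (hmemA z).1 hz
      exact ⟨i, (hF _ hi).1⟩
    · obtain ⟨i, hi⟩ := (hmemB z).1 hz
      exact ⟨i, (hF _ hi).1⟩
    · rw [← hFc (l i), ← Set.ncard_coe_finset]
      exact Set.ncard_le_ncard (fun z hz => ⟨(hmemA z).2 ⟨i, hz⟩, (hF _ hz).1⟩) (Set.toFinite _)
    · rw [← hFc (m i), ← Set.ncard_coe_finset]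
      refine Set.ncard_le_ncard (fun z hz => ?_) (Set.toFinite _)
      obtain ⟨j, hj⟩ := (hmemB z).1 hz.1
      have := hm (hPeq _ _ z (hF _ hj).1 hz.2)
      exact this ▸ hj
  · refine ⟨S ∩ C, Set.inter_subset_right, ?_, fun D hD hDc hDX => ?_⟩
    · have := Set.ncard_le_ncard (Set.inter_subset_left (s := (S : Set α)) (t := C))
        (Set.toFinite _)
      rw [Set.ncard_coe_finset] at this
      omega
    have hDC : D ⊆ C := fun z hz => (hD hz).1
    have hDS : ∀ s ∈ S, s ∉ D := fun s hs hsD => (hD hsD).2 ⟨hs, (hD hsD).1⟩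
    rcases hsep.mem_or_mem Set.subset_union_left Set.subset_union_right hDc hDC hDS with h | h
    · exact hasScaffold_of_isLinkage hC hH hCZ hXZ hd₃ hd₂ hBX subset_rfl hsep hM hself
        (by omega) hDc hDC hDS hDX h
    · exact hasScaffold_of_isLinkage hC hH hCZ hXZ hd₃ hd₂ hAX (Set.union_comm _ _).subset hsep.symm
        hM.symm hself (by omega) hDc hDC hDS hDX h

theorem HasScaffold.hasRootedDecomp [Finite α] {k c : ℕ} (hk : 0 < k)
    (hG : ¬ HasDisjointModels (completeBipartiteGraph (Fin 2) (Fin (c + 1))) G k) {h b : ℕ}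
    (hh : h = (6 * k - 1) * (2 * (4 * k * c + 1) - 1) + (4 * k * c + 1))
    (hb : b + 1 = h + 3 * k * (4 * k * c + 1)) (hhb : h ≤ b) : ∀ C : Set α, ConnectedOn G C →
    HasScaffold G C → (outerNeighbors G C).ncard ≤ h →
    HasRootedDecomp G b (C ∪ outerNeighbors G C) (outerNeighbors G C) := by
  intro C
  induction hn : C.ncard using Nat.strong_induction_on generalizing C with
  | _ n ih =>
  subst hn
  intro hC hscaf hX
  obtain ⟨S, hSC, hSb, hS⟩ : ∃ S ⊆ C, (outerNeighbors G C ∪ S).ncard ≤ b ∧ ∀ D ⊆ C \ S,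
      ConnectedOn G D → outerNeighbors G D ⊆ outerNeighbors G C ∪ S →
      D ≠ C ∧ HasScaffold G D ∧ (outerNeighbors G D).ncard ≤ h := by
    by_cases hlt : (outerNeighbors G C).ncard < h
    · obtain ⟨v, hv, hD⟩ := hscaf.exists_vertex hC
      have hcard : (outerNeighbors G C ∪ {v}).ncard ≤ h := by
        have := Set.ncard_union_le (outerNeighbors G C) {v}
        rw [Set.ncard_singleton] at this
        omega
      refine ⟨{v}, by simpa using hv, hcard.trans hhb, fun D hDC hDc hDX => ⟨?_, hD D hDC hDc hDX, ?_⟩⟩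
      · rintro rfl
        exact (hDC hv).2 rfl
      · exact (Set.ncard_le_ncard hDX (Set.toFinite _)).trans hcard
    · obtain ⟨S, hSC, hSc, hD⟩ := hscaf.exists_separator hk hG hC (by omega)
      refine ⟨S, hSC, ?_, fun D hDC hDc hDX => ?_⟩
      · have := Set.ncard_union_le (outerNeighbors G C) S
        omega
      · obtain ⟨h₁, h₂⟩ := hD D hDC hDc hDX
        exact ⟨fun h => h₂.ne (h ▸ rfl), h₁, by omega⟩
  have hdec := hasRootedDecomp_union_of_components (G := G) (b := b)
    (W := outerNeighbors G C ∪ S) hSb (C \ S) ?_ ?_ ?_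
  · have heq : C \ S ∪ (outerNeighbors G C ∪ S) = C ∪ outerNeighbors G C := by
      rw [Set.union_comm (outerNeighbors G C), ← Set.union_assoc, Set.sdiff_union_of_subset hSC]
    rw [heq] at hdec
    exact hdec.mono_root Set.subset_union_left
  · refine Set.disjoint_left.2 fun z hz => ?_
    rintro (h | h)
    exacts [h.1 hz.1, hz.2 h]
  · rintro u ⟨hu, v, hv, hvu⟩
    by_cases huC : u ∈ C
    · exact Or.inr (by_contra fun h => hu ⟨huC, h⟩)
    · exact Or.inl ⟨huC, v, hv.1, hvu⟩
  · intro D hD hDc hDX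
    obtain ⟨hne, h₁, h₂⟩ := hS D hD hDc hDX
    have hDC : D ⊆ C := hD.trans Set.sdiff_subset
    exact ih _ (Set.ncard_lt_ncard (hDC.ssubset_of_ne hne) (Set.toFinite _)) D rfl hDc h₁ h₂

theorem hasScaffold_of_outerNeighbors_eq_singleton (hD : outerNeighbors G D = {v}) :
    HasScaffold G D := by
  have hdeg : ∀ w : α, ((⊥ : SimpleGraph α).neighborSet w).ncard ≤ 0 := fun w => by simp
  have hvD : v ∉ D := (hD.symm.subset rfl).1
  exact ⟨⊥, {v}, ⟨bot_le, fun u w h => h.elim, connectedOn_singleton v⟩,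
    Set.disjoint_singleton_right.2 hvD, hD.subset, fun w => (hdeg w).trans (by norm_num),
    fun w _ => (hdeg w).trans (by norm_num), v, hD.symm.subset rfl, (hdeg v).trans (by norm_num)⟩

theorem hasRootedDecomp_univ [Finite α] {k c : ℕ} (hk : 0 < k)
    (hG : ¬ HasDisjointModels (completeBipartiteGraph (Fin 2) (Fin (c + 1))) G k) {h b : ℕ}
    (hh : h = (6 * k - 1) * (2 * (4 * k * c + 1) - 1) + (4 * k * c + 1))
    (hb : b + 1 = h + 3 * k * (4 * k * c + 1)) (hhb : h ≤ b) :
    HasRootedDecomp G b Set.univ ∅ := by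
  have hdec := hasRootedDecomp_union_of_components (G := G) (b := b) (W := ∅) (by simp) Set.univ
    (Set.disjoint_empty _) (fun u hu => absurd trivial hu.1) fun C _ hC hCX => ?_
  · rwa [Set.union_empty] at hdec
  have hCX : outerNeighbors G C = ∅ := Set.eq_empty_of_subset_empty hCX
  obtain ⟨v, hv⟩ := hC.nonempty
  have hdec := hasRootedDecomp_union_of_components (G := G) (b := b) (W := {v})
    ((Set.ncard_singleton v).trans_le (by omega)) (C \ {v}) Set.disjoint_sdiff_left ?_ ?_
  · rw [Set.sdiff_union_of_subset (by simpa using hv)] at hdec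
    rw [hCX, Set.union_empty]
    exact hdec.mono_root (Set.empty_subset _)
  · rintro u ⟨hu, w, hw, hwu⟩
    by_contra huv
    refine (hCX.subset ⟨fun huC => hu ⟨huC, huv⟩, w, hw.1, hwu⟩ : u ∈ (∅ : Set α))
  · intro D hD hDc hDX
    have hDv : outerNeighbors G D = {v} := by
      obtain ⟨s, -, hs⟩ := hC.exists_mem_outerNeighbors hDc.nonempty
        (hD.trans Set.sdiff_subset) (fun h => (hD (h.symm.subset hv)).2 rfl)
      exact hDX.antisymm (by
        rintro z rfl
        exact (hDX hs : s = z) ▸ hs)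
    refine HasScaffold.hasRootedDecomp hk hG hh hb hhb D hDc
      (hasScaffold_of_outerNeighbors_eq_singleton hDv) ?_
    rw [hDv, Set.ncard_singleton]
    omega

end Scaffold

/-- For all positive integers `k` and `r`, if `G` does not contain
`k` pairwise disjoint models of `K_{2,r}`, then `tw(G) < 20k²r² − 8k²r + 2r − 1`. -/
theorem tw_bound_of_no_K2r_packing (k r : ℕ) (hk : 0 < k) (hr : 0 < r)
    {α : Type} [Fintype α] (G : SimpleGraph α)
    (h : ¬ HasDisjointModels (completeBipartiteGraph (Fin 2) (Fin r)) G k) :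
    treewidth G < 20 * k ^ 2 * r ^ 2 - 8 * k ^ 2 * r + 2 * r - 1 := by
  obtain ⟨c, rfl⟩ : ∃ c, r = c + 1 := ⟨r - 1, by omega⟩
  obtain ⟨j, rfl⟩ : ∃ j, k = j + 1 := ⟨k - 1, by omega⟩
  set p := (j + 1) * c with hp
  have hmul : 4 * (j + 1) * c + 1 = 4 * p + 1 := by rw [hp]; ring
  have hh : (6 * (j + 1) - 1) * (2 * (4 * (j + 1) * c + 1) - 1) + (4 * (j + 1) * c + 1) =
      (6 * j + 5) * (8 * p + 1) + (4 * p + 1) := by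
    rw [hmul, show 6 * (j + 1) - 1 = 6 * j + 5 by omega,
      show 2 * (4 * p + 1) - 1 = 8 * p + 1 by omega]
  have hdec := hasRootedDecomp_univ (b := (6 * j + 5) * (8 * p + 1) + (4 * p + 1) +
    (3 * (j + 1) * (4 * p) + 3 * j + 1) + 1) hk h hh.symm (by rw [hmul]; ring) (by omega)
  refine (treewidth_le_of_hasRootedDecomp hdec).trans_lt ?_
  have hlt : (6 * j + 5) * (8 * p + 1) + (4 * p + 1) + (3 * (j + 1) * (4 * p) + 3 * j + 1) +
      8 * (j + 1) ^ 2 * (c + 1) + 1 < 20 * (j + 1) ^ 2 * (c + 1) ^ 2 + 2 * (c + 1) := by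
    rw [hp]
    rcases c with _ | _ | c
    · nlinarith
    · nlinarith
    · have h₁ : 0 ≤ j * c := Nat.zero_le _
      have h₂ : 0 ≤ j ^ 2 * c := Nat.zero_le _
      have h₃ : 0 ≤ j * c ^ 2 := Nat.zero_le _
      have h₄ : 0 ≤ j ^ 2 * c ^ 2 := Nat.zero_le _
      ring_nf
      nlinarith
  omega
end

section
/- Let G be a graph and let p ≥ q ≥ 1 be integers. If G contains no q-mesh of order p, then the treewidth of G is less than p + q − 1. -/
open SimpleGraph

namespace SimpleGraph

variable {V : Type*}

/-- `W` meets every walk of `G` from `A` to `B`. -/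
def Separates (G : SimpleGraph V) (A B W : Set V) : Prop :=
  ∀ a ∈ A, ∀ b ∈ B, ∀ p : G.Walk a b, ∃ w ∈ W, w ∈ p.support

/-- There are `k` pairwise disjoint walks of `G` from `A` to `B`. -/
def Linked (G : SimpleGraph V) (A B : Set V) (k : ℕ) : Prop :=
  ∃ (a b : Fin k → V) (p : ∀ i, G.Walk (a i) (b i)),
    (∀ i, a i ∈ A) ∧ (∀ i, b i ∈ B) ∧
      ∀ i j, i ≠ j → ∀ v ∈ (p i).support, v ∉ (p j).support

theorem Separates.symm {G : SimpleGraph V} {A B W : Set V} (h : G.Separates A B W) :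
    G.Separates B A W := by
  intro b hb a ha p
  simpa using h a ha b hb p.reverse

theorem Linked.symm {G : SimpleGraph V} {A B : Set V} {k : ℕ} (h : G.Linked A B k) :
    G.Linked B A k := by
  obtain ⟨a, b, p, ha, hb, hd⟩ := h
  exact ⟨b, a, fun i => (p i).reverse, hb, ha, by simpa using hd⟩

theorem Linked.mono {G G' : SimpleGraph V} (hle : G ≤ G') {A B : Set V} {k : ℕ}
    (h : G.Linked A B k) : G'.Linked A B k := by
  obtain ⟨a, b, p, ha, hb, hd⟩ := h
  exact ⟨a, b, fun i => (p i).mapLe hle, ha, hb, by simpa using hd⟩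

theorem Linked.of_finset {G : SimpleGraph V} {A B : Set V} (M : Finset V) (a b : V → V)
    (p : ∀ t, G.Walk (a t) (b t)) (ha : ∀ t ∈ M, a t ∈ A) (hb : ∀ t ∈ M, b t ∈ B)
    (hd : ∀ t ∈ M, ∀ u ∈ M, t ≠ u → ∀ v ∈ (p t).support, v ∉ (p u).support) :
    G.Linked A B M.card := by
  refine ⟨fun i => a (M.equivFin.symm i), fun i => b (M.equivFin.symm i),
    fun i => p (M.equivFin.symm i), fun i => ha _ (Subtype.coe_prop _),
    fun i => hb _ (Subtype.coe_prop _), fun i j hij => ?_⟩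
  refine hd _ (Subtype.coe_prop _) _ (Subtype.coe_prop _) fun h => hij ?_
  exact M.equivFin.symm.injective (Subtype.ext h)

/-- A walk meeting `M` has an initial part meeting `M` exactly in its last vertex. -/
theorem Walk.exists_prefix_to {G : SimpleGraph V} (M : Set V) {u v : V} (p : G.Walk u v)
    (h : ∃ w ∈ M, w ∈ p.support) :
    ∃ m ∈ M, ∃ q : G.Walk u m, (∀ w ∈ q.support, w ∈ p.support) ∧
      ∀ w ∈ q.support, w ∈ M → w = m := by
  induction p with
  | nil =>
    obtain ⟨w, hw, hw'⟩ := h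
    simp only [support_nil, List.mem_singleton] at hw'
    subst hw'
    exact ⟨w, hw, .nil, by simp, by simp⟩
  | @cons u x v e p ih =>
    by_cases hu : u ∈ M
    · exact ⟨u, hu, .nil, by simp, by simp⟩
    · have h' : ∃ w ∈ M, w ∈ p.support := by
        obtain ⟨w, hw, hw'⟩ := h
        rw [support_cons, List.mem_cons] at hw'
        rcases hw' with rfl | hw'
        · exact absurd hw hu
        · exact ⟨w, hw, hw'⟩
      obtain ⟨m, hm, q, hq, hqm⟩ := ih h'
      refine ⟨m, hm, .cons e q, ?_, ?_⟩
      · intro w hw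
        rw [support_cons, List.mem_cons] at hw ⊢
        exact hw.imp_right (hq w)
      · intro w hw hwM
        rw [support_cons, List.mem_cons] at hw
        rcases hw with rfl | hw
        · exact absurd hwM hu
        · exact hqm w hw hwM

theorem Walk.exists_deleteEdges {G : SimpleGraph V} {x y u v : V} (p : G.Walk u v)
    (h : ¬ (x ∈ p.support ∧ y ∈ p.support)) :
    ∃ q : (G.deleteEdges {s(x, y)}).Walk u v, q.support = p.support := by
  refine ⟨p.toDeleteEdges _ ?_, by simp [Walk.toDeleteEdges]⟩
  rintro e he rfl
  exact h ⟨p.fst_mem_support_of_mem_edges he, p.snd_mem_support_of_mem_edges he⟩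

theorem Separates.of_deleteEdges {G : SimpleGraph V} {A B S W : Set V} {x y : V} (hxy : x ≠ y)
    (hS : (G.deleteEdges {s(x, y)}).Separates A B S)
    (hy : (G.deleteEdges {s(x, y)}).Separates A {y} S)
    (hW : (G.deleteEdges {s(x, y)}).Separates A (insert x S) W) : G.Separates A B W := by
  intro a ha b hb p
  by_cases hit : ∃ w ∈ insert x (insert y S), w ∈ p.support
  · obtain ⟨m, hm, q, hqp, hqm⟩ := p.exists_prefix_to _ hit
    obtain ⟨q', hq'⟩ := q.exists_deleteEdges (x := x) (y := y) fun h =>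
      hxy ((hqm x h.1 (by simp)).trans (hqm y h.2 (by simp)).symm)
    have hm' : m ∈ insert x S := by
      rcases hm with rfl | rfl | hm
      · simp
      · obtain ⟨w, hw, hw'⟩ := hy a ha m rfl q'
        have := hqm w (hq' ▸ hw') (by simp [hw])
        exact Or.inr (this ▸ hw)
      · exact Or.inr hm
    obtain ⟨w, hw, hw'⟩ := hW a ha m hm' q'
    exact ⟨w, hw, hqp w (hq' ▸ hw')⟩
  · obtain ⟨q', hq'⟩ := p.exists_deleteEdges (x := x) (y := y) fun h => hit ⟨x, by simp, h.1⟩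
    obtain ⟨w, hw, hw'⟩ := hS a ha b hb q'
    exact absurd ⟨w, by simp [hw], hq' ▸ hw'⟩ hit

/-- Walks linking `A` to a set of the right size can be indexed by their last vertices. -/
theorem Linked.exists_paths_to {G : SimpleGraph V} {A : Set V} {M : Finset V}
    (h : G.Linked A M M.card) :
    ∃ (a : V → V) (p : ∀ t, G.Walk (a t) t), (∀ t ∈ M, a t ∈ A) ∧ (∀ t, (p t).IsPath) ∧
      ∀ t ∈ M, ∀ u ∈ M, t ≠ u → ∀ v ∈ (p t).support, v ∉ (p u).support := by
  classical
  obtain ⟨a, b, p, ha, hb, hd⟩ := h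
  have hinj : Function.Injective fun i => (⟨b i, hb i⟩ : M) := by
    intro i j hij
    by_contra hne
    have hij : b i = b j := congrArg Subtype.val hij
    exact hd i j hne (b i) (p i).end_mem_support (by rw [hij]; exact (p j).end_mem_support)
  have hsurj : ∀ t ∈ M, ∃ i, b i = t := by
    intro t ht
    have hbij := (Fintype.bijective_iff_injective_and_card _).2 ⟨hinj, by simp⟩
    obtain ⟨i, hi⟩ := hbij.2 ⟨t, ht⟩
    exact ⟨i, congrArg Subtype.val hi⟩
  have key : ∀ t, ∃ (c : V) (q : G.Walk c t), q.IsPath ∧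
      (t ∈ M → c ∈ A ∧ ∃ i, b i = t ∧ ∀ v ∈ q.support, v ∈ (p i).support) := by
    intro t
    by_cases ht : t ∈ M
    · obtain ⟨i, rfl⟩ := hsurj t ht
      exact ⟨a i, (p i).bypass, (p i).bypass_isPath, fun _ => ⟨ha i, i, rfl,
        fun v hv => (p i).support_bypass_subset_support hv⟩⟩
    · exact ⟨t, .nil, .nil, fun h => absurd h ht⟩
  choose c q hq hqM using key
  refine ⟨c, q, fun t ht => (hqM t ht).1, hq, fun t ht u hu htu v hvt hvu => ?_⟩
  obtain ⟨-, i, hi, hip⟩ := hqM t ht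
  obtain ⟨-, j, hj, hjp⟩ := hqM u hu
  exact hd i j (fun hij => htu (by rw [← hi, ← hj, hij])) v (hip v hvt) (hjp v hvu)

theorem Linked.glue {G G' : SimpleGraph V} (hle : G' ≤ G) {A B : Set V} {S : Finset V}
    [DecidableEq V] {x y : V} (hxy : G.Adj x y) (hx : x ∉ S) (hy : y ∉ S)
    (hS : G'.Separates A B S)
    (h₁ : G'.Linked A (insert x S : Finset V) (S.card + 1))
    (h₂ : G'.Linked (insert y S : Finset V) B (S.card + 1)) : G.Linked A B (S.card + 1) := by
  rw [← Finset.card_insert_of_notMem hx] at h₁ ⊢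
  replace h₂ := h₂.symm
  rw [← Finset.card_insert_of_notMem hy] at h₂
  obtain ⟨a, p, ha, hp, hpd⟩ := h₁.exists_paths_to
  obtain ⟨b, q, hb, hq, hqd⟩ := h₂.exists_paths_to
  have meet : ∀ t ∈ insert x S, ∀ r ∈ insert y S, ∀ v ∈ (p t).support, v ∈ (q r).support →
      v = t ∧ v = r ∧ v ∈ S := by
    intro t ht r hr v hvt hvr
    obtain ⟨w, hwS, hw⟩ := hS _ (ha t ht) _ (hb r hr)
      (((p t).takeUntil v hvt).append ((q r).takeUntil v hvr).reverse)
    have hwx : w ∈ insert x S := Finset.mem_insert_of_mem hwS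
    have hwy : w ∈ insert y S := Finset.mem_insert_of_mem hwS
    rw [Walk.mem_support_append_iff, Walk.support_reverse, List.mem_reverse] at hw
    have ht' : v ∈ S → v = t := fun hv => by
      by_contra hne
      exact hpd t ht v (Finset.mem_insert_of_mem hv) (Ne.symm hne) v hvt (p v).end_mem_support
    have hr' : v ∈ S → v = r := fun hv => by
      by_contra hne
      exact hqd r hr v (Finset.mem_insert_of_mem hv) (Ne.symm hne) v hvr (q v).end_mem_support
    have hvS : v ∈ S := by
      rcases hw with hw | hw
      · have hwt : t = w := by
          by_contra hne
          exact hpd t ht w hwx hne w ((p t).support_takeUntil_subset_support hvt hw)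
            (p w).end_mem_support
        subst hwt
        by_contra hne
        exact Walk.endpoint_notMem_support_takeUntil (hp t) hvt
          (fun h => hne (h ▸ hwS)) hw
      · have hwt : r = w := by
          by_contra hne
          exact hqd r hr w hwy hne w ((q r).support_takeUntil_subset_support hvr hw)
            (q w).end_mem_support
        subst hwt
        by_contra hne
        exact Walk.endpoint_notMem_support_takeUntil (hq r) hvr
          (fun h => hne (h ▸ hwS)) hw
    exact ⟨ht' hvS, hr' hvS, hvS⟩
  have link : ∀ t, ∃ (r : V) (l : G.Walk t r), (∀ v ∈ l.support, v = t ∨ v = r) ∧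
      (t = x → r = y) ∧ (t ≠ x → r = t) := by
    intro t
    by_cases ht : t = x
    · subst ht
      exact ⟨y, hxy.toWalk, by simp, by simp, by simp⟩
    · exact ⟨t, .nil, by simp, by simp [ht], by simp⟩
  choose r l hl hrx hrt using link
  have hr : ∀ t ∈ insert x S, r t ∈ insert y S := by
    intro t ht
    by_cases h : t = x
    · simp [hrx t h]
    · rw [hrt t h]
      exact Finset.mem_insert_of_mem (Finset.mem_of_mem_insert_of_ne ht h)
  have hrS : ∀ t ∈ insert x S, r t ∈ S → r t = t := fun t ht hrt' => by
    by_cases h : t = x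
    · exact absurd (hrx t h ▸ hrt') hy
    · exact hrt t h
  have hrinj : ∀ t ∈ insert x S, ∀ u ∈ insert x S, t ≠ u → r t ≠ r u := by
    intro t ht u hu htu h
    by_cases htx : t = x
    · have hux : u ≠ x := fun h => htu (htx.trans h.symm)
      rw [hrx t htx, hrt u hux] at h
      exact hy (h ▸ Finset.mem_of_mem_insert_of_ne hu hux)
    · have h1 := hrt t htx
      have : r u ∈ S := by
        rw [← h, h1]; exact Finset.mem_of_mem_insert_of_ne ht htx
      exact htu (by rw [← h1, h, hrS u hu this])
  have hsupp : ∀ t v, v ∈ ((((p t).mapLe hle).append (l t)).append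
      ((q (r t)).mapLe hle).reverse).support → v ∈ (p t).support ∨ v ∈ (q (r t)).support := by
    intro t v hv
    simp only [Walk.mem_support_append_iff, Walk.support_reverse, List.mem_reverse,
      Walk.support_mapLe_eq_support] at hv
    rcases hv with (hv | hv) | hv
    · exact Or.inl hv
    · rcases hl t v hv with rfl | rfl
      · exact Or.inl (p _).end_mem_support
      · exact Or.inr (q _).end_mem_support
    · exact Or.inr hv
  refine Linked.of_finset _ a (fun t => b (r t)) (fun t => (((p t).mapLe hle).append (l t)).append
      ((q (r t)).mapLe hle).reverse) ha (fun t ht => hb _ (hr t ht)) ?_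
  intro t ht u hu htu v hvt hvu
  rcases hsupp t v hvt with h1 | h1 <;> rcases hsupp u v hvu with h2 | h2
  · exact hpd t ht u hu htu v h1 h2
  · obtain ⟨e1, e2, e3⟩ := meet t ht _ (hr u hu) v h1 h2
    exact htu (by rw [← e1, e2, hrS u hu (e2 ▸ e3)])
  · obtain ⟨e1, e2, e3⟩ := meet u hu _ (hr t ht) v h2 h1
    exact htu (by rw [← e1, e2, hrS t ht (e2 ▸ e3)])
  · exact hqd _ (hr t ht) _ (hr u hu) (hrinj t ht u hu htu) v h1 h2

/-- **Menger's theorem** (vertex version, for sets): if no fewer than `k` vertices separate `A`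
from `B`, then there are `k` disjoint walks from `A` to `B`. -/
theorem linked_of_forall_separates [Finite V] (k : ℕ) (G : SimpleGraph V) (A B : Set V)
    (h : ∀ W : Finset V, G.Separates A B W → k ≤ W.card) : G.Linked A B k := by
  classical
  induction G using WellFoundedLT.induction generalizing A B with
  | ind G ih =>
  by_cases hG : G = ⊥
  · subst hG
    have hsep : (⊥ : SimpleGraph V).Separates A B (Set.toFinite (A ∩ B)).toFinset := by
      intro a ha b hb p
      cases p with
      | nil => exact ⟨a, by simp [ha, hb], by simp⟩
      | cons e _ => exact absurd e (by simp)
    obtain ⟨M, hM, rfl⟩ := Finset.exists_subset_card_eq (h _ hsep)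
    have hM' : ∀ t ∈ M, t ∈ A ∧ t ∈ B := fun t ht => by simpa using hM ht
    exact Linked.of_finset M id id (fun t => .nil) (fun t ht => (hM' t ht).1)
      (fun t ht => (hM' t ht).2) (by simp)
  obtain ⟨x, y, hxy⟩ := SimpleGraph.ne_bot_iff_exists_adj.1 hG
  have key : ∀ x y, G.Adj x y → ∀ S : Finset V, S.card < k →
      (G.deleteEdges {s(x, y)}).Separates A B S →
      ¬ (G.deleteEdges {s(x, y)}).Separates A {x} S →
      ¬ (G.deleteEdges {s(x, y)}).Separates {y} B S → G.Linked A B k := by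
    intro x y hxy S hSk hS hax hyb
    have hle : G.deleteEdges {s(x, y)} ≤ G := G.deleteEdges_le _
    have hlt : G.deleteEdges {s(x, y)} < G := lt_of_le_of_ne hle fun h => by
      have := h ▸ hxy
      simp [deleteEdges_adj] at this
    simp only [Separates, not_forall, not_exists, not_and] at hax hyb
    obtain ⟨a, ha, x', hx', p, hp⟩ := hax
    obtain rfl : x' = x := hx'
    obtain ⟨y', hy', b, hb, q, hq⟩ := hyb
    obtain rfl : y' = y := hy'
    have hAy : (G.deleteEdges {s(x', y')}).Separates A {y'} S := by
      intro a' ha' z hz r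
      obtain rfl : z = y' := hz
      obtain ⟨w, hw, hw'⟩ := hS a' ha' b hb (r.append q)
      rcases Walk.mem_support_append_iff _ _ |>.1 hw' with hw' | hw'
      · exact ⟨w, hw, hw'⟩
      · exact absurd hw' (hq w hw)
    have hxB : (G.deleteEdges {s(x', y')}).Separates {x'} B S := by
      intro z hz b' hb' r
      obtain rfl : z = x' := hz
      obtain ⟨w, hw, hw'⟩ := hS a ha b' hb' (p.append r)
      rcases Walk.mem_support_append_iff _ _ |>.1 hw' with hw' | hw'
      · exact absurd hw' (hp w hw)
      · exact ⟨w, hw, hw'⟩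
    have hxS : x' ∉ S := fun hx => hp x' hx p.end_mem_support
    have hyS : y' ∉ S := fun hy => hq y' hy q.start_mem_support
    have h1 : ∀ W : Finset V, (G.deleteEdges {s(x', y')}).Separates A
        (insert x' S : Finset V) W → k ≤ W.card := fun W hW =>
      h W (Separates.of_deleteEdges hxy.ne hS hAy (by simpa using hW))
    have h2 : ∀ W : Finset V, (G.deleteEdges {s(x', y')}).Separates
        (insert y' S : Finset V) B W → k ≤ W.card := fun W hW => by
      refine h W (Separates.symm ?_)
      rw [Sym2.eq_swap] at *
      exact Separates.of_deleteEdges hxy.ne' hS.symm hxB.symm (by simpa using hW.symm)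
    have hk : k = S.card + 1 := by
      have := h1 (insert x' S) fun _ _ b hb p => ⟨b, hb, p.end_mem_support⟩
      rw [Finset.card_insert_of_notMem hxS] at this
      omega
    have l1 := ih _ hlt _ _ h1
    have l2 := ih _ hlt _ _ h2
    subst hk
    exact Linked.glue hle hxy hxS hyS hS l1 l2
  by_cases hall : ∀ W : Finset V, (G.deleteEdges {s(x, y)}).Separates A B W → k ≤ W.card
  · have hlt : G.deleteEdges {s(x, y)} < G := lt_of_le_of_ne (G.deleteEdges_le _) fun h => by
      have := h ▸ hxy
      simp [deleteEdges_adj] at this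
    exact (ih _ hlt _ _ hall).mono hlt.le
  push Not at hall
  obtain ⟨S, hS, hSk⟩ := hall
  have hnS : ¬ G.Separates A B S := fun hs => absurd (h S hs) (by omega)
  simp only [Separates, not_forall, not_exists, not_and] at hnS
  obtain ⟨a, ha, b, hb, p, hp⟩ := hnS
  have hit : x ∈ p.support ∧ y ∈ p.support := by
    by_contra hne
    obtain ⟨q, hq⟩ := p.exists_deleteEdges hne
    obtain ⟨w, hw, hw'⟩ := hS a ha b hb q
    exact hp w hw (hq ▸ hw')
  have reach : ∀ {u v : V} (p : G.Walk u v), (∀ w ∈ S, w ∉ p.support) → x ∈ p.support →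
      ∃ m, (m = x ∨ m = y) ∧ ∃ q : (G.deleteEdges {s(x, y)}).Walk u m,
        ∀ w ∈ S, w ∉ q.support := by
    intro u v p hp hx
    obtain ⟨m, hm, q, hqp, hqm⟩ := p.exists_prefix_to {x, y} ⟨x, by simp, hx⟩
    obtain ⟨q', hq'⟩ := q.exists_deleteEdges (x := x) (y := y) fun h =>
      hxy.ne ((hqm x h.1 (by simp)).trans (hqm y h.2 (by simp)).symm)
    exact ⟨m, hm, q', fun w hw hwq => hp w hw (hqp w (hq' ▸ hwq))⟩
  obtain ⟨m, hm, q, hq⟩ := reach p hp hit.1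
  obtain ⟨n, hn, r, hr⟩ := reach p.reverse (by simpa using hp) (by simpa using hit.1)
  have hmn : m ≠ n := by
    rintro rfl
    obtain ⟨w, hw, hw'⟩ := hS a ha b hb (q.append r.reverse)
    rcases Walk.mem_support_append_iff _ _ |>.1 hw' with hw' | hw'
    · exact hq w hw hw'
    · exact hr w hw (by simpa using hw')
  have hAm : ¬ (G.deleteEdges {s(x, y)}).Separates A {m} S := fun hs => by
    obtain ⟨w, hw, hw'⟩ := hs a ha m rfl q
    exact hq w hw hw'
  have hnB : ¬ (G.deleteEdges {s(x, y)}).Separates {n} B S := fun hs => by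
    obtain ⟨w, hw, hw'⟩ := hs n rfl b hb r.reverse
    exact hr w hw (by simpa using hw')
  rcases hm with rfl | rfl
  · obtain rfl := hn.resolve_left (Ne.symm hmn)
    exact key _ _ hxy S hSk hS hAm hnB
  · obtain rfl := hn.resolve_right (Ne.symm hmn)
    rw [Sym2.eq_swap] at hS hAm hnB
    exact key _ _ hxy.symm S hSk hS hAm hnB

/-- **Menger's theorem**, with a separator consisting of one vertex from each walk. -/
theorem exists_separates_linked [Finite V] (G : SimpleGraph V) (A B : Set V) :
    ∃ (S : Finset V) (a b : V → V) (p : ∀ s, G.Walk (a s) (b s)), G.Separates A B S ∧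
      (∀ s ∈ S, a s ∈ A ∧ b s ∈ B ∧ s ∈ (p s).support) ∧
      ∀ s ∈ S, ∀ t ∈ S, s ≠ t → ∀ v ∈ (p s).support, v ∉ (p t).support := by
  classical
  have hex : ∃ k, ∃ S : Finset V, G.Separates A B S ∧ S.card = k := by
    cases nonempty_fintype V
    exact ⟨_, Finset.univ, fun a _ _ _ p => ⟨a, by simp, p.start_mem_support⟩, rfl⟩
  obtain ⟨S, hS, hSk⟩ := Nat.find_spec hex
  obtain ⟨a, b, p, ha, hb, hd⟩ := G.linked_of_forall_separates (Nat.find hex) A B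
    fun W hW => Nat.find_min' hex ⟨W, hW, rfl⟩
  choose f hfS hf using fun i => hS _ (ha i) _ (hb i) (p i)
  have hinj : Function.Injective fun i => (⟨f i, hfS i⟩ : S) := by
    intro i j hij
    by_contra hne
    have hij : f i = f j := congrArg Subtype.val hij
    exact hd i j hne (f i) (hf i) (hij ▸ hf j)
  have hsurj : ∀ t ∈ S, ∃ i, f i = t := by
    intro t ht
    have hbij := (Fintype.bijective_iff_injective_and_card _).2 ⟨hinj, by simp [hSk]⟩
    obtain ⟨i, hi⟩ := hbij.2 ⟨t, ht⟩
    exact ⟨i, congrArg Subtype.val hi⟩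
  have key : ∀ t, ∃ (c d : V) (q : G.Walk c d),
      (t ∈ S → ∃ i, f i = t ∧ c ∈ A ∧ d ∈ B ∧ q.support = (p i).support) := by
    intro t
    by_cases ht : t ∈ S
    · obtain ⟨i, rfl⟩ := hsurj t ht
      exact ⟨a i, b i, p i, fun _ => ⟨i, rfl, ha i, hb i, rfl⟩⟩
    · exact ⟨t, t, .nil, fun h => absurd h ht⟩
  choose c d q hq using key
  refine ⟨S, c, d, q, hS, fun s hs => ?_, fun s hs t ht hst v hvs hvt => ?_⟩
  · obtain ⟨i, hi, hc, hd, he⟩ := hq s hs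
    exact ⟨hc, hd, he ▸ hi ▸ hf i⟩
  · obtain ⟨i, hi, -, -, hei⟩ := hq s hs
    obtain ⟨j, hj, -, -, hej⟩ := hq t ht
    exact hd i j (fun hij => hst (by rw [← hi, ← hj, hij])) v (hei ▸ hvs) (hej ▸ hvt)

theorem connected_induce_iff_exists_walk {V : Type*} {G : SimpleGraph V} {s : Set V} :
    (G.induce s).Connected ↔
      s.Nonempty ∧ ∀ u ∈ s, ∀ v ∈ s, ∃ p : G.Walk u v, ∀ w ∈ p.support, w ∈ s := by
  constructor
  · intro h
    refine ⟨Set.nonempty_coe_sort.1 h.nonempty, fun u hu v hv => ?_⟩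
    obtain ⟨p⟩ := h.preconnected ⟨u, hu⟩ ⟨v, hv⟩
    have key : ∃ q : G.Walk u v, q.support = p.support.map Subtype.val :=
      ⟨p.map (Embedding.induce s).toHom, Walk.support_map _ _⟩
    obtain ⟨q, hq⟩ := key
    refine ⟨q, fun w hw => ?_⟩
    rw [hq, List.mem_map] at hw
    obtain ⟨x, -, rfl⟩ := hw
    exact x.2
  · rintro ⟨hne, h⟩
    have := hne.to_subtype
    refine ⟨fun u v => ?_⟩
    obtain ⟨p, hp⟩ := h u u.2 v v.2
    exact ⟨p.induce s hp⟩

/-- The graph obtained from `T` by adding a new vertex `none` adjacent only to `t`. -/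
def addLeaf {ι : Type*} (T : SimpleGraph ι) (t : ι) : SimpleGraph (Option ι) :=
  T.map Function.Embedding.some ⊔ edge none (some t)

theorem addLeaf_adj_none {ι : Type*} (T : SimpleGraph ι) (t : ι) :
    (T.addLeaf t).Adj (some t) none := by
  simp [addLeaf, edge_adj]

theorem exists_walk_addLeaf {ι : Type*} {T : SimpleGraph ι} (t : ι) {u v : ι} (p : T.Walk u v) :
    ∃ q : (T.addLeaf t).Walk (some u) (some v), q.support = p.support.map some := by
  let f : T →g T.addLeaf t :=
    ⟨some, fun {a b} h => Or.inl ((map_adj _ _ _ _).2 ⟨a, b, h, rfl, rfl⟩)⟩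
  exact ⟨p.map f, Walk.support_map f p⟩

theorem IsTree.addLeaf {ι : Type*} [Finite ι] {T : SimpleGraph ι} (hT : T.IsTree) (t : ι) :
    (T.addLeaf t).IsTree := by
  classical
  rw [isTree_iff_connected_and_card] at hT ⊢
  refine ⟨?_, ?_⟩
  · rw [connected_iff_exists_forall_reachable]
    refine ⟨some t, fun v => ?_⟩
    cases v with
    | none => exact (T.addLeaf_adj_none t).reachable
    | some v =>
      obtain ⟨p⟩ := hT.1.preconnected t v
      obtain ⟨q, -⟩ := exists_walk_addLeaf t p
      exact ⟨q⟩
  · have hE : (T.addLeaf t).edgeSet =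
        insert s(none, some t) (Sym2.map some '' T.edgeSet) := by
      rw [SimpleGraph.addLeaf, edgeSet_sup, edgeSet_map, edgeSet_edge_of_ne (by simp),
        Set.union_comm]
      rfl
    have hn : s(none, some t) ∉ Sym2.map some '' T.edgeSet := by
      rintro ⟨e, -, he⟩
      have : (none : Option ι) ∈ Sym2.map some e := he ▸ Sym2.mem_mk_left _ _
      simp [Sym2.mem_map] at this
    rw [Nat.card_coe_set_eq, hE, Set.ncard_insert_of_notMem hn (Set.toFinite _),
      Set.ncard_image_of_injective _ (Sym2.map.injective (Option.some_injective _)),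
      ← Nat.card_coe_set_eq, hT.2, Finite.card_option]

/-- `T` with bags `X` is a tree decomposition of `G[U]` with bags of size at most `n`. -/
structure IsTreeDecompOn {V ι : Type*} (G : SimpleGraph V) (U : Set V) (n : ℕ)
    (T : SimpleGraph ι) (X : ι → Set V) : Prop where
  isTree : T.IsTree
  subset : ∀ t, X t ⊆ U
  adj : ∀ u ∈ U, ∀ v ∈ U, G.Adj u v → ∃ t, u ∈ X t ∧ v ∈ X t
  connected : ∀ v ∈ U, (T.induce {t | v ∈ X t}).Connected
  card : ∀ t, (X t).ncard ≤ n

theorem IsTreeDecompOn.extend {V ι : Type*} [Finite ι] {G : SimpleGraph V} {U : Set V} {n : ℕ}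
    {T : SimpleGraph ι} {X : ι → Set V} (h : IsTreeDecompOn G U n T X) {t : ι} {N S : Set V}
    (hN : N ⊆ X t) (hS : Disjoint S U) (hadj : ∀ s ∈ S, ∀ u ∈ U, G.Adj s u → u ∈ N)
    (hcard : (N ∪ S).ncard ≤ n) :
    IsTreeDecompOn G (U ∪ S) n (T.addLeaf t) (fun o => o.elim (N ∪ S) X) where
  isTree := h.isTree.addLeaf t
  subset o := by
    cases o with
    | none => exact Set.union_subset_union_left S (hN.trans (h.subset t))
    | some o => exact (h.subset o).trans Set.subset_union_left
  adj u hu v hv huv := by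
    rcases hu with hu | hu <;> rcases hv with hv | hv
    · obtain ⟨o, ho⟩ := h.adj u hu v hv huv
      exact ⟨some o, ho⟩
    · exact ⟨none, Or.inl (hadj v hv u hu huv.symm), Or.inr hv⟩
    · exact ⟨none, Or.inr hu, Or.inl (hadj u hu v hv huv)⟩
    · exact ⟨none, Or.inr hu, Or.inr hv⟩
  card o := by
    cases o with
    | none => exact hcard
    | some o => exact h.card o
  connected v hv := by
    rw [connected_induce_iff_exists_walk]
    rcases hv with hv | hv
    · obtain ⟨⟨t₀, ht₀⟩, hw⟩ := connected_induce_iff_exists_walk.1 (h.connected v hv)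
      have hss : ∀ a, v ∈ X a → ∀ b, v ∈ X b → ∃ p : (T.addLeaf t).Walk (some a) (some b),
          ∀ w ∈ p.support, w ∈ {o : Option ι | v ∈ o.elim (N ∪ S) X} := by
        intro a ha b hb
        obtain ⟨p, hp⟩ := hw a ha b hb
        obtain ⟨q, hq⟩ := exists_walk_addLeaf t p
        refine ⟨q, fun w hw => ?_⟩
        rw [hq, List.mem_map] at hw
        obtain ⟨x, hx, rfl⟩ := hw
        exact hp x hx
      refine ⟨⟨some t₀, ht₀⟩, fun a ha b hb => ?_⟩
      have hN' : v ∈ N ∪ S → v ∈ X t := fun h' =>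
        hN (h'.resolve_right fun h' => hS.le_bot ⟨h', hv⟩)
      have hns : ∀ b, v ∈ N ∪ S → v ∈ X b → ∃ p : (T.addLeaf t).Walk none (some b),
          ∀ w ∈ p.support, w ∈ {o : Option ι | v ∈ o.elim (N ∪ S) X} := by
        intro b hn hb
        obtain ⟨p, hp⟩ := hss t (hN' hn) b hb
        refine ⟨.cons (T.addLeaf_adj_none t).symm p, fun w hw => ?_⟩
        rw [Walk.support_cons, List.mem_cons] at hw
        rcases hw with rfl | hw
        · exact hn
        · exact hp w hw
      cases a with
      | none =>
        cases b with
        | none => exact ⟨.nil, by simpa using ha⟩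
        | some b => exact hns b ha hb
      | some a =>
        cases b with
        | none =>
          obtain ⟨p, hp⟩ := hns a hb ha
          exact ⟨p.reverse, by simpa using hp⟩
        | some b => exact hss a ha b hb
    · refine ⟨⟨none, Or.inr hv⟩, fun a ha b hb => ?_⟩
      have hno : ∀ o : ι, v ∉ X o := fun o ho => hS.le_bot ⟨hv, h.subset o ho⟩
      cases a with
      | some a => exact absurd ha (hno a)
      | none =>
        cases b with
        | some b => exact absurd hb (hno b)
        | none => exact ⟨.nil, by simpa using ha⟩

theorem Walk.IsPath.ncard_neighborSet_toSubgraph_le {G : SimpleGraph V} {u v : V}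
    {p : G.Walk u v} (hp : p.IsPath) (w : V) : (p.toSubgraph.neighborSet w).ncard ≤ 2 := by
  by_cases hn : p.Nil
  · have : p.toSubgraph.neighborSet w = ∅ := by
      ext x
      simp only [Subgraph.mem_neighborSet, Set.mem_empty_iff_false, iff_false]
      exact fun h => p.not_nil_of_adj_toSubgraph h hn
    simp [this]
  by_cases hw : w ∈ p.support
  · obtain ⟨i, rfl, hi⟩ := Walk.mem_support_iff_exists_getVert.1 hw
    rcases Nat.eq_zero_or_pos i with rfl | h0
    · rw [Walk.getVert_zero, hp.neighborSet_toSubgraph_startpoint hn]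
      simp
    · rcases hi.eq_or_lt with rfl | hlt
      · rw [Walk.getVert_length, hp.neighborSet_toSubgraph_endpoint hn]
        simp
      · exact (hp.ncard_neighborSet_toSubgraph_internal_eq_two h0.ne' hlt).le
  · have : p.toSubgraph.neighborSet w = ∅ := by
      ext x
      simp only [Subgraph.mem_neighborSet, Set.mem_empty_iff_false, iff_false]
      exact fun h => hw (Walk.mem_support_of_adj_toSubgraph h)
    simp [this]

theorem Subgraph.Connected.sup_iSup {G : SimpleGraph V} {ι : Type*} {T : G.Subgraph}
    (hT : T.Connected) {P : ι → G.Subgraph} (hP : ∀ i, (P i).Connected)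
    (hTP : ∀ i, (T ⊓ P i).verts.Nonempty) : (T ⊔ ⨆ i, P i).Connected := by
  obtain ⟨t, ht⟩ := hT.nonempty
  rw [Subgraph.connected_iff', connected_iff_exists_forall_reachable]
  refine ⟨⟨t, Or.inl ht⟩, ?_⟩
  rintro ⟨v, hv | hv⟩
  · exact Reachable.map (Subgraph.inclusion (le_sup_left : T ≤ T ⊔ ⨆ i, P i))
      (hT.preconnected ⟨t, ht⟩ ⟨v, hv⟩)
  · simp only [Subgraph.verts_iSup, Set.mem_iUnion] at hv
    obtain ⟨i, hi⟩ := hv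
    have := Subgraph.connected_sup hT.preconnected (hP i).preconnected (hTP i)
    exact Reachable.map
      (Subgraph.inclusion (sup_le_sup_left (le_iSup P i) T : T ⊔ P i ≤ T ⊔ ⨆ i, P i))
      (this.preconnected ⟨t, Or.inl ht⟩ ⟨v, Or.inr hi⟩)

/-- Attaching to a connected subgraph `T` disjoint nontrivial paths that meet `T` only in their
first vertices. -/
theorem Subgraph.Connected.exists_attach [Finite V] {G : SimpleGraph V} {T : G.Subgraph}
    (hT : T.Connected) {I : Set V} (a : V → V) (p : ∀ s, G.Walk (a s) s)
    (ha : ∀ s ∈ I, a s ∈ T.verts) (hp : ∀ s ∈ I, (p s).IsPath)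
    (hpT : ∀ s ∈ I, ∀ v ∈ (p s).support, v ∈ T.verts → v = a s) (hs : ∀ s ∈ I, s ∉ T.verts)
    (hd : ∀ s ∈ I, ∀ t ∈ I, s ≠ t → ∀ v ∈ (p s).support, v ∉ (p t).support) :
    ∃ T' : G.Subgraph, T'.Connected ∧ (∀ v ∈ T.verts, v ∈ T'.verts) ∧
      (∀ v ∈ T'.verts, v ∈ T.verts ∨ ∃ s ∈ I, v ∈ (p s).support) ∧
      (∀ s ∈ I, s ∈ T'.verts ∧ (T'.neighborSet s).ncard ≤ 1) ∧
      (∀ v ∈ T.verts, (∀ s ∈ I, v ≠ a s) → T'.neighborSet v = T.neighborSet v) ∧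
      (∀ v ∈ T.verts, (T'.neighborSet v).ncard ≤ (T.neighborSet v).ncard + 1) ∧
      ∀ v, v ∉ T.verts → (T'.neighborSet v).ncard ≤ 2 := by
  classical
  have hnil : ∀ s ∈ I, ¬ (p s).Nil := fun s hsI hn => hs s hsI (hn.eq ▸ ha s hsI)
  have hnbr : ∀ v, (T ⊔ ⨆ s : I, (p s).toSubgraph).neighborSet v =
      T.neighborSet v ∪ ⋃ s : I, (p s).toSubgraph.neighborSet v := by
    intro v
    rw [Subgraph.neighborSet_sup, Subgraph.neighborSet_iSup]
  have hoff : ∀ s : I, ∀ v, v ∉ (p s).support → (p s).toSubgraph.neighborSet v = ∅ := by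
    intro s v hv
    ext x
    simp only [Subgraph.mem_neighborSet, Set.mem_empty_iff_false, iff_false]
    exact fun h => hv (Walk.mem_support_of_adj_toSubgraph h)
  have hon : ∀ s ∈ I, ∀ v ∈ (p s).support,
      (⋃ t : I, (p t).toSubgraph.neighborSet v) = (p s).toSubgraph.neighborSet v := by
    intro s hsI v hv
    refine subset_antisymm (Set.iUnion_subset fun t => ?_)
      (Set.subset_iUnion (fun t : I => (p t).toSubgraph.neighborSet v) ⟨s, hsI⟩)
    by_cases hst : s = t
    · subst hst
      exact subset_rfl
    · rw [hoff t v (hd s hsI t t.2 hst v hv)]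
      exact Set.empty_subset _
  have hnone : ∀ v, (∀ s ∈ I, v ∉ (p s).support) →
      (⋃ t : I, (p t).toSubgraph.neighborSet v) = ∅ := by
    intro v hv
    simp only [Set.iUnion_eq_empty]
    exact fun t => hoff t v (hv t t.2)
  have hTn : ∀ v, v ∉ T.verts → T.neighborSet v = ∅ := by
    intro v hv
    ext x
    simp only [Subgraph.mem_neighborSet, Set.mem_empty_iff_false, iff_false]
    exact fun h => hv h.fst_mem
  refine ⟨T ⊔ ⨆ s : I, (p s).toSubgraph, hT.sup_iSup (fun s => (p s).toSubgraph_connected)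
    (fun s => ⟨a s, ha s s.2, (p s).start_mem_verts_toSubgraph⟩), fun v hv => Or.inl hv,
    ?_, ?_, ?_, ?_, ?_⟩
  · rintro v (hv | hv)
    · exact Or.inl hv
    · simp only [Subgraph.verts_iSup, Set.mem_iUnion] at hv
      obtain ⟨s, hv⟩ := hv
      exact Or.inr ⟨s, s.2, (p s).mem_verts_toSubgraph.1 hv⟩
  · intro s hsI
    refine ⟨Or.inr ?_, ?_⟩
    · simp only [Subgraph.verts_iSup, Set.mem_iUnion]
      exact ⟨⟨s, hsI⟩, (p s).end_mem_verts_toSubgraph⟩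
    · rw [hnbr, hTn s (hs s hsI), hon s hsI s (p s).end_mem_support, Set.empty_union,
        (hp s hsI).neighborSet_toSubgraph_endpoint (hnil s hsI)]
      simp
  · intro v hv hva
    rw [hnbr, hnone v fun s hsI hvs => hva s hsI (hpT s hsI v hvs hv), Set.union_empty]
  · intro v hv
    rw [hnbr]
    refine (Set.ncard_union_le _ _).trans (Nat.add_le_add_left ?_ _)
    by_cases h : ∃ s ∈ I, v ∈ (p s).support
    · obtain ⟨s, hsI, hvs⟩ := h
      rw [hon s hsI v hvs]
      obtain rfl := hpT s hsI v hvs hv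
      rw [(hp s hsI).neighborSet_toSubgraph_startpoint (hnil s hsI)]
      simp
    · push Not at h
      rw [hnone v h]
      simp
  · intro v hv
    rw [hnbr, hTn v hv, Set.empty_union]
    by_cases h : ∃ s ∈ I, v ∈ (p s).support
    · obtain ⟨s, hsI, hvs⟩ := h
      rw [hon s hsI v hvs]
      exact (hp s hsI).ncard_neighborSet_toSubgraph_le v
    · push Not at h
      rw [hnone v h]
      simp

/-- A connected subgraph contains a tree with the same vertices. -/
theorem Subgraph.Connected.exists_isTree_le {G : SimpleGraph V} {T : G.Subgraph}
    (hT : T.Connected) : ∃ T' ≤ T, T'.verts = T.verts ∧ T'.coe.IsTree := by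
  obtain ⟨F, hF, hFt⟩ := SimpleGraph.Connected.exists_isTree_le hT.coe
  let T' : G.Subgraph :=
    { verts := T.verts
      Adj := fun u v => ∃ (hu : u ∈ T.verts) (hv : v ∈ T.verts), F.Adj ⟨u, hu⟩ ⟨v, hv⟩
      adj_sub := fun ⟨_, _, h⟩ => T.adj_sub (hF h)
      edge_vert := fun ⟨hu, _, _⟩ => hu
      symm := ⟨fun _ _ ⟨hu, hv, h⟩ => ⟨hv, hu, h.symm⟩⟩ }
  refine ⟨T', ⟨le_rfl, fun u v ⟨_, _, h⟩ => hF h⟩, rfl, ?_⟩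
  have : T'.coe = F := by
    ext u v
    exact ⟨fun ⟨_, _, h⟩ => h, fun h => ⟨u.2, v.2, h⟩⟩
  rw [this]
  exact hFt

end SimpleGraph

section Mesh

variable {α : Type*}

theorem IsMesh.of_connected [Finite α] {G : SimpleGraph α} {A B : Set α} {q s : ℕ}
    (hAB : A ∪ B = Set.univ) {T : G.Subgraph} (hT : T.Connected) (hTA : T.verts ⊆ A)
    (hnt : T.verts.Nontrivial) (hdeg : ∀ v ∈ T.verts, (T.neighborSet v).ncard ≤ 3)
    (hABT : A ∩ B ⊆ T.verts) (hdeg₂ : ∀ v ∈ A ∩ B, (T.neighborSet v).ncard ≤ 2)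
    (hleaf : ∃ v ∈ A ∩ B, (T.neighborSet v).ncard ≤ 1) (hs : (A ∩ B).ncard = s)
    (hext : ExternallyConnectedIn G B (A ∩ B) (A ∩ B) q) : IsMesh G A B q s := by
  obtain ⟨F, hF, hFv, hFt⟩ := hT.exists_isTree_le
  have hle : ∀ v, (F.neighborSet v).ncard ≤ (T.neighborSet v).ncard := fun v =>
    Set.ncard_le_ncard (fun w hw => hF.2 hw) (Set.toFinite _)
  refine ⟨hAB, F, hFv ▸ hTA, hFt, fun v hv => (hle v).trans (hdeg v (hFv ▸ hv)), hFv ▸ hABT,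
    fun v hv => (hle v).trans (hdeg₂ v hv), ?_, hs, hext⟩
  obtain ⟨v, hv, hv1⟩ := hleaf
  refine ⟨v, hv, le_antisymm ((hle v).trans hv1) ?_⟩
  have hvF : v ∈ F.verts := hFv ▸ hABT hv
  have : Nontrivial F.verts := Set.nontrivial_coe_sort.2 (hFv ▸ hnt)
  obtain ⟨u, hu⟩ := Subgraph.Preconnected.exists_adj_of_nontrivial ⟨hFt.connected.preconnected⟩
    ⟨v, hvF⟩
  exact (Set.ncard_pos (Set.toFinite _)).2 ⟨u, hu⟩

theorem isMesh_one_of_adj [Finite α] {G : SimpleGraph α} {u v : α} (h : G.Adj u v) (q : ℕ) :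
    IsMesh G {u, v} {u}ᶜ q 1 := by
  have hAB : ({u, v} : Set α) ∩ {u}ᶜ = {v} := by
    ext x
    simp only [Set.mem_inter_iff, Set.mem_insert_iff, Set.mem_singleton_iff, Set.mem_compl_iff]
    constructor
    · rintro ⟨rfl | rfl, hx⟩
      · exact absurd rfl hx
      · rfl
    · rintro rfl
      exact ⟨Or.inr rfl, h.ne'⟩
  have hdeg : ∀ w, ((G.subgraphOfAdj h).neighborSet w).ncard ≤ 1 := by
    intro w
    rw [Set.ncard_le_one (Set.toFinite _)]
    intro a ha b hb
    simp only [Subgraph.mem_neighborSet, subgraphOfAdj_adj, Sym2.eq_iff] at ha hb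
    have := h.ne
    grind
  refine IsMesh.of_connected ?_ (Subgraph.subgraphOfAdj_connected h) (by simp)
    ⟨u, by simp, v, by simp, h.ne⟩ (fun w _ => (hdeg w).trans (by norm_num)) ?_
    (fun w _ => (hdeg w).trans (by norm_num)) ⟨v, ?_, hdeg v⟩ ?_ ?_
  · ext x
    simp only [Set.mem_union, Set.mem_insert_iff, Set.mem_compl_iff, Set.mem_singleton_iff,
      Set.mem_univ, iff_true]
    tauto
  · rw [hAB]
    simp
  · rw [hAB]
    rfl
  · rw [hAB, Set.ncard_singleton]
  · rw [hAB]
    intro X Y hX hY hd hc _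
    have hXe : ∀ x : X, False := by
      rintro ⟨x, hx⟩
      obtain ⟨y, hy⟩ := Finset.card_pos.1 (hc ▸ Finset.card_pos.2 ⟨x, hx⟩)
      have hxv : x = v := hX hx
      have hyv : y = v := hY hy
      subst hxv hyv
      exact Set.disjoint_left.1 hd hx hy
    exact ⟨fun x => (hXe x).elim, fun x => (hXe x).elim, fun x => (hXe x).elim,
      fun x => (hXe x).elim, fun x => (hXe x).elim, fun x => (hXe x).elim⟩

/-- The vertices outside `C` with a neighbour in `C`. -/
def outerBoundary (G : SimpleGraph α) (C : Set α) : Set α :=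
  {w | w ∉ C ∧ ∃ c ∈ C, G.Adj c w}

/-- `C` is the vertex set of a component of `G - U`. -/
structure IsComponentOff (G : SimpleGraph α) (U C : Set α) : Prop where
  nonempty : C.Nonempty
  notMem : ∀ c ∈ C, c ∉ U
  walk : ∀ u ∈ C, ∀ v ∈ C, ∃ p : G.Walk u v, ∀ w ∈ p.support, w ∈ C
  boundary : outerBoundary G C ⊆ U

/-- `(V(G) ∖ C, C ∪ N(C))` is a premesh of order at most `p`, witnessed by the connected
subgraph `T`. -/
structure IsPremesh (G : SimpleGraph α) (p : ℕ) (C : Set α) (T : G.Subgraph) : Prop where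
  connected : T.Connected
  notMem : ∀ v ∈ T.verts, v ∉ C
  boundary : outerBoundary G C ⊆ T.verts
  degree : ∀ v ∈ T.verts, (T.neighborSet v).ncard ≤ 3
  degree_boundary : ∀ v ∈ outerBoundary G C, (T.neighborSet v).ncard ≤ 2
  leaf : ∃ v ∈ outerBoundary G C, (T.neighborSet v).ncard ≤ 1
  card : (outerBoundary G C).ncard ≤ p

/-- `G[U]` has a tree decomposition into bags of size at most `n` such that the components of
`G - U` attach to single bags and define premeshes. -/
def IsMeshDecomposable (G : SimpleGraph α) (p n : ℕ) (U : Set α) : Prop :=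
  ∃ (ι : Type) (_ : Finite ι) (T : SimpleGraph ι) (X : ι → Set α), IsTreeDecompOn G U n T X ∧
    ∀ C, IsComponentOff G U C → (∃ t, outerBoundary G C ⊆ X t) ∧
      (outerBoundary G C = ∅ ∨ ∃ T : G.Subgraph, IsPremesh G p C T)

theorem exists_isComponentOff (G : SimpleGraph α) {U : Set α} {v : α} (hv : v ∉ U) :
    ∃ C, IsComponentOff G U C ∧ v ∈ C := by
  classical
  have hvC : v ∈ {w | ∃ p : G.Walk v w, ∀ x ∈ p.support, x ∉ U} := ⟨.nil, by simpa using hv⟩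
  refine ⟨{w | ∃ p : G.Walk v w, ∀ x ∈ p.support, x ∉ U}, ⟨⟨v, hvC⟩, ?_, ?_, ?_⟩, hvC⟩
  · rintro c ⟨p, hp⟩
    exact hp c p.end_mem_support
  · rintro a ⟨p, hp⟩ b ⟨q, hq⟩
    have : ∀ {c} (p : G.Walk v c), (∀ x ∈ p.support, x ∉ U) → ∀ w ∈ p.support,
        ∃ p : G.Walk v w, ∀ x ∈ p.support, x ∉ U := fun p hp w hw =>
      ⟨p.takeUntil w hw, fun x hx => hp x (p.support_takeUntil_subset_support hw hx)⟩
    refine ⟨p.reverse.append q, fun w hw => ?_⟩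
    rw [Walk.mem_support_append_iff, Walk.support_reverse, List.mem_reverse] at hw
    rcases hw with hw | hw
    · exact this p hp w hw
    · exact this q hq w hw
  · rintro w ⟨hw, c, ⟨p, hp⟩, hcw⟩
    by_contra hwU
    refine hw ⟨p.concat hcw, fun x hx => ?_⟩
    rw [Walk.support_concat, List.mem_append, List.mem_singleton] at hx
    rcases hx with hx | rfl
    · exact hp x hx
    · exact hwU

theorem IsMeshDecomposable.extend {G : SimpleGraph α} {p n : ℕ} {U C S : Set α}
    (h : IsMeshDecomposable G p n U) (hC : IsComponentOff G U C) (hSC : S ⊆ C)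
    (hS : S.Nonempty) (hcard : (outerBoundary G C ∪ S).ncard ≤ n)
    (hmesh : ∀ C', IsComponentOff G (U ∪ S) C' → C' ⊆ C →
      outerBoundary G C' ⊆ outerBoundary G C ∪ S → (∃ s ∈ S, s ∈ outerBoundary G C') →
      ∃ T : G.Subgraph, IsPremesh G p C' T) : IsMeshDecomposable G p n (U ∪ S) := by
  obtain ⟨ι, hι, T, X, hTX, hcomp⟩ := h
  obtain ⟨⟨t, ht⟩, -⟩ := hcomp C hC
  have hSU : Disjoint S U := Set.disjoint_left.2 fun s hs => hC.notMem s (hSC hs)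
  refine ⟨Option ι, inferInstance, T.addLeaf t, _, hTX.extend ht hSU ?_ hcard, ?_⟩
  · intro s hs u hu hsu
    exact ⟨fun huC => hC.notMem u huC hu, s, hSC hs, hsu⟩
  intro C' hC'
  by_cases hdisj : ∃ c ∈ C', c ∈ C
  · obtain ⟨c, hcC', hcC⟩ := hdisj
    have hsub : C' ⊆ C := by
      intro v hv
      by_contra hvC
      obtain ⟨r, hr⟩ := hC'.walk c hcC' v hv
      obtain ⟨d, hd, hd1, hd2⟩ := r.exists_boundary_dart C hcC hvC
      have hdU : d.snd ∈ U := hC.boundary ⟨hd2, d.fst, hd1, d.adj⟩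
      exact hC'.notMem d.snd (hr _ (r.dart_snd_mem_support_of_mem_darts hd)) (Or.inl hdU)
    have hbd : outerBoundary G C' ⊆ outerBoundary G C ∪ S := by
      intro w hw
      rcases hC'.boundary hw with hwU | hwS
      · obtain ⟨-, c', hc', hcw⟩ := hw
        exact Or.inl ⟨fun hwC => hC.notMem w hwC hwU, c', hsub hc', hcw⟩
      · exact Or.inr hwS
    refine ⟨⟨none, hbd⟩, Or.inr (hmesh C' hC' hsub hbd ?_)⟩
    obtain ⟨s, hs⟩ := hS
    obtain ⟨r, hr⟩ := hC.walk c hcC s (hSC hs)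
    obtain ⟨d, hd, hd1, hd2⟩ := r.exists_boundary_dart C' hcC'
      fun hsC' => hC'.notMem s hsC' (Or.inr hs)
    have hdb : d.snd ∈ outerBoundary G C' := ⟨hd2, d.fst, hd1, d.adj⟩
    refine ⟨d.snd, (hC'.boundary hdb).resolve_left (hC.notMem _ ?_), hdb⟩
    exact hr _ (r.dart_snd_mem_support_of_mem_darts hd)
  · push Not at hdisj
    have hC'U : IsComponentOff G U C' := by
      refine ⟨hC'.nonempty, fun c hc hcU => hC'.notMem c hc (Or.inl hcU), hC'.walk, ?_⟩
      intro w hw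
      refine (hC'.boundary hw).resolve_right fun hwS => ?_
      obtain ⟨-, c', hc', hcw⟩ := hw
      have : c' ∈ U := hC.boundary ⟨hdisj c' hc', w, hSC hwS, hcw.symm⟩
      exact hC'.notMem c' hc' (Or.inl this)
    obtain ⟨⟨o, ho⟩, hor⟩ := hcomp C' hC'U
    exact ⟨⟨some o, ho⟩, hor⟩

theorem isPremesh_singletonSubgraph {G : SimpleGraph α} {p : ℕ} (hp : 1 ≤ p) {C : Set α} {v : α}
    (hC : outerBoundary G C ⊆ {v}) (hv : v ∈ outerBoundary G C) :
    IsPremesh G p C (G.singletonSubgraph v) := by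
  refine ⟨Subgraph.singletonSubgraph_connected, ?_, by simpa using hC, by simp, by simp,
    ⟨v, hv, by simp⟩, ?_⟩
  · rintro w rfl
    exact hv.1
  · refine (Set.ncard_le_ncard hC (Set.finite_singleton v)).trans ?_
    simpa using hp

theorem IsPremesh.exists_of_adj_leaf [Finite α] {G : SimpleGraph α} {p : ℕ} {C C' : Set α}
    {T : G.Subgraph} (hT : IsPremesh G p C T) (hp : (outerBoundary G C).ncard < p) {u c : α}
    (hu : u ∈ outerBoundary G C) (hu1 : (T.neighborSet u).ncard ≤ 1) (hc : c ∈ C)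
    (huc : G.Adj u c) (hC' : C' ⊆ C) (hbd : outerBoundary G C' ⊆ insert c (outerBoundary G C))
    (hcC' : c ∈ outerBoundary G C') : ∃ T' : G.Subgraph, IsPremesh G p C' T' := by
  classical
  have key : ∀ s, ∃ (a : α) (r : G.Walk a s), s = c → a = u ∧ r.IsPath ∧
      ∀ v ∈ r.support, v = u ∨ v = c := by
    intro s
    by_cases hs : s = c
    · subst hs
      exact ⟨u, huc.toWalk, fun _ => ⟨rfl, by simp [huc.ne], by simp⟩⟩
    · exact ⟨s, .nil, fun h => absurd h hs⟩
  choose a r har using key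
  obtain ⟨hau, hpath, hsupp⟩ := har c rfl
  have hcT : c ∉ T.verts := fun h => hT.notMem c h hc
  obtain ⟨T', hconn, hTT', hT'T, hI, heq, hle, h2⟩ := hT.connected.exists_attach (I := {c}) a r
    (by rintro s rfl; exact hau ▸ hT.boundary hu) (by rintro s rfl; exact hpath)
    (by
      rintro s rfl v hv hvT
      rcases hsupp v hv with rfl | rfl
      · exact hau.symm
      · exact absurd hvT hcT)
    (by rintro s rfl; exact hcT) (by rintro s rfl t rfl h; exact absurd rfl h)
  have hTu : ∀ v ∈ T.verts, v ≠ u → T'.neighborSet v = T.neighborSet v := fun v hv hvu =>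
    heq v hv (by rintro s rfl; exact hau ▸ hvu)
  obtain ⟨hcT', hc1⟩ := hI c rfl
  refine ⟨T', hconn, ?_, ?_, ?_, ?_, ⟨c, hcC', hc1⟩, ?_⟩
  · intro v hv hvC'
    rcases hT'T v hv with hv | ⟨s, rfl, hv⟩
    · exact hT.notMem v hv (hC' hvC')
    · rcases hsupp v hv with rfl | rfl
      · exact hu.1 (hC' hvC')
      · exact hcC'.1 hvC'
  · intro v hv
    rcases hbd hv with rfl | hv
    · exact hcT'
    · exact hTT' v (hT.boundary hv)
  · intro v hv
    by_cases hvT : v ∈ T.verts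
    · by_cases hvu : v = u
      · subst hvu
        have := hle v hvT
        omega
      · rw [hTu v hvT hvu]
        exact hT.degree v hvT
    · exact (h2 v hvT).trans (by norm_num)
  · intro v hv
    rcases hbd hv with rfl | hv
    · omega
    · have hvT := hT.boundary hv
      by_cases hvu : v = u
      · subst hvu
        have := hle v hvT
        omega
      · rw [hTu v hvT hvu]
        exact hT.degree_boundary v hv
  · have := Set.ncard_le_ncard hbd (Set.toFinite _)
    have := Set.ncard_insert_le c (outerBoundary G C)
    omega

/-- The subgraph of the edges of `G[C ∪ R]` that have an end in `C`. -/
def externalGraph (G : SimpleGraph α) (C R : Set α) : SimpleGraph α where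
  Adj u v := G.Adj u v ∧ (u ∈ C ∨ v ∈ C) ∧ (u ∈ C ∨ u ∈ R) ∧ (v ∈ C ∨ v ∈ R)
  symm := ⟨fun _ _ ⟨h, h1, h2, h3⟩ => ⟨h.symm, h1.symm, h3, h2⟩⟩
  loopless := ⟨fun _ h => h.1.ne rfl⟩

theorem externalGraph_le (G : SimpleGraph α) (C R : Set α) : externalGraph G C R ≤ G :=
  fun _ _ h => h.1

theorem mem_of_mem_support_externalGraph {G : SimpleGraph α} {C R : Set α} {u v : α}
    (p : (externalGraph G C R).Walk u v) (hu : u ∈ C ∨ u ∈ R) :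
    ∀ w ∈ p.support, w ∈ C ∨ w ∈ R := by
  induction p with
  | nil => simpa using hu
  | cons e p ih =>
    intro w hw
    rw [Walk.support_cons, List.mem_cons] at hw
    rcases hw with rfl | hw
    · exact hu
    · exact ih e.2.2.2 w hw

theorem exists_walk_externalGraph {G : SimpleGraph α} {C R : Set α} {u v : α} (p : G.Walk u v)
    (hp : ∀ w ∈ p.support, w ∈ C) :
    ∃ q : (externalGraph G C R).Walk u v, q.support = p.support := by
  induction p with
  | nil => exact ⟨.nil, rfl⟩
  | @cons u x v e p ih =>
    obtain ⟨q, hq⟩ := ih fun w hw => hp w (by simp [hw])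
    have hu : u ∈ C := hp u (by simp)
    have hx : x ∈ C := hp x (by simp)
    have e' : (externalGraph G C R).Adj u x := ⟨e, Or.inl hu, Or.inl hu, Or.inl hx⟩
    exact ⟨.cons e' q, by rw [Walk.support_cons, Walk.support_cons, hq]⟩

/-- A connected part of `C` avoiding a separator does not attach to both separated sets. -/
theorem not_boundary_of_separates {G : SimpleGraph α} {C D R Y Z S : Set α} (hDC : D ⊆ C)
    (hD : ∀ u ∈ D, ∀ v ∈ D, ∃ p : G.Walk u v, ∀ w ∈ p.support, w ∈ D)
    (hDS : ∀ d ∈ D, d ∉ S) (hYR : Y ⊆ R) (hZR : Z ⊆ R)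
    (hsep : (externalGraph G C R).Separates Y Z S) {y z : α} (hy : y ∈ Y) (hyS : y ∉ S)
    (hyD : y ∈ outerBoundary G D) (hz : z ∈ Z) (hzS : z ∉ S) (hzD : z ∈ outerBoundary G D) :
    False := by
  obtain ⟨-, c, hc, hcy⟩ := hyD
  obtain ⟨-, d, hd, hdz⟩ := hzD
  obtain ⟨p, hp⟩ := hD c hc d hd
  obtain ⟨r, hr⟩ := exists_walk_externalGraph (R := R) p fun w hw => hDC (hp w hw)
  have e1 : (externalGraph G C R).Adj y c :=
    ⟨hcy.symm, Or.inr (hDC hc), Or.inr (hYR hy), Or.inl (hDC hc)⟩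
  have e2 : (externalGraph G C R).Adj d z :=
    ⟨hdz, Or.inl (hDC hd), Or.inl (hDC hd), Or.inr (hZR hz)⟩
  obtain ⟨w, hwS, hw⟩ := hsep y hy z hz (.cons e1 (r.concat e2))
  rw [Walk.support_cons, List.mem_cons, Walk.support_concat, List.mem_append,
    List.mem_singleton, hr] at hw
  rcases hw with rfl | hw | rfl
  · exact hyS hwS
  · exact hDS w (hp w hw) hwS
  · exact hzS hwS

theorem IsPremesh.exists_of_separates [Finite α] {G : SimpleGraph α} {p : ℕ}
    {C C' R : Set α} {T : G.Subgraph} (hT : IsPremesh G p C T) (hp : (outerBoundary G C).ncard ≤ p)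
    {Y Z S : Finset α} (hY : (Y : Set α) ⊆ outerBoundary G C)
    (hZ : (Z : Set α) ⊆ outerBoundary G C) (hR : ∀ r ∈ R, r ∈ Y ∨ r ∈ Z)
    (hYR : (Y : Set α) ⊆ R) (hSY : S.card ≤ Y.card) {a b : α → α}
    (P : ∀ s, (externalGraph G C R).Walk (a s) (b s))
    (hsep : (externalGraph G C R).Separates Y Z S)
    (hP : ∀ s ∈ S, a s ∈ Y ∧ s ∈ (P s).support)
    (hd : ∀ s ∈ S, ∀ t ∈ S, s ≠ t → ∀ v ∈ (P s).support, v ∉ (P t).support)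
    (hC' : C' ⊆ C) (hbd : outerBoundary G C' ⊆ outerBoundary G C ∪ {s | s ∈ S ∧ s ∈ C})
    (hSC' : ∃ s ∈ S, s ∈ C ∧ s ∈ outerBoundary G C')
    (hYC' : ∀ y ∈ Y, y ∈ outerBoundary G C' → y ∈ S) :
    ∃ T' : G.Subgraph, IsPremesh G p C' T' := by
  classical
  have key : ∀ s, ∃ (c : α) (r : (externalGraph G C R).Walk c s), s ∈ S → c ∈ Y ∧ r.IsPath ∧
      (∀ v ∈ r.support, v ∈ (P s).support) ∧ ∀ v ∈ r.support, v ∈ Y → v = c := by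
    intro s
    by_cases hs : s ∈ S
    · obtain ⟨haY, hsP⟩ := hP s hs
      obtain ⟨c, hcY, r, hr, hrc⟩ := ((P s).takeUntil s hsP).reverse.exists_prefix_to Y
        ⟨a s, haY, by simp⟩
      refine ⟨c, r.reverse.bypass, fun _ => ⟨hcY, Walk.bypass_isPath _, fun v hv => ?_,
        fun v hv hvY => ?_⟩⟩
      · have hv := Walk.support_bypass_subset_support _ hv
        have hv := hr v (by simpa using hv)
        rw [Walk.support_reverse, List.mem_reverse] at hv
        exact (P s).support_takeUntil_subset_support hsP hv
      · have hv := Walk.support_bypass_subset_support _ hv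
        exact hrc v (by simpa using hv) hvY
    · exact ⟨s, .nil, fun h => absurd h hs⟩
  choose c r hr using key
  have hcC : ∀ s ∈ S, c s ∉ C := fun s hs => (hY (hr s hs).1).1
  have honly : ∀ s ∈ S, ∀ v ∈ (r s).support, v ∈ S → v = s := by
    intro s hs v hv hvS
    by_contra hne
    exact hd v hvS s hs hne v (hP v hvS).2 ((hr s hs).2.2.1 v hv)
  have hmem : ∀ s ∈ S, s ∈ C → ∀ v ∈ (r s).support, v ∈ C ∨ v = c s := by
    intro s hs hsC v hv
    obtain ⟨hcY, hpath, -, hvc⟩ := hr s hs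
    rcases mem_of_mem_support_externalGraph (r s) (Or.inr (hYR hcY)) v hv with hvC | hvR
    · exact Or.inl hvC
    rcases hR v hvR with hvY | hvZ
    · exact Or.inr (hvc v hv hvY)
    · obtain ⟨w, hwS, hw⟩ := hsep _ hcY _ hvZ ((r s).takeUntil v hv)
      obtain rfl := honly s hs w ((r s).support_takeUntil_subset_support hv hw) hwS
      have hvw : v ≠ w := fun h => (hZ hvZ).1 (h ▸ hsC)
      exact absurd hw (Walk.endpoint_notMem_support_takeUntil hpath hv hvw.symm)
  have hcbd : ∀ s ∈ S, s ∈ C → c s ∉ outerBoundary G C' := by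
    intro s hs hsC hcs
    have := honly s hs (c s) (r s).start_mem_support (hYC' _ (hr s hs).1 hcs)
    exact hcC s hs (by rw [this]; exact hsC)
  have hoff : ∀ s ∈ S, s ∈ C → s ∈ outerBoundary G C' → ∀ v ∈ (r s).support, v ∉ C' := by
    intro s hs hsC hsC' v hv hvC'
    have hvs : v ≠ s := fun h => hsC'.1 (h ▸ hvC')
    obtain ⟨d, hdd, hd1, hd2⟩ := ((r s).takeUntil v hv).exists_boundary_dart C'ᶜ
      (fun h => hcC s hs (hC' h)) (by simpa using hvC')
    have hd2 : d.snd ∈ C' := by simpa using hd2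
    have hdt := Walk.dart_fst_mem_support_of_mem_darts _ hdd
    have hdr := (r s).support_takeUntil_subset_support hv hdt
    have hds : d.fst ≠ s := fun h =>
      Walk.endpoint_notMem_support_takeUntil (hr s hs).2.1 hv hvs.symm (h ▸ hdt)
    have hdb : d.fst ∈ outerBoundary G C' := ⟨hd1, d.snd, hd2, d.adj.1.symm⟩
    rcases hbd hdb with h | h
    · rcases hmem s hs hsC _ hdr with h' | h'
      · exact h.1 h'
      · exact hcbd s hs hsC (h' ▸ hdb)
    · exact hds (honly s hs _ hdr h.1)
  obtain ⟨T', hconn, hTT', hT'T, hI, heq, hle, h2⟩ := hT.connected.exists_attach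
    (I := {s | s ∈ S ∧ s ∈ C ∧ s ∈ outerBoundary G C'}) c
    (fun s => (r s).mapLe (externalGraph_le G C R))
    (fun s hs => hT.boundary (hY (hr s hs.1).1))
    (fun s hs => (hr s hs.1).2.1.mapLe _)
    (fun s hs v hv hvT => (hmem s hs.1 hs.2.1 v (by simpa using hv)).resolve_left
      (hT.notMem v hvT))
    (fun s hs hsT => hT.notMem s hsT hs.2.1)
    (fun s hs t ht hst v hvs hvt => hd s hs.1 t ht.1 hst v
      ((hr s hs.1).2.2.1 v (by simpa using hvs)) ((hr t ht.1).2.2.1 v (by simpa using hvt)))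
  obtain ⟨s₀, hs₀, hs₀C, hs₀C'⟩ := hSC'
  refine ⟨T', hconn, ?_, ?_, ?_, ?_, ⟨s₀, hs₀C', (hI s₀ ⟨hs₀, hs₀C, hs₀C'⟩).2⟩, ?_⟩
  · intro v hv hvC'
    rcases hT'T v hv with hv | ⟨s, hs, hv⟩
    · exact hT.notMem v hv (hC' hvC')
    · exact hoff s hs.1 hs.2.1 hs.2.2 v (by simpa using hv) hvC'
  · intro v hv
    rcases hbd hv with h | h
    · exact hTT' v (hT.boundary h)
    · exact (hI v ⟨h.1, h.2, hv⟩).1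
  · intro v hv
    by_cases hvT : v ∈ T.verts
    · by_cases hvc : v ∈ outerBoundary G C
      · have := hle v hvT
        have := hT.degree_boundary v hvc
        omega
      · rw [heq v hvT fun s hs h => hvc (h ▸ hY (hr s hs.1).1)]
        exact hT.degree v hvT
    · exact (h2 v hvT).trans (by norm_num)
  · intro v hv
    rcases hbd hv with h | h
    · rw [heq v (hT.boundary h) fun s hs h => hcbd s hs.1 hs.2.1 (h ▸ hv)]
      exact hT.degree_boundary v h
    · exact (hI v ⟨h.1, h.2, hv⟩).2.trans (by norm_num)
  · have hsub : outerBoundary G C' ⊆ (outerBoundary G C \ Y) ∪ S := by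
      intro v hv
      rcases hbd hv with h | h
      · by_cases hvY : v ∈ Y
        · exact Or.inr (hYC' v hvY hv)
        · exact Or.inl ⟨h, hvY⟩
      · exact Or.inr h.1
    have h1 := Set.ncard_le_ncard hsub (Set.toFinite _)
    have h2 := Set.ncard_union_le (outerBoundary G C \ Y) S
    have h3 := Set.ncard_sdiff_add_ncard_of_subset hY (Set.toFinite _)
    rw [Set.ncard_coe_finset] at h2 h3
    omega

theorem SimpleGraph.Walk.IsPath.ne_of_mem_tail_dropLast {G : SimpleGraph α} {u v w : α}
    {p : G.Walk u v} (hp : p.IsPath) (hw : w ∈ p.support.tail.dropLast) : w ≠ u ∧ w ≠ v := by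
  have hnd := hp.support_nodup
  constructor
  · rintro rfl
    rw [← Walk.cons_tail_support] at hnd
    exact (List.nodup_cons.1 hnd).1 (List.mem_of_mem_dropLast hw)
  · rintro rfl
    rw [← List.tail_dropLast] at hw
    have hw := List.mem_of_mem_tail hw
    rw [← Walk.dropLast_support_concat] at hnd
    exact (List.nodup_append.1 hnd).2.2 _ hw _ (by simp) rfl

/-- Disjoint walks indexed by a set `S` with one vertex on each: the indices inject into any set
that contains all the starting points. -/
theorem card_le_of_disjoint_walks {H : SimpleGraph α} {S Y : Finset α} {a b : α → α}
    (P : ∀ s, H.Walk (a s) (b s)) (ha : ∀ s ∈ S, a s ∈ Y)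
    (hd : ∀ s ∈ S, ∀ t ∈ S, s ≠ t → ∀ v ∈ (P s).support, v ∉ (P t).support) :
    S.card ≤ Y.card := by
  refine Finset.card_le_card_of_injOn a ha fun s hs t ht hst => ?_
  by_contra hne
  exact hd s hs t ht hne (a s) (P s).start_mem_support
    (by rw [hst]; exact (P t).start_mem_support)

theorem exists_paths_of_card_eq {G : SimpleGraph α} {C : Set α} {Y Z S : Finset α}
    (hY : (Y : Set α) ⊆ outerBoundary G C) (hYZ : Y.card = Z.card) (hSY : S.card = Y.card)
    {a b : α → α} (P : ∀ s, (externalGraph G C (Y ∪ Z)).Walk (a s) (b s))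
    (ha : ∀ s ∈ S, a s ∈ Y) (hb : ∀ s ∈ S, b s ∈ Z)
    (hZ : (Z : Set α) ⊆ outerBoundary G C)
    (hd : ∀ s ∈ S, ∀ t ∈ S, s ≠ t → ∀ v ∈ (P s).support, v ∉ (P t).support) :
    ∃ p : (x : Y) → Σ y : Z, G.Walk x.1 y.1,
      (∀ x, (p x).2.IsPath) ∧
      (∀ x, ∀ v ∈ (p x).2.support, v ∈ C ∪ outerBoundary G C) ∧
      (Pairwise fun x₁ x₂ => ∀ v, v ∈ (p x₁).2.support → v ∉ (p x₂).2.support) ∧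
      (∀ x, ∀ v ∈ (p x).2.support.tail.dropLast,
        v ∉ outerBoundary G C ∪ outerBoundary G C) ∧
      (∀ x, ∀ u v : α, s(u, v) ∈ (p x).2.edges →
        ¬(u ∈ outerBoundary G C ∪ outerBoundary G C ∧
          v ∈ outerBoundary G C ∪ outerBoundary G C)) := by
  classical
  rw [Set.union_self]
  have hinj : ∀ s ∈ S, ∀ t ∈ S, ∀ v ∈ (P s).support, v ∈ (P t).support → s = t := by
    intro s hs t ht v hvs hvt
    by_contra hne
    exact hd s hs t ht hne v hvs hvt
  have hsurj : ∀ y ∈ Y, ∃ s ∈ S, a s = y := by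
    have := Finset.surjOn_of_injOn_of_card_le a (s := S) (t := Y) ha
      (fun s hs t ht hst => hinj s hs t ht (a s) (P s).start_mem_support
        (by rw [hst]; exact (P t).start_mem_support)) hSY.ge
    exact fun y hy => this hy
  have hsurj' : ∀ z ∈ Z, ∃ s ∈ S, b s = z := by
    have := Finset.surjOn_of_injOn_of_card_le b (s := S) (t := Z) hb
      (fun s hs t ht hst => hinj s hs t ht (b s) (P s).end_mem_support
        (by rw [hst]; exact (P t).end_mem_support)) (by omega)
    exact fun y hy => this hy
  have key : ∀ x : Y, ∃ (s : α) (y : Z) (r : (externalGraph G C (Y ∪ Z)).Walk x.1 y.1),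
      s ∈ S ∧ a s = x ∧ b s = y ∧ r.IsPath ∧ ∀ v ∈ r.support, v ∈ (P s).support := by
    rintro ⟨x, hx⟩
    obtain ⟨s, hs, rfl⟩ := hsurj x hx
    exact ⟨s, ⟨b s, hb s hs⟩, (P s).bypass, hs, rfl, rfl, Walk.bypass_isPath _,
      fun v hv => Walk.support_bypass_subset_support _ hv⟩
  choose s y r hs has hbs hr hrP using key
  refine ⟨fun x => ⟨y x, (r x).mapLe (externalGraph_le G C _)⟩, fun x => (hr x).mapLe _,
    fun x v hv => ?_, fun x₁ x₂ hne v h1 h2 => ?_, fun x v hv hvb => ?_, fun x u v huv hb => ?_⟩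
  · rcases mem_of_mem_support_externalGraph (r x) (Or.inr (Or.inl x.2)) v (by simpa using hv)
      with h | h | h
    · exact Or.inl h
    · exact Or.inr (hY h)
    · exact Or.inr (hZ h)
  · refine hne (Subtype.ext ?_)
    rw [← has x₁, ← has x₂, hinj _ (hs x₁) _ (hs x₂) v (hrP x₁ v (by simpa using h1))
      (hrP x₂ v (by simpa using h2))]
  · have hv : v ∈ (r x).support.tail.dropLast := by simpa using hv
    have hvr : v ∈ (r x).support := List.mem_of_mem_tail (List.mem_of_mem_dropLast hv)
    obtain ⟨hvx, hvy⟩ := (hr x).ne_of_mem_tail_dropLast hv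
    rcases mem_of_mem_support_externalGraph (r x) (Or.inr (Or.inl x.2)) v hvr with h | h | h
    · exact hvb.1 h
    · obtain ⟨t, ht, rfl⟩ := hsurj v h
      rw [← has x, hinj _ ht _ (hs x) _ (P t).start_mem_support (hrP x _ hvr)] at hvx
      exact hvx rfl
    · obtain ⟨t, ht, rfl⟩ := hsurj' v h
      rw [← hbs x, hinj _ ht _ (hs x) _ (P t).end_mem_support (hrP x _ hvr)] at hvy
      exact hvy rfl
  · have huv : s(u, v) ∈ (r x).edges := by simpa using huv
    rcases ((r x).adj_of_mem_edges huv).2.1 with h | h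
    · exact hb.1.1 h
    · exact hb.2.1 h

/-- A set of `p` boundary vertices that is not externally `q`-connected has a small separation. -/
theorem exists_separates_of_no_mesh [Finite α] {G : SimpleGraph α} {p q : ℕ} {C : Set α}
    {T : G.Subgraph} (hmesh : ∀ A B : Set α, ¬ IsMesh G A B q p) (hT : IsPremesh G p C T)
    (hp : 2 ≤ p) (hcard : (outerBoundary G C).ncard = p) :
    ∃ (Y Z S : Finset α) (a b : α → α) (P : ∀ s, (externalGraph G C (Y ∪ Z)).Walk (a s) (b s)),
      (Y : Set α) ⊆ outerBoundary G C ∧ (Z : Set α) ⊆ outerBoundary G C ∧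
      Y.card = Z.card ∧ Y.card ≤ q ∧ S.card < Y.card ∧
      (externalGraph G C (Y ∪ Z)).Separates Y Z S ∧
      (∀ s ∈ S, a s ∈ Y ∧ b s ∈ Z ∧ s ∈ (P s).support) ∧
      ∀ s ∈ S, ∀ t ∈ S, s ≠ t → ∀ v ∈ (P s).support, v ∉ (P t).support := by
  have hAB : Cᶜ ∩ (C ∪ outerBoundary G C) = outerBoundary G C := by
    ext v
    constructor
    · rintro ⟨h, h' | h'⟩
      · exact absurd h' h
      · exact h'
    · exact fun h => ⟨h.1, Or.inr h⟩
  have hnt : T.verts.Nontrivial := by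
    refine (Set.one_lt_ncard_iff_nontrivial.1 ?_).mono hT.boundary
    omega
  have hext : ¬ ExternallyConnectedIn G (C ∪ outerBoundary G C) (outerBoundary G C)
      (outerBoundary G C) q := by
    intro hext
    refine hmesh Cᶜ (C ∪ outerBoundary G C) (IsMesh.of_connected ?_ hT.connected hT.notMem hnt
      hT.degree ?_ ?_ ?_ ?_ ?_)
    · rw [← Set.union_assoc, Set.compl_union_self, Set.univ_union]
    all_goals rw [hAB]
    · exact hT.boundary
    · exact hT.degree_boundary
    · exact hT.leaf
    · exact hcard
    · exact hext
  unfold ExternallyConnectedIn at hext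
  push Not at hext
  obtain ⟨Y, Z, hY, hZ, -, hYZ, hYq, hno⟩ := hext
  obtain ⟨S, a, b, P, hsep, hP, hd⟩ :=
    exists_separates_linked (externalGraph G C (Y ∪ Z)) Y Z
  refine ⟨Y, Z, S, a, b, P, hY, hZ, hYZ, hYq, ?_, hsep, hP, hd⟩
  refine (card_le_of_disjoint_walks P (fun s hs => (hP s hs).1) hd).lt_of_ne fun hSY => ?_
  obtain ⟨r, h1, h2, h3, h4, h5⟩ := exists_paths_of_card_eq hY hYZ hSY P
    (fun s hs => (hP s hs).1) (fun s hs => (hP s hs).2.1) hZ hd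
  obtain ⟨x, u, v, huv, hu, hv⟩ := hno r h1 h2 h3 h4
  exact h5 x u v huv ⟨hu, hv⟩

theorem IsMeshDecomposable.exists_larger [Finite α] {G : SimpleGraph α} {p q : ℕ} (hq : 1 ≤ q)
    (hpq : q ≤ p) (hmesh : ∀ A B : Set α, ¬ IsMesh G A B q p) {U : Set α}
    (h : IsMeshDecomposable G p (p + q - 1) U) (hU : U ≠ Set.univ) :
    ∃ U', U ⊂ U' ∧ IsMeshDecomposable G p (p + q - 1) U' := by
  classical
  obtain ⟨v, hv⟩ := (Set.ne_univ_iff_exists_notMem U).1 hU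
  obtain ⟨C, hC, hvC⟩ := exists_isComponentOff G hv
  suffices ∃ S ⊆ C, S.Nonempty ∧ IsMeshDecomposable G p (p + q - 1) (U ∪ S) by
    obtain ⟨S, hSC, ⟨s, hs⟩, hS⟩ := this
    exact ⟨U ∪ S, Set.ssubset_iff_of_subset Set.subset_union_left |>.2
      ⟨s, Or.inr hs, hC.notMem s (hSC hs)⟩, hS⟩
  have hor : outerBoundary G C = ∅ ∨ ∃ T : G.Subgraph, IsPremesh G p C T := by
    obtain ⟨ι, hι, T, X, -, hcomp⟩ := h
    exact (hcomp C hC).2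
  rcases hor with hemp | ⟨T, hT⟩
  · refine ⟨{v}, by simpa using hvC, ⟨v, rfl⟩, h.extend hC (by simpa using hvC) ⟨v, rfl⟩ ?_ ?_⟩
    · rw [hemp, Set.empty_union, Set.ncard_singleton]
      omega
    · rintro C' - - hsub ⟨s, rfl, hs⟩
      rw [hemp, Set.empty_union] at hsub
      exact ⟨_, isPremesh_singletonSubgraph (hq.trans hpq) hsub hs⟩
  rcases hT.card.lt_or_eq with hlt | hcard
  · obtain ⟨u, hu, hu1⟩ := hT.leaf
    obtain ⟨-, c, hc, hcu⟩ := id hu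
    refine ⟨{c}, by simpa using hc, ⟨c, rfl⟩, h.extend hC (by simpa using hc) ⟨c, rfl⟩ ?_ ?_⟩
    · have := Set.ncard_union_le (outerBoundary G C) {c}
      rw [Set.ncard_singleton] at this
      omega
    · rintro C' - hsub hbd ⟨s, rfl, hs⟩
      rw [Set.union_singleton] at hbd
      exact hT.exists_of_adj_leaf hlt hu hu1 hc hcu.symm hsub hbd hs
  obtain rfl | hp : p = 1 ∨ 2 ≤ p := by omega
  · obtain ⟨u, -, c, -, hcu⟩ := hT.leaf.imp fun _ h => h.1
    exact absurd (isMesh_one_of_adj hcu q) (hmesh _ _)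
  obtain ⟨Y, Z, S, a, b, P, hY, hZ, hYZ, hYq, hSY, hsep, hP, hd⟩ :=
    exists_separates_of_no_mesh hmesh hT hp hcard
  have hYR : (Y : Set α) ⊆ Y ∪ Z := Set.subset_union_left
  have hZR : (Z : Set α) ⊆ Y ∪ Z := Set.subset_union_right
  have hne : ∃ s ∈ S, s ∈ C := by
    by_contra! hSC
    obtain ⟨y, hy, hyS⟩ := Finset.exists_mem_notMem_of_card_lt_card hSY
    obtain ⟨z, hz, hzS⟩ := Finset.exists_mem_notMem_of_card_lt_card (hYZ ▸ hSY)
    exact not_boundary_of_separates subset_rfl hC.walk (fun d hd hdS => hSC d hdS hd) hYR hZR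
      hsep hy hyS (hY hy) hz hzS (hZ hz)
  refine ⟨{s | s ∈ S ∧ s ∈ C}, fun s hs => hs.2, hne, h.extend hC (fun s hs => hs.2) hne ?_ ?_⟩
  · have h1 := Set.ncard_union_le (outerBoundary G C) {s | s ∈ S ∧ s ∈ C}
    have h2 := Set.ncard_le_ncard (show {s | s ∈ S ∧ s ∈ C} ⊆ (S : Set α) from fun s hs => hs.1)
      (Set.toFinite _)
    rw [Set.ncard_coe_finset] at h2
    omega
  · rintro C' hC' hsub hbd ⟨s, ⟨hs, hsC⟩, hsC'⟩
    have hC'S : ∀ d ∈ C', d ∉ (S : Set α) := fun d hd hdS =>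
      hC'.notMem d hd (Or.inr ⟨hdS, hsub hd⟩)
    by_cases hYC' : ∀ y ∈ Y, y ∈ outerBoundary G C' → y ∈ S
    · exact hT.exists_of_separates hcard.le hY hZ (fun r hr => hr) hYR hSY.le P hsep
        (fun s hs => ⟨(hP s hs).1, (hP s hs).2.2⟩) hd hsub hbd ⟨s, hs, hsC, hsC'⟩ hYC'
    push Not at hYC'
    obtain ⟨y, hy, hyC', hyS⟩ := hYC'
    refine hT.exists_of_separates hcard.le hZ hY (fun r hr => hr.symm) hZR (hYZ ▸ hSY.le)
      (fun s => (P s).reverse) hsep.symm (fun s hs => ⟨(hP s hs).2.1, by simp [hP s hs]⟩)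
      (by simpa using hd) hsub hbd ⟨s, hs, hsC, hsC'⟩ fun z hz hzC' => ?_
    by_contra hzS
    exact not_boundary_of_separates hsub hC'.walk hC'S hYR hZR hsep hy hyS hyC' hz hzS hzC'

theorem isMeshDecomposable_empty (G : SimpleGraph α) (p n : ℕ) : IsMeshDecomposable G p n ∅ := by
  refine ⟨Unit, inferInstance, ⊥, fun _ => ∅, ⟨IsTree.of_subsingleton, by simp, by simp, by simp,
    by simp⟩, fun C hC => ⟨⟨(), hC.boundary⟩, Or.inl (Set.subset_empty_iff.1 hC.boundary)⟩⟩

theorem isMeshDecomposable_univ [Finite α] {G : SimpleGraph α} {p q : ℕ} (hq : 1 ≤ q)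
    (hpq : q ≤ p) (hmesh : ∀ A B : Set α, ¬ IsMesh G A B q p) :
    IsMeshDecomposable G p (p + q - 1) Set.univ := by
  obtain ⟨U, hU⟩ := (Set.toFinite {U | IsMeshDecomposable G p (p + q - 1) U}).exists_maximal
    ⟨∅, isMeshDecomposable_empty G p _⟩
  by_cases hUu : U = Set.univ
  · exact hUu ▸ hU.prop
  · obtain ⟨U', hlt, hU'⟩ := IsMeshDecomposable.exists_larger hq hpq hmesh hU.prop hUu
    exact absurd hU' (hU.not_prop_of_gt hlt)

end Mesh

/-- Let `p ≥ q ≥ 1`. If `G` contains no `q`-mesh of order `p`,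
then `tw(G) < p + q − 1`. -/
theorem tw_lt_of_no_mesh {α : Type} [Fintype α] (G : SimpleGraph α) (p q : ℕ)
    (hq : 1 ≤ q) (hpq : q ≤ p)
    (h : ∀ A B : Set α, ¬ IsMesh G A B q p) :
    treewidth G < p + q - 1 := by
  obtain ⟨ι, -, T, X, hTX, -⟩ := isMeshDecomposable_univ hq hpq h
  have hle : treewidth G ≤ p + q - 2 := by
    refine Nat.sInf_le ⟨ι, T, X, hTX.isTree, ⟨fun v => ?_, fun u v huv =>
      hTX.adj u trivial v trivial huv, fun v => hTX.connected v trivial⟩, fun t =>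
      (hTX.card t).trans (by omega)⟩
    obtain ⟨t, ht⟩ := (hTX.connected v trivial).nonempty
    exact ⟨t, ht⟩
  omega
end

section
/- Let k ≥ 2 be an integer, let T be a tree of maximum degree at most 3, and let X ⊆ V(T). Then T has at least ⌊|X|/(2k−1)⌋ − 1 pairwise vertex-disjoint subtrees, each containing at least k vertices of X. -/
open SimpleGraph

/-- The vertices that can be reached from `w` by a walk of `G` staying inside `S`. -/
def reachIn {V : Type*} (G : SimpleGraph V) (S : Set V) (w : V) : Set V :=
  {x | ∃ p : G.Walk w x, ∀ y ∈ p.support, y ∈ S}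

section Connectivity

variable {V : Type*} {G : SimpleGraph V}

lemma exists_walk_of_induce_connected {s : Set V} (h : (G.induce s).Connected) {u v : V}
    (hu : u ∈ s) (hv : v ∈ s) : ∃ p : G.Walk u v, ∀ y ∈ p.support, y ∈ s := by
  obtain ⟨p⟩ := h.preconnected ⟨u, hu⟩ ⟨v, hv⟩
  refine ⟨p.map (Embedding.induce s).toHom, fun y hy => ?_⟩
  obtain ⟨z, -, rfl⟩ := List.mem_map.1 (Walk.support_map _ p ▸ hy)
  exact z.2

lemma induce_connected_of_walks {s : Set V} {u : V} (hu : u ∈ s)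
    (h : ∀ x ∈ s, ∃ p : G.Walk u x, ∀ y ∈ p.support, y ∈ s) : (G.induce s).Connected := by
  refine induce_connected_of_patches u hu fun {x} hx => ?_
  obtain ⟨p, hp⟩ := h x hx
  exact ⟨s, subset_rfl, hu, hx, ⟨p.induce s hp⟩⟩

lemma reachIn_subset {S : Set V} {w : V} : reachIn G S w ⊆ S :=
  fun _ ⟨p, hp⟩ => hp _ p.end_mem_support

lemma mem_reachIn_trans {S : Set V} {w x y : V} (hx : x ∈ reachIn G S w)
    (hy : y ∈ reachIn G S x) : y ∈ reachIn G S w := by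
  obtain ⟨p, hp⟩ := hx
  obtain ⟨q, hq⟩ := hy
  refine ⟨p.append q, fun z hz => ?_⟩
  rcases Walk.mem_support_append_iff _ _ |>.1 hz with hz | hz
  exacts [hp z hz, hq z hz]

lemma mem_reachIn_of_mem_support {S : Set V} {w x y : V} {p : G.Walk w x}
    (hp : ∀ z ∈ p.support, z ∈ S) (hy : y ∈ p.support) : x ∈ reachIn G S y := by
  classical
  exact ⟨p.dropUntil y hy, fun z hz => hp z (p.support_dropUntil_subset_support hy hz)⟩

lemma mem_reachIn_of_mem_support' {S : Set V} {w x y : V} {p : G.Walk w x}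
    (hp : ∀ z ∈ p.support, z ∈ S) (hy : y ∈ p.support) : y ∈ reachIn G S w := by
  classical
  exact ⟨p.takeUntil y hy, fun z hz => hp z (p.support_takeUntil_subset_support hy hz)⟩

lemma induce_reachIn_connected {S : Set V} {w : V} (hw : w ∈ S) :
    (G.induce (reachIn G S w)).Connected := by
  refine induce_connected_of_walks (u := w) ⟨.nil, by simpa using hw⟩ fun x ⟨p, hp⟩ => ?_
  exact ⟨p, fun y hy => mem_reachIn_of_mem_support' hp hy⟩

/-- In a connected set `A`, every vertex `x ≠ v` is joined to `v` by an edge `vw` followed by a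
walk in `A \ {v}`. -/
lemma exists_adj_walk_of_induce_connected {A : Set V} (hA : (G.induce A).Connected) {v x : V}
    (hv : v ∈ A) (hx : x ∈ A) (hxv : x ≠ v) :
    ∃ w, G.Adj v w ∧ ∃ p : G.Walk w x, ∀ y ∈ p.support, y ∈ A \ {v} := by
  classical
  obtain ⟨p, hp⟩ := exists_walk_of_induce_connected hA hv hx
  have hpath := p.bypass_isPath
  have hsub := p.support_bypass_subset_support
  generalize p.bypass = q at hpath hsub
  cases q with
  | nil => exact absurd rfl hxv
  | cons h q =>
    rw [Walk.cons_isPath_iff] at hpath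
    refine ⟨_, h, q, fun y hy => ⟨hp y (hsub (by simp [hy])), ?_⟩⟩
    rintro rfl
    exact hpath.2 hy

/-- Let `A ⊆ C` with `A` connected and `C \ A` empty or connected and adjacent to `v ∈ A`.
Removing from `C` a component of `A \ {v}` leaves a connected set. -/
lemma induce_diff_reachIn_connected {A C : Set V} (hAC : A ⊆ C) (hA : (G.induce A).Connected)
    {v : V} (hv : v ∈ A)
    (hD : C \ A = ∅ ∨ (G.induce (C \ A)).Connected ∧ ∃ b ∈ C \ A, G.Adj v b) (w : V) :
    (G.induce (C \ reachIn G (A \ {v}) w)).Connected := by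
  have hvK : v ∉ reachIn G (A \ {v}) w := fun h => (reachIn_subset h).2 rfl
  refine induce_connected_of_walks (u := v) ⟨hAC hv, hvK⟩ fun x ⟨hxC, hxK⟩ => ?_
  by_cases hxA : x ∈ A
  · obtain rfl | hxv := eq_or_ne x v
    · exact ⟨.nil, by simpa using ⟨hxC, hxK⟩⟩
    obtain ⟨u, huv, p, hp⟩ := exists_adj_walk_of_induce_connected hA hv hxA hxv
    refine ⟨.cons huv p, fun y hy => ?_⟩
    rw [Walk.support_cons, List.mem_cons] at hy
    obtain rfl | hy := hy
    · exact ⟨hAC hv, hvK⟩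
    · exact ⟨hAC (hp y hy).1, fun h =>
        hxK (mem_reachIn_trans h (mem_reachIn_of_mem_support hp hy))⟩
  · obtain hD | ⟨hD, b, hb, hvb⟩ := hD
    · exact absurd (show x ∈ C \ A from ⟨hxC, hxA⟩) (by simp [hD])
    obtain ⟨p, hp⟩ := exists_walk_of_induce_connected hD hb ⟨hxC, hxA⟩
    refine ⟨.cons hvb p, fun y hy => ?_⟩
    rw [Walk.support_cons, List.mem_cons] at hy
    obtain rfl | hy := hy
    · exact ⟨hAC hv, hvK⟩
    · exact ⟨(hp y hy).1, fun h => (hp y hy).2 (reachIn_subset h).1⟩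

end Connectivity

section Packing

variable {V : Type*} [Finite V] {G : SimpleGraph V}

/-- If every component of `A \ {v}` has at most `m` vertices of `X`, then `A` has at most
`1 + d * m` of them, where `d` is the number of neighbours of `v` in `A`. -/
lemma ncard_inter_le_of_reachIn {A X : Set V} (hA : (G.induce A).Connected) {v : V} (hv : v ∈ A)
    {m : ℕ} (hm : ∀ w ∈ G.neighborSet v ∩ A, (reachIn G (A \ {v}) w ∩ X).ncard ≤ m) :
    (A ∩ X).ncard ≤ 1 + (G.neighborSet v ∩ A).ncard * m := by
  classical
  let N : Finset V := (G.neighborSet v ∩ A).toFinite.toFinset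
  have hcover : A ∩ X ⊆ {v} ∪ ⋃ w ∈ N, reachIn G (A \ {v}) w ∩ X := by
    rintro x ⟨hxA, hxX⟩
    obtain rfl | hxv := eq_or_ne x v
    · exact Or.inl rfl
    obtain ⟨u, huv, p, hp⟩ := exists_adj_walk_of_induce_connected hA hv hxA hxv
    refine Or.inr (Set.mem_biUnion (x := u) ?_ ⟨⟨p, hp⟩, hxX⟩)
    simpa [N] using ⟨huv, (hp u p.start_mem_support).1⟩
  calc (A ∩ X).ncard ≤ _ := Set.ncard_le_ncard hcover
    _ ≤ ({v} : Set V).ncard + _ := Set.ncard_union_le _ _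
    _ ≤ 1 + ∑ w ∈ N, (reachIn G (A \ {v}) w ∩ X).ncard := by
        rw [Set.ncard_singleton]
        exact Nat.add_le_add_left (Finset.set_ncard_biUnion_le _ _) _
    _ ≤ 1 + N.card * m := by
        refine Nat.add_le_add_left ?_ _
        rw [← smul_eq_mul]
        exact Finset.sum_le_card_nsmul _ _ _ fun w hw => hm w (by simpa [N] using hw)
    _ = _ := by rw [Set.ncard_eq_toFinset_card _ (Set.toFinite _)]

/-- A connected set `C` with enough vertices of `X` has a connected part `A` containing between
`k` and `2 * k - 1` vertices of `X` and whose removal leaves a connected set. -/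
lemma exists_connected_cut (hdeg : ∀ v, (G.neighborSet v).ncard ≤ 3) {k : ℕ} (hk : 1 ≤ k)
    {C X : Set V} (hC : (G.induce C).Connected) (hX : 2 * (2 * k - 1) ≤ (C ∩ X).ncard) :
    ∃ A ⊆ C, (G.induce A).Connected ∧ (G.induce (C \ A)).Connected ∧
      k ≤ (A ∩ X).ncard ∧ (A ∩ X).ncard ≤ 2 * k - 1 := by
  let P : Set V → Prop := fun A => A ⊆ C ∧ (G.induce A).Connected ∧
    (C \ A = ∅ ∨ (G.induce (C \ A)).Connected) ∧ k ≤ (A ∩ X).ncard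
  obtain ⟨A, ⟨hAC, hA, hD, hkA⟩, hmin⟩ := (Set.toFinite {A | P A}).exists_minimal
    ⟨C, subset_rfl, hC, Or.inl (Set.sdiff_self), by omega⟩
  have key : ∀ v ∈ A, (C \ A = ∅ ∨ (G.induce (C \ A)).Connected ∧ ∃ b ∈ C \ A, G.Adj v b) →
      (A ∩ X).ncard ≤ 1 + (G.neighborSet v ∩ A).ncard * (k - 1) := by
    intro v hv hv'
    refine ncard_inter_le_of_reachIn hA hv fun w ⟨hwv, hwA⟩ => ?_
    by_contra! hlt
    have hKA : reachIn G (A \ {v}) w ⊆ A := reachIn_subset.trans Set.sdiff_subset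
    have hP : P (reachIn G (A \ {v}) w) :=
      ⟨hKA.trans hAC, induce_reachIn_connected ⟨hwA, (G.ne_of_adj hwv).symm⟩,
        Or.inr (induce_diff_reachIn_connected hAC hA hv hv' w), by omega⟩
    exact (reachIn_subset (hmin hP hKA hv)).2 rfl
  have hne : C \ A ≠ ∅ := by
    intro h
    obtain ⟨v, hv⟩ := hA.nonempty
    have h1 := key v hv (Or.inl h)
    have h2 : (G.neighborSet v ∩ A).ncard ≤ 3 :=
      (Set.ncard_le_ncard Set.inter_subset_left).trans (hdeg v)
    have h3 := Nat.mul_le_mul_right (k - 1) h2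
    rw [hAC.antisymm (Set.sdiff_eq_empty.1 h)] at h1 h3
    omega
  have hD' := hD.resolve_left hne
  refine ⟨A, hAC, hA, hD', hkA, ?_⟩
  obtain ⟨a, ha⟩ := hA.nonempty
  obtain ⟨c, hc⟩ := Set.nonempty_iff_ne_empty.2 hne
  obtain ⟨p, hp⟩ := exists_walk_of_induce_connected hC (hAC ha) hc.1
  obtain ⟨d, hd, hdA, hdA'⟩ := p.exists_boundary_dart A ha hc.2
  have hdC : d.snd ∈ C \ A := ⟨hp _ (p.dart_snd_mem_support_of_mem_darts hd), hdA'⟩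
  have h1 := key d.fst hdA (Or.inr ⟨hD', d.snd, hdC, d.adj⟩)
  have h2 : (G.neighborSet d.fst ∩ A).ncard < (G.neighborSet d.fst).ncard :=
    Set.ncard_lt_ncard ⟨Set.inter_subset_left, fun h => hdA' (h d.adj).2⟩
  have h3 := Nat.mul_le_mul_right (k - 1) (Nat.le_of_lt_succ (h2.trans_le (hdeg d.fst)))
  omega

lemma exists_disjoint_connected (hdeg : ∀ v, (G.neighborSet v).ncard ≤ 3) {k : ℕ} (hk : 1 ≤ k)
    {X : Set V} (n : ℕ) {C : Set V} (hC : (G.induce C).Connected)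
    (hX : n * (2 * k - 1) ≤ (C ∩ X).ncard) :
    ∃ S : Fin n → Set V, (∀ i, S i ⊆ C) ∧ (Pairwise fun i j => Disjoint (S i) (S j)) ∧
      (∀ i, (G.induce (S i)).Connected) ∧ ∀ i, k ≤ (S i ∩ X).ncard := by
  induction n generalizing C with
  | zero => exact ⟨fun _ => ∅, fun i => i.elim0, fun i => i.elim0, fun i => i.elim0,
      fun i => i.elim0⟩
  | succ n ih =>
    obtain rfl | hn := Nat.eq_zero_or_pos n
    · exact ⟨fun _ => C, fun _ => subset_rfl, fun i j hij => absurd (Fin.ext (by omega)) hij,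
        fun _ => hC, fun _ => le_trans (by omega) hX⟩
    rw [Nat.succ_mul] at hX
    have hn' : 2 * k - 1 ≤ n * (2 * k - 1) := Nat.le_mul_of_pos_left _ hn
    obtain ⟨A, hAC, hA, hD, hkA, hAk⟩ := exists_connected_cut hdeg hk (X := X) hC (by omega)
    have hsplit : (C ∩ X).ncard ≤ (A ∩ X).ncard + ((C \ A) ∩ X).ncard := by
      rw [← Set.sdiff_union_of_subset hAC, Set.union_inter_distrib_right, add_comm]
      simpa using Set.ncard_union_le ((C \ A) ∩ X) (A ∩ X)
    obtain ⟨S, hSC, hS, hSconn, hSk⟩ := ih hD (by omega)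
    have hAS : ∀ i, Disjoint A (S i) := fun i => Set.disjoint_sdiff_right.mono_right (hSC i)
    refine ⟨Fin.cons A S, Fin.cases hAC fun i => (hSC i).trans Set.sdiff_subset, ?_,
      Fin.cases hA hSconn, Fin.cases hkA hSk⟩
    intro i j hij
    induction i using Fin.cases with
    | zero =>
      induction j using Fin.cases with
      | zero => exact absurd rfl hij
      | succ j => exact hAS j
    | succ i =>
      induction j using Fin.cases with
      | zero => exact (hAS i).symm
      | succ j => exact hS fun h => hij (congrArg Fin.succ h)

end Packing

/-- Let `k ≥ 2`, let `T` be a tree of maximum degree at most `3`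
and `X ⊆ V(T)`. Then `T` has at least `⌊|X|/(2k−1)⌋ − 1` pairwise vertex-disjoint
subtrees, each containing at least `k` vertices of `X`. -/
theorem tree_cut (k : ℕ) (hk : 2 ≤ k) {α : Type} [Fintype α]
    (T : SimpleGraph α) (hT : T.IsTree)
    (hdeg : ∀ v : α, (T.neighborSet v).ncard ≤ 3) (X : Set α) :
    ∃ S : Fin (X.ncard / (2 * k - 1) - 1) → Set α,
      (Pairwise fun i j => Disjoint (S i) (S j)) ∧
      (∀ i, (T.induce (S i)).Connected) ∧
      (∀ i, k ≤ (S i ∩ X).ncard) := by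
  have huniv : (T.induce Set.univ).Connected :=
    (induceUnivIso T).connected_iff.2 hT.connected
  obtain ⟨S, -, hS⟩ := exists_disjoint_connected hdeg (by omega : 1 ≤ k) (X := X)
    (X.ncard / (2 * k - 1) - 1) huniv (by
      rw [Set.univ_inter]
      exact (Nat.mul_le_mul_right _ (Nat.sub_le _ _)).trans (Nat.div_mul_le_self _ _))
  exact ⟨S, hS⟩
end
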